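/- Let Ω ⊆ ℂⁿ be a bounded open set with smooth boundary that is Levi pseudoconvex, and let λ, τ be real-valued functions that are twice continuously differentiable on an open neighborhood of the closure of Ω with τ > 0 on the closure of Ω. Suppose there are constants c₁ > 0 and c₂ > 0 such that Θ_{λ,τ}(z; ξ) ≥ c₁|ξ|²e^{−λ(z)} for all z ∈ Ω and all ξ ∈ ℂⁿ, and e^{−λ(z)}/τ(z) ≥ c₂ for all z in the closure of Ω. Then: (1) for every α = (α₁,…,αₙ) ∈ (L²(Ω))ⁿ that is ∂̄-closed on Ω there exists v ∈ L²(Ω) with ∂̄v = α distributionally on Ω and ‖v‖_{L²(Ω)} ≤ √(2/(c₁c₂)) · ‖α‖; and (2) for every f ∈ D(∂̄) that is orthogonal in L²(Ω) to every element of N(∂̄), one has ‖f‖ ≤ √(2/(c₁c₂)) · ‖∂̄f‖. -/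

import Mathlib

open MeasureTheory Complex Metric Set

noncomputable section

/-- The Wirtinger derivative `∂φ/∂z̄_j` of `φ : ℂⁿ → ℂ`:
`(1/2)(Dφ_z(e_j) + i·Dφ_z(i·e_j))`. -/
def dbarCoord (n : ℕ) (φ : (Fin n → ℂ) → ℂ) (j : Fin n) (z : Fin n → ℂ) : ℂ :=
  (1 / 2) * (fderiv ℝ φ z (Pi.single j 1) + Complex.I * fderiv ℝ φ z (Pi.single j Complex.I))

/-- A test function on `Ω`: smooth with compact support contained in `Ω`. -/
def IsTest (n : ℕ) (Ω : Set (Fin n → ℂ)) (φ : (Fin n → ℂ) → ℂ) : Prop :=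
  ContDiff ℝ (⊤ : ℕ∞) φ ∧ HasCompactSupport φ ∧ tsupport φ ⊆ Ω

/-- `∂̄u = α` distributionally on `Ω`. -/
def DbarEq (n : ℕ) (Ω : Set (Fin n → ℂ)) (u : (Fin n → ℂ) → ℂ)
    (α : Fin n → (Fin n → ℂ) → ℂ) : Prop :=
  ∀ j : Fin n, ∀ φ : (Fin n → ℂ) → ℂ, IsTest n Ω φ →
    ∫ z in Ω, α j z * φ z = - ∫ z in Ω, u z * dbarCoord n φ j z

/-- `α` is `∂̄`-closed on `Ω`. -/
def DbarClosed (n : ℕ) (Ω : Set (Fin n → ℂ)) (α : Fin n → (Fin n → ℂ) → ℂ) : Prop :=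
  ∀ j k : Fin n, ∀ φ : (Fin n → ℂ) → ℂ, IsTest n Ω φ →
    ∫ z in Ω, α j z * dbarCoord n φ k z = ∫ z in Ω, α k z * dbarCoord n φ j z

/-- The complex Hessian `Hf(z;ξ) = (1/4)(D²f_z(ξ,ξ) + D²f_z(iξ,iξ))`. -/
def hessC (n : ℕ) (f : (Fin n → ℂ) → ℝ) (z ξ : Fin n → ℂ) : ℝ :=
  (1 / 4) * (iteratedFDeriv ℝ 2 f z ![ξ, ξ]
    + iteratedFDeriv ℝ 2 f z ![Complex.I • ξ, Complex.I • ξ])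

/-- The pairing `⟨∂f(z), ξ⟩ = (1/2)(Df_z(ξ) − i·Df_z(iξ))`. -/
def delPair (n : ℕ) (f : (Fin n → ℂ) → ℝ) (z ξ : Fin n → ℂ) : ℂ :=
  (1 / 2) * ((fderiv ℝ f z ξ : ℂ) - Complex.I * (fderiv ℝ f z (Complex.I • ξ) : ℂ))

/-- Squared Euclidean norm of `ξ ∈ ℂⁿ`. -/
def enormSq (n : ℕ) (ξ : Fin n → ℂ) : ℝ := ∑ j, Complex.normSq (ξ j)

/-- The twisted curvature expression
`Θ_{λ,τ}(z;ξ) = τ(z)·Hλ(z;ξ) − Hτ(z;ξ) − τ(z)⁻¹·|⟨∂τ(z),ξ⟩|²`. -/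
def Theta (n : ℕ) (lam tau : (Fin n → ℂ) → ℝ) (z ξ : Fin n → ℂ) : ℝ :=
  tau z * hessC n lam z ξ - hessC n tau z ξ - (tau z)⁻¹ * Complex.normSq (delPair n tau z ξ)

/-- `Φ` is an exhaustion function of `Ω`: every sublevel set has compact closure inside `Ω`. -/
def ExhaustsOn (n : ℕ) (Ω : Set (Fin n → ℂ)) (Φ : (Fin n → ℂ) → ℝ) : Prop :=
  ∀ c : ℝ, IsCompact (closure {z ∈ Ω | Φ z < c}) ∧ closure {z ∈ Ω | Φ z < c} ⊆ Ω

/-- `Ω` is pseudoconvex: it admits a smooth plurisubharmonic exhaustion function. -/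
def Pseudoconvex (n : ℕ) (Ω : Set (Fin n → ℂ)) : Prop :=
  ∃ Φ : (Fin n → ℂ) → ℝ, ContDiffOn ℝ (⊤ : ℕ∞) Φ Ω ∧ (∀ z ∈ Ω, ∀ ξ, 0 ≤ hessC n Φ z ξ) ∧
    ExhaustsOn n Ω Φ

/-- `r` is a smooth defining function for `Ω` which is Levi pseudoconvex. -/
def IsLeviDefiningFn (n : ℕ) (Ω : Set (Fin n → ℂ)) (r : (Fin n → ℂ) → ℝ) : Prop :=
  ContDiff ℝ (⊤ : ℕ∞) r ∧ Ω = {z | r z < 0} ∧ (∀ z, r z = 0 → fderiv ℝ r z ≠ 0) ∧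
    (∀ p, r p = 0 → ∀ ξ, delPair n r p ξ = 0 → 0 ≤ hessC n r p ξ)

open scoped Topology ContDiff ComplexConjugate

/-- The first order operator `(1/2)(D(e_j) + c·D(i·e_j))`; it is `∂/∂z̄_j` for `c = i` and
`∂/∂z_j` for `c = -i`. -/
def wirt {n : ℕ} (c : ℂ) (f : (Fin n → ℂ) → ℂ) (j : Fin n) (z : Fin n → ℂ) : ℂ :=
  (1 / 2) * (fderiv ℝ f z (Pi.single j 1) + c * fderiv ℝ f z (Pi.single j Complex.I))

/-- The complexification of a real valued function. -/
def cplx {n : ℕ} (f : (Fin n → ℂ) → ℝ) (z : Fin n → ℂ) : ℂ := (f z : ℂ)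

section Wirtinger

variable {n : ℕ} {c d : ℂ} {f g : (Fin n → ℂ) → ℂ} {j k : Fin n} {z : Fin n → ℂ}

lemma dbarCoord_eq_wirt (f : (Fin n → ℂ) → ℂ) (j : Fin n) (z : Fin n → ℂ) :
    dbarCoord n f j z = wirt Complex.I f j z := rfl

lemma wirt_add (hf : DifferentiableAt ℝ f z) (hg : DifferentiableAt ℝ g z) :
    wirt c (fun x => f x + g x) j z = wirt c f j z + wirt c g j z := by
  simp only [wirt]
  rw [fderiv_fun_add hf hg]
  simp only [add_apply]
  ring

lemma wirt_sub (hf : DifferentiableAt ℝ f z) (hg : DifferentiableAt ℝ g z) :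
    wirt c (fun x => f x - g x) j z = wirt c f j z - wirt c g j z := by
  simp only [wirt]
  rw [fderiv_fun_sub hf hg]
  simp only [sub_apply]
  ring

lemma wirt_mul (hf : DifferentiableAt ℝ f z) (hg : DifferentiableAt ℝ g z) :
    wirt c (fun x => f x * g x) j z = f z * wirt c g j z + wirt c f j z * g z := by
  simp only [wirt]
  rw [fderiv_fun_mul hf hg]
  simp only [add_apply, smul_apply, smul_eq_mul]
  ring

lemma wirt_const_mul (a : ℂ) (hf : DifferentiableAt ℝ f z) :
    wirt c (fun x => a * f x) j z = a * wirt c f j z := by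
  simp only [wirt]
  rw [fderiv_const_mul hf]
  simp only [smul_apply, smul_eq_mul]
  ring

lemma wirt_congr (h : f =ᶠ[𝓝 z] g) : wirt c f j z = wirt c g j z := by
  simp only [wirt, h.fderiv_eq]

lemma wirt_conj (f : (Fin n → ℂ) → ℂ) (c : ℂ) (j : Fin n) (z : Fin n → ℂ) :
    wirt c (fun x => conj (f x)) j z = conj (wirt (conj c) f j z) := by
  have h : fderiv ℝ (fun x => conj (f x)) z
      = (Complex.conjCLE : ℂ →L[ℝ] ℂ).comp (fderiv ℝ f z) :=
    Complex.conjCLE.comp_fderiv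
  simp only [wirt, h, map_mul, map_add, map_div₀, map_one, map_ofNat, Complex.conj_conj]
  rfl

lemma contDiff_wirt {m l : ℕ∞ω} (hf : ContDiff ℝ l f) (hml : m + 1 ≤ l) :
    ContDiff ℝ m (wirt c f j) := by
  have h := hf.fderiv_right hml
  unfold wirt
  fun_prop

lemma continuous_wirt (hf : ContDiff ℝ 1 f) : Continuous (wirt c f j) :=
  (contDiff_wirt (m := 0) hf (by simp)).continuous

lemma wirt_eq_zero_of_notMem_tsupport (h : z ∉ tsupport f) : wirt c f j z = 0 := by
  have : f =ᶠ[𝓝 z] fun _ => 0 := notMem_tsupport_iff_eventuallyEq.mp h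
  rw [wirt_congr this]
  simp [wirt]

lemma tsupport_wirt_subset : tsupport (wirt c f j) ⊆ tsupport f :=
  closure_minimal (fun _ hz => by_contra fun h => hz (wirt_eq_zero_of_notMem_tsupport h))
    (isClosed_tsupport f)

lemma hasCompactSupport_wirt (hf : HasCompactSupport f) : HasCompactSupport (wirt c f j) :=
  hf.mono' (fun _ hz => by_contra fun h => hz (wirt_eq_zero_of_notMem_tsupport h))

lemma integral_fderiv_eq_zero (hf : ContDiff ℝ 1 f) (hc : HasCompactSupport f) (v : Fin n → ℂ) :
    ∫ z, fderiv ℝ f z v = 0 := by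
  have hd : Continuous (fun z => fderiv ℝ f z v) :=
    (hf.continuous_fderiv (by simp)).clm_apply continuous_const
  have hdc : HasCompactSupport (fun z => fderiv ℝ f z v) := hc.fderiv_apply ℝ v
  have := integral_mul_fderiv_eq_neg_fderiv_mul_of_integrable (μ := volume)
    (f := fun _ : Fin n → ℂ => (1 : ℂ)) (g := f) (v := v)
    (by simp) (by simpa using hd.integrable_of_hasCompactSupport hdc)
    (by simpa using hf.continuous.integrable_of_hasCompactSupport hc)
    (fun x _ => by fun_prop) (fun x _ => (hf.differentiable (by simp)) x)
  simpa using this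

lemma integrable_wirt (hf : ContDiff ℝ 1 f) (hc : HasCompactSupport f) :
    Integrable (wirt c f j) :=
  (continuous_wirt hf).integrable_of_hasCompactSupport (hasCompactSupport_wirt hc)

lemma integral_wirt_eq_zero (hf : ContDiff ℝ 1 f) (hc : HasCompactSupport f) :
    ∫ z, wirt c f j z = 0 := by
  have hd : ∀ v, Integrable (fun z => fderiv ℝ f z v) := fun v =>
    ((hf.continuous_fderiv (by simp)).clm_apply continuous_const).integrable_of_hasCompactSupport
      (hc.fderiv_apply ℝ v)
  simp only [wirt]
  rw [integral_const_mul, integral_add (hd _) ((hd _).const_mul _), integral_const_mul,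
    integral_fderiv_eq_zero hf hc, integral_fderiv_eq_zero hf hc]
  simp

lemma integral_mul_wirt (hf : ContDiff ℝ 1 f) (hg : ContDiff ℝ 1 g) (hc : HasCompactSupport g) :
    ∫ z, f z * wirt c g j z = - ∫ z, wirt c f j z * g z := by
  have h1 : ∫ z, wirt c (fun x => f x * g x) j z = 0 :=
    integral_wirt_eq_zero (hf.mul hg) hc.mul_left
  have h2 : ∀ z, wirt c (fun x => f x * g x) j z = f z * wirt c g j z + wirt c f j z * g z :=
    fun z => wirt_mul (hf.differentiable (by simp) z) (hg.differentiable (by simp) z)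
  simp only [h2] at h1
  rw [integral_add] at h1
  · exact eq_neg_of_add_eq_zero_left h1
  · exact (hf.continuous.mul (continuous_wirt hg)).integrable_of_hasCompactSupport
      (hasCompactSupport_wirt hc).mul_left
  · exact ((continuous_wirt hf).mul hg.continuous).integrable_of_hasCompactSupport hc.mul_left

lemma fderiv_wirt (hf : ContDiff ℝ 2 f) (v : Fin n → ℂ) :
    fderiv ℝ (wirt c f j) z v = (1 / 2) * (fderiv ℝ (fderiv ℝ f) z v (Pi.single j 1)
      + c * fderiv ℝ (fderiv ℝ f) z v (Pi.single j Complex.I)) := by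
  have hd : DifferentiableAt ℝ (fderiv ℝ f) z :=
    (hf.fderiv_right (m := 1) (by norm_num)).differentiable (by simp) z
  have h1 : ∀ w : Fin n → ℂ, fderiv ℝ (fun x => fderiv ℝ f x w) z v
      = fderiv ℝ (fderiv ℝ f) z v w := fun w => by
    rw [fderiv_clm_apply hd (differentiableAt_const _)]
    simp
  have hdw : ∀ w : Fin n → ℂ, DifferentiableAt ℝ (fun x => fderiv ℝ f x w) z := fun w =>
    hd.clm_apply (differentiableAt_const _)
  unfold wirt
  rw [fderiv_const_mul ((hdw _).fun_add ((hdw _).const_mul c)), smul_apply,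
    fderiv_fun_add (hdw _) ((hdw _).const_mul c), add_apply,
    fderiv_const_mul (hdw _), smul_apply, h1, h1]
  rfl

lemma wirt_comm (hf : ContDiff ℝ 2 f) :
    wirt c (wirt d f k) j z = wirt d (wirt c f j) k z := by
  have hs : ∀ v w, fderiv ℝ (fderiv ℝ f) z v w = fderiv ℝ (fderiv ℝ f) z w v :=
    fun v w => (hf.contDiffAt.isSymmSndFDerivAt (by simp)).eq v w
  rw [wirt, wirt, fderiv_wirt hf, fderiv_wirt hf, fderiv_wirt hf, fderiv_wirt hf,
    hs (Pi.single j 1), hs (Pi.single j 1), hs (Pi.single j Complex.I),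
    hs (Pi.single j Complex.I)]
  ring

lemma fderiv_cplx {f : (Fin n → ℂ) → ℝ} (hf : DifferentiableAt ℝ f z) (v : Fin n → ℂ) :
    fderiv ℝ (cplx f) z v = (fderiv ℝ f z v : ℂ) := by
  have h : HasFDerivAt (cplx f) (Complex.ofRealCLM.comp (fderiv ℝ f z)) z :=
    Complex.ofRealCLM.hasFDerivAt.comp z hf.hasFDerivAt
  rw [h.fderiv]
  rfl

lemma contDiff_cplx {m : ℕ∞ω} {f : (Fin n → ℂ) → ℝ} (hf : ContDiff ℝ m f) :
    ContDiff ℝ m (cplx f) := Complex.ofRealCLM.contDiff.comp hf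

/-- Conjugating the coefficient conjugates the derivative of a real function. -/
lemma conj_wirt_cplx (f : (Fin n → ℂ) → ℝ) (c : ℂ) (j : Fin n) (z : Fin n → ℂ) :
    conj (wirt c (cplx f) j z) = wirt (conj c) (cplx f) j z := by
  have h := wirt_conj (cplx f) (conj c) j z
  rw [Complex.conj_conj] at h
  rw [← h]
  congr 1
  funext x
  simp [cplx]

lemma wirt_cplx_comp {f : (Fin n → ℂ) → ℝ} {h : ℝ → ℝ} {h' : ℝ}
    (hf : DifferentiableAt ℝ f z) (hh : HasDerivAt h h' (f z)) :
    wirt c (cplx (fun x => h (f x))) j z = h' * wirt c (cplx f) j z := by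
  have hc : HasFDerivAt (fun x => h (f x)) (h' • fderiv ℝ f z) z :=
    hh.comp_hasFDerivAt z hf.hasFDerivAt
  simp only [wirt, fderiv_cplx hf, fderiv_cplx hc.differentiableAt, hc.fderiv]
  simp
  ring

end Wirtinger

section Hessian

variable {n : ℕ} {z : Fin n → ℂ}

lemma pi_eq_sum_re_im (ξ : Fin n → ℂ) :
    ξ = ∑ j, ((ξ j).re • (Pi.single j 1 : Fin n → ℂ) + (ξ j).im • (Pi.single j Complex.I : Fin n → ℂ)) := by
  conv_lhs => rw [← Finset.univ_sum_single ξ]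
  refine Finset.sum_congr rfl fun j _ => ?_
  ext k
  by_cases h : k = j
  · subst h
    simp
  · simp [h]

lemma I_smul_eq_sum_re_im (ξ : Fin n → ℂ) :
    Complex.I • ξ = ∑ j, ((-(ξ j).im) • (Pi.single j 1 : Fin n → ℂ)
      + (ξ j).re • (Pi.single j Complex.I : Fin n → ℂ)) := by
  conv_lhs => rw [pi_eq_sum_re_im (Complex.I • ξ)]
  simp

lemma delPair_eq_sum (f : (Fin n → ℂ) → ℝ) (hf : DifferentiableAt ℝ f z) (ξ : Fin n → ℂ) :
    delPair n f z ξ = ∑ j, ξ j * wirt (-Complex.I) (cplx f) j z := by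
  have h1 : fderiv ℝ f z ξ = ∑ j, ((ξ j).re * fderiv ℝ f z (Pi.single j 1)
      + (ξ j).im * fderiv ℝ f z (Pi.single j Complex.I)) := by
    conv_lhs => rw [pi_eq_sum_re_im ξ]
    simp
  have h2 : fderiv ℝ f z (Complex.I • ξ) = ∑ j, (-(ξ j).im * fderiv ℝ f z (Pi.single j 1)
      + (ξ j).re * fderiv ℝ f z (Pi.single j Complex.I)) := by
    rw [I_smul_eq_sum_re_im ξ]
    simp
  rw [delPair, h1, h2]
  push_cast
  rw [Finset.mul_sum, ← Finset.sum_sub_distrib, Finset.mul_sum]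
  refine Finset.sum_congr rfl fun j _ => ?_
  simp only [wirt, fderiv_cplx hf]
  conv_rhs => rw [← Complex.re_add_im (ξ j)]
  linear_combination (1 / 2 * (ξ j).im * (fderiv ℝ f z (Pi.single j Complex.I) : ℂ)) *
    Complex.I_sq

lemma hessC_eq_fderiv (f : (Fin n → ℂ) → ℝ) (ξ : Fin n → ℂ) :
    hessC n f z ξ = (1 / 4) * (fderiv ℝ (fderiv ℝ f) z ξ ξ
      + fderiv ℝ (fderiv ℝ f) z (Complex.I • ξ) (Complex.I • ξ)) := by
  simp [hessC, iteratedFDeriv_two_apply]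

lemma fderiv_fderiv_apply {F : Type*} [NormedAddCommGroup F] [NormedSpace ℝ F]
    {f : (Fin n → ℂ) → F} (hd : DifferentiableAt ℝ (fderiv ℝ f) z) (v w : Fin n → ℂ) :
    fderiv ℝ (fun x => fderiv ℝ f x w) z v = fderiv ℝ (fderiv ℝ f) z v w := by
  rw [fderiv_clm_apply hd (differentiableAt_const _)]
  simp

lemma fderiv_fderiv_cplx {f : (Fin n → ℂ) → ℝ} (hf : ContDiff ℝ 2 f) (v w : Fin n → ℂ) :
    fderiv ℝ (fderiv ℝ (cplx f)) z v w = (fderiv ℝ (fderiv ℝ f) z v w : ℂ) := by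
  have hd : DifferentiableAt ℝ (fderiv ℝ f) z :=
    (hf.fderiv_right (m := 1) (by norm_num)).differentiable (by simp) z
  have hd' : DifferentiableAt ℝ (fderiv ℝ (cplx f)) z :=
    ((contDiff_cplx hf).fderiv_right (m := 1) (by norm_num)).differentiable (by simp) z
  have h1 : (fun x => fderiv ℝ (cplx f) x w) = cplx (fun x => fderiv ℝ f x w) := by
    funext x
    exact fderiv_cplx (hf.differentiable (by simp) x) w
  rw [← fderiv_fderiv_apply hd', h1, fderiv_cplx (hd.clm_apply (differentiableAt_const _)),
    fderiv_fderiv_apply hd]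

/-- The complex Hessian in coordinates. -/
lemma hessC_eq_sum {f : (Fin n → ℂ) → ℝ} (hf : ContDiff ℝ 2 f) (ξ : Fin n → ℂ) :
    hessC n f z ξ = (∑ j, ∑ k, wirt Complex.I (wirt (-Complex.I) (cplx f) j) k z
      * (ξ j * conj (ξ k))).re := by
  have hs : ∀ v w, fderiv ℝ (fderiv ℝ f) z v w = fderiv ℝ (fderiv ℝ f) z w v :=
    fun v w => (hf.contDiffAt.isSymmSndFDerivAt (by simp)).eq v w
  rw [hessC_eq_fderiv, Complex.re_sum]
  set B := fderiv ℝ (fderiv ℝ f) z with hB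
  have h1 : B ξ ξ = ∑ j, ∑ k,
      ((ξ j).re * ((ξ k).re * B (Pi.single j 1) (Pi.single k 1)
        + (ξ k).im * B (Pi.single j 1) (Pi.single k Complex.I))
      + (ξ j).im * ((ξ k).re * B (Pi.single j Complex.I) (Pi.single k 1)
        + (ξ k).im * B (Pi.single j Complex.I) (Pi.single k Complex.I))) := by
    conv_lhs => rw [pi_eq_sum_re_im ξ]
    simp only [map_sum, sum_apply, map_add, map_smul, add_apply, smul_apply, smul_eq_mul]
    rw [Finset.sum_comm]
    refine Finset.sum_congr rfl fun k _ => ?_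
    simp only [Finset.mul_sum, ← Finset.sum_add_distrib]
    refine Finset.sum_congr rfl fun j _ => ?_
    ring
  have h2 : B (Complex.I • ξ) (Complex.I • ξ) = ∑ j, ∑ k,
      (-(ξ j).im * (-(ξ k).im * B (Pi.single j 1) (Pi.single k 1)
        + (ξ k).re * B (Pi.single j 1) (Pi.single k Complex.I))
      + (ξ j).re * (-(ξ k).im * B (Pi.single j Complex.I) (Pi.single k 1)
        + (ξ k).re * B (Pi.single j Complex.I) (Pi.single k Complex.I))) := by
    rw [I_smul_eq_sum_re_im ξ]
    simp only [map_sum, sum_apply, map_add, map_smul, add_apply, smul_apply, smul_eq_mul]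
    rw [Finset.sum_comm]
    refine Finset.sum_congr rfl fun k _ => ?_
    simp only [Finset.mul_sum, ← Finset.sum_add_distrib]
    refine Finset.sum_congr rfl fun j _ => ?_
    ring
  rw [h1, h2, ← Finset.sum_add_distrib, Finset.mul_sum]
  refine Finset.sum_congr rfl fun j _ => ?_
  rw [Complex.re_sum, ← Finset.sum_add_distrib, Finset.mul_sum]
  refine Finset.sum_congr rfl fun k _ => ?_
  rw [wirt, fderiv_wirt (contDiff_cplx hf), fderiv_wirt (contDiff_cplx hf)]
  simp only [fderiv_fderiv_cplx hf, ← hB]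
  rw [hs (Pi.single k 1), hs (Pi.single k 1), hs (Pi.single k Complex.I),
    hs (Pi.single k Complex.I)]
  simp
  ring

end Hessian

section KohnMorreyHormander

variable {n : ℕ}

/-- The twisted integration by parts identity for a pair of coefficients. -/
lemma integral_twisted_commutator_eq_zero {T P e u y : (Fin n → ℂ) → ℂ} (hT : ContDiff ℝ 2 T)
    (hP : ContDiff ℝ 2 P) (he : ContDiff ℝ 2 e) (hu : ContDiff ℝ 2 u) (hy : ContDiff ℝ 2 y)
    (huc : HasCompactSupport u) (j k : Fin n) (a b : ℂ)
    (hea : ∀ z, wirt a e j z = - wirt a P j z * e z)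
    (heb : ∀ z, wirt b e k z = - wirt b P k z * e z) {F : (Fin n → ℂ) → ℂ}
    (hF : ∀ z, F z =
      T z * (wirt a u j z - wirt a P j z * u z) * (wirt b y k z - wirt b P k z * y z) * e z
      - T z * wirt b u k z * wirt a y j z * e z
      - (T z * wirt b (wirt a P j) k z - wirt b (wirt a T j) k z) * u z * y z * e z
      + wirt b T k z * y z * (wirt a u j z - wirt a P j z * u z) * e z
      + u z * wirt a T j z * (wirt b y k z - wirt b P k z * y z) * e z) :
    Integrable F ∧ ∫ z, F z = 0 := by
  have wd : ∀ {c : ℂ} {i : Fin n} {f : (Fin n → ℂ) → ℂ}, ContDiff ℝ 2 f →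
      ContDiff ℝ 1 (wirt c f i) := fun hf => contDiff_wirt hf (by norm_num)
  have dd : ∀ {f : (Fin n → ℂ) → ℂ}, ContDiff ℝ 1 f → ∀ z, DifferentiableAt ℝ f z :=
    fun hf z => hf.differentiable (by simp) z
  have le12 : (1 : ℕ∞ω) ≤ 2 := by norm_num
  have hT1 := hT.of_le le12
  have hP1 := hP.of_le le12
  have he1 := he.of_le le12
  have hu1 := hu.of_le le12
  have hy1 := hy.of_le le12
  set A : (Fin n → ℂ) → ℂ := fun z => wirt a u j z - wirt a P j z * u z with hA
  have hA1 : ContDiff ℝ 1 A := (wd hu).sub ((wd hP).mul hu1)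
  have hAc : HasCompactSupport A :=
    (hasCompactSupport_wirt huc).sub huc.mul_left
  have hbuc : HasCompactSupport (wirt b u k) := hasCompactSupport_wirt huc
  set F1 : (Fin n → ℂ) → ℂ := fun z => (T z * A z) * (y z * e z) with hF1
  set F2 : (Fin n → ℂ) → ℂ := fun z => (T z * wirt b u k z) * (y z * e z) with hF2
  set F3 : (Fin n → ℂ) → ℂ := fun z => (u z * wirt a T j z) * (y z * e z) with hF3
  have h1 : ContDiff ℝ 1 F1 := (hT1.mul hA1).mul (hy1.mul he1)
  have h2 : ContDiff ℝ 1 F2 := (hT1.mul (wd hu)).mul (hy1.mul he1)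
  have h3 : ContDiff ℝ 1 F3 := (hu1.mul (wd hT)).mul (hy1.mul he1)
  have c1 : HasCompactSupport F1 := (hAc.mul_left).mul_right
  have c2 : HasCompactSupport F2 := (hbuc.mul_left).mul_right
  have c3 : HasCompactSupport F3 := (huc.mul_right).mul_right
  have hye : ∀ c i z, wirt c (fun x => y x * e x) i z = y z * wirt c e i z + wirt c y i z * e z :=
    fun c i z => wirt_mul (dd hy1 z) (dd he1 z)
  have hFF : F = fun z => wirt b F1 k z - wirt a F2 j z + wirt b F3 k z := by
    funext z
    have e1 : wirt b F1 k z = (T z * A z) * (y z * wirt b e k z + wirt b y k z * e z)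
        + (T z * (wirt b (wirt a u j) k z - (wirt a P j z * wirt b u k z
          + wirt b (wirt a P j) k z * u z)) + wirt b T k z * A z) * (y z * e z) := by
      rw [hF1, wirt_mul ((dd hT1 z).fun_mul (dd hA1 z)) ((dd hy1 z).fun_mul (dd he1 z)), hye,
        wirt_mul (dd hT1 z) (dd hA1 z), hA,
        wirt_sub (dd (wd hu) z) ((dd (wd hP) z).fun_mul (dd hu1 z)),
        wirt_mul (dd (wd hP) z) (dd hu1 z)]
    have e2 : wirt a F2 j z = (T z * wirt b u k z) * (y z * wirt a e j z + wirt a y j z * e z)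
        + (T z * wirt b (wirt a u j) k z + wirt a T j z * wirt b u k z) * (y z * e z) := by
      rw [hF2, wirt_mul ((dd hT1 z).fun_mul (dd (wd hu) z)) ((dd hy1 z).fun_mul (dd he1 z)), hye,
        wirt_mul (dd hT1 z) (dd (wd hu) z), wirt_comm hu]
    have e3 : wirt b F3 k z = (u z * wirt a T j z) * (y z * wirt b e k z + wirt b y k z * e z)
        + (u z * wirt b (wirt a T j) k z + wirt b u k z * wirt a T j z) * (y z * e z) := by
      rw [hF3, wirt_mul ((dd hu1 z).fun_mul (dd (wd hT) z)) ((dd hy1 z).fun_mul (dd he1 z)), hye,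
        wirt_mul (dd hu1 z) (dd (wd hT) z)]
    rw [e1, e2, e3, hF, hea, heb]
    simp only [hA]
    ring
  rw [hFF]
  have i1 := integrable_wirt (c := b) (j := k) h1 c1
  have i2 := integrable_wirt (c := a) (j := j) h2 c2
  have i3 := integrable_wirt (c := b) (j := k) h3 c3
  have i12 : Integrable (fun z => wirt b F1 k z - wirt a F2 j z) := i1.sub i2
  refine ⟨i12.add i3, ?_⟩
  show ∫ z, (wirt b F1 k z - wirt a F2 j z + wirt b F3 k z) = 0
  rw [integral_add i12 i3, integral_sub i1 i2, integral_wirt_eq_zero h1 c1,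
    integral_wirt_eq_zero h2 c2, integral_wirt_eq_zero h3 c3]
  simp

/-- The quadratic form in the twisted Kohn–Morrey–Hörmander inequality; `g` is a form, `p` its
divergence `∑ ∂g_j/∂z_j` and `q` its curl `∂g_k/∂z̄_j - ∂g_j/∂z̄_k`. -/
def kmhForm (φ τ : (Fin n → ℂ) → ℝ) (z g : Fin n → ℂ) (p : ℂ) (q : Fin n → Fin n → ℂ) : ℝ :=
  τ z * Complex.normSq (p - delPair n φ z g) + τ z / 2 * ∑ j, ∑ k, Complex.normSq (q j k)
    + 2 * (delPair n τ z g * conj (p - delPair n φ z g)).re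
    - (τ z * hessC n φ z g - hessC n τ z g)

lemma sum_sum_normSq_sub (x : Fin n → Fin n → ℂ) :
    ∑ j, ∑ k, Complex.normSq (x k j - x j k) = 2 * (∑ j, ∑ k, Complex.normSq (x j k)
      - (∑ j, ∑ k, x j k * conj (x k j)).re) := by
  have h1 : ∀ j k, Complex.normSq (x k j - x j k) = Complex.normSq (x k j)
      + Complex.normSq (x j k) - 2 * (x j k * conj (x k j)).re := fun j k => by
    rw [← Complex.normSq_neg, neg_sub, Complex.normSq_sub]
    ring
  simp only [h1, Finset.sum_sub_distrib, Finset.sum_add_distrib, ← Finset.mul_sum, Complex.re_sum]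
  rw [Finset.sum_comm]
  ring

lemma integral_kmhForm_nonneg_of_contDiff {φ τ : (Fin n → ℂ) → ℝ} (hφ : ContDiff ℝ 2 φ)
    (hτ : ContDiff ℝ 2 τ) (hτ0 : ∀ z, 0 ≤ τ z) {G : Fin n → (Fin n → ℂ) → ℂ}
    (hG : ∀ j, ContDiff ℝ 2 (G j)) (hGc : ∀ j, HasCompactSupport (G j)) :
    0 ≤ ∫ z, Real.exp (-φ z) * kmhForm φ τ z (fun j => G j z)
      (∑ j, wirt (-Complex.I) (G j) j z)
      (fun j k => wirt Complex.I (G k) j z - wirt Complex.I (G j) k z) := by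
  set e : (Fin n → ℂ) → ℂ := cplx (fun z => Real.exp (-φ z)) with he
  have he2 : ContDiff ℝ 2 e := contDiff_cplx (Real.contDiff_exp.comp hφ.neg)
  have hew : ∀ c i z, wirt c e i z = - wirt c (cplx φ) i z * e z := fun c i z => by
    have := wirt_cplx_comp (c := c) (j := i) (hφ.differentiable (by simp) z)
      (h := fun t => Real.exp (-t)) ((Real.hasDerivAt_exp _).comp _ (hasDerivAt_neg (φ z)))
    rw [he, this]
    simp [cplx]
    ring
  have hGs : ∀ j, ContDiff ℝ 2 (fun z => conj (G j z)) := fun j =>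
    Complex.conjCLE.contDiff.comp (hG j)
  let F : Fin n → Fin n → (Fin n → ℂ) → ℂ := fun j k z =>
      (τ z : ℂ) * (wirt (-Complex.I) (G j) j z - wirt (-Complex.I) (cplx φ) j z * G j z)
        * conj (wirt (-Complex.I) (G k) k z - wirt (-Complex.I) (cplx φ) k z * G k z)
        * e z
      - τ z * wirt Complex.I (G j) k z * conj (wirt Complex.I (G k) j z) * e z
      - (τ z * wirt Complex.I (wirt (-Complex.I) (cplx φ) j) k z
          - wirt Complex.I (wirt (-Complex.I) (cplx τ) j) k z) * G j z * conj (G k z) * e z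
      + conj (wirt (-Complex.I) (cplx τ) k z) * conj (G k z)
        * (wirt (-Complex.I) (G j) j z - wirt (-Complex.I) (cplx φ) j z * G j z) * e z
      + G j z * wirt (-Complex.I) (cplx τ) j z
        * conj (wirt (-Complex.I) (G k) k z - wirt (-Complex.I) (cplx φ) k z * G k z) * e z
  have hF : ∀ j k, Integrable (F j k) ∧ ∫ z, F j k z = 0 := fun j k => by
    refine integral_twisted_commutator_eq_zero (contDiff_cplx hτ) (contDiff_cplx hφ) he2 (hG j)
      (hGs k) (hGc j) j k (-Complex.I) Complex.I (hew _ _) (hew _ _) fun z => ?_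
    simp only [F, map_sub, map_mul, wirt_conj, conj_wirt_cplx, map_neg, Complex.conj_I, neg_neg]
    simp only [cplx]
  let S : (Fin n → ℂ) → ℂ := fun z => ∑ j, ∑ k, F j k z
  have hS : Integrable S := integrable_finsetSum _ fun j _ => integrable_finsetSum _ fun k _ =>
    (hF j k).1
  have hS0 : ∫ z, S z = 0 := by
    simp only [S]
    rw [integral_finsetSum _ fun j _ => integrable_finsetSum _ fun k _ => (hF j k).1]
    refine Finset.sum_eq_zero fun j _ => ?_
    rw [integral_finsetSum _ fun k _ => (hF j k).1]
    exact Finset.sum_eq_zero fun k _ => (hF j k).2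
  let R : (Fin n → ℂ) → ℝ := fun z =>
    Real.exp (-φ z) * (τ z * ∑ j, ∑ k, Complex.normSq (wirt Complex.I (G j) k z))
  have hR : Integrable R := by
    refine Continuous.integrable_of_hasCompactSupport ?_ ?_
    · have : ∀ j k, Continuous (wirt Complex.I (G j) k) := fun j k =>
        continuous_wirt ((hG j).of_le (by norm_num))
      have h1 := hφ.continuous
      have h2 := hτ.continuous
      have h3 := Complex.continuous_normSq
      refine (Real.continuous_exp.comp h1.neg).mul (h2.mul ?_)
      exact continuous_finsetSum _ fun j _ => continuous_finsetSum _ fun k _ =>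
        h3.comp (this j k)
    · refine HasCompactSupport.intro (isCompact_iUnion fun j => (hGc j).isCompact)
        (K := ⋃ j, tsupport (G j)) fun z hz => ?_
      simp only [mem_iUnion, not_exists] at hz
      simp [R, wirt_eq_zero_of_notMem_tsupport (hz _)]
  have hpt : ∀ z, Real.exp (-φ z) * kmhForm φ τ z (fun j => G j z)
      (∑ j, wirt (-Complex.I) (G j) j z)
      (fun j k => wirt Complex.I (G k) j z - wirt Complex.I (G j) k z) = (S z).re + R z := by
    intro z
    have hp : (∑ j, wirt (-Complex.I) (G j) j z) - delPair n φ z (fun j => G j z)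
        = ∑ j, (wirt (-Complex.I) (G j) j z - wirt (-Complex.I) (cplx φ) j z * G j z) := by
      rw [delPair_eq_sum _ (hφ.differentiable (by simp) z), Finset.sum_sub_distrib]
      simp only [mul_comm]
    have hq := sum_sum_normSq_sub (fun j k => wirt Complex.I (G j) k z)
    rw [kmhForm, hp, hq, hessC_eq_sum hφ, hessC_eq_sum hτ,
      delPair_eq_sum _ (hτ.differentiable (by simp) z)]
    set δ : Fin n → ℂ :=
      fun j => wirt (-Complex.I) (G j) j z - wirt (-Complex.I) (cplx φ) j z * G j z with hδ
    have hSz : S z = e z * (τ z * ((∑ j, δ j) * conj (∑ j, δ j))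
        - τ z * (∑ j, ∑ k, wirt Complex.I (G j) k z * conj (wirt Complex.I (G k) j z))
        - (τ z * (∑ j, ∑ k, wirt Complex.I (wirt (-Complex.I) (cplx φ) j) k z
            * (G j z * conj (G k z)))
          - ∑ j, ∑ k, wirt Complex.I (wirt (-Complex.I) (cplx τ) j) k z * (G j z * conj (G k z)))
        + (∑ j, δ j) * conj (∑ j, G j z * wirt (-Complex.I) (cplx τ) j z)
        + (∑ j, G j z * wirt (-Complex.I) (cplx τ) j z) * conj (∑ j, δ j)) := by
      rw [map_sum, map_sum, Finset.sum_mul_sum, Finset.sum_mul_sum, Finset.sum_mul_sum]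
      simp only [Finset.mul_sum, ← Finset.sum_sub_distrib, ← Finset.sum_add_distrib, S]
      refine Finset.sum_congr rfl fun j _ => Finset.sum_congr rfl fun k _ => ?_
      simp only [F, hδ, map_sub, map_mul]
      ring
    rw [hSz]
    have hez : e z = (Real.exp (-φ z) : ℂ) := by simp [he, cplx]
    rw [hez, Complex.re_ofReal_mul, Complex.mul_conj]
    simp only [Complex.add_re, Complex.sub_re, Complex.re_ofReal_mul, Complex.ofReal_re, R]
    rw [show ((∑ j, δ j) * conj (∑ j, G j z * wirt (-Complex.I) (cplx τ) j z)).re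
      = ((∑ j, G j z * wirt (-Complex.I) (cplx τ) j z) * conj (∑ j, δ j)).re by
        rw [← Complex.conj_re]; simp only [map_mul, Complex.conj_conj]; rw [mul_comm]]
    ring
  simp only [hpt]
  have hSre : Integrable (fun z => (S z).re) := hS.re
  rw [integral_add hSre hR]
  have : ∫ z, (S z).re = 0 := by
    have := integral_re hS
    simp only [RCLike.re_eq_complex_re] at this
    rw [this, hS0]
    simp
  erw [this, zero_add]
  exact integral_nonneg fun z => by
    have := hτ0 z
    have : 0 ≤ ∑ j, ∑ k, Complex.normSq (wirt Complex.I (G j) k z) :=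
      Finset.sum_nonneg fun j _ => Finset.sum_nonneg fun k _ => Complex.normSq_nonneg _
    simp only [R, Pi.zero_apply]
    positivity

end KohnMorreyHormander

section L2Limits

open Filter

variable {X : Type*} [MeasurableSpace X] {μ : Measure X}

/-- Convergence of a sequence of square-integrable functions in the mean. -/
structure TendstoL2 (μ : Measure X) (A : ℕ → X → ℂ) (A₀ : X → ℂ) : Prop where
  memLp : ∀ k, MemLp (A k) 2 μ
  memLp_lim : MemLp A₀ 2 μ
  tendsto : Tendsto (fun k => eLpNorm (A k - A₀) 2 μ) atTop (𝓝 0)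

namespace TendstoL2

variable {A B : ℕ → X → ℂ} {A₀ B₀ : X → ℂ}

lemma add (hA : TendstoL2 μ A A₀) (hB : TendstoL2 μ B B₀) :
    TendstoL2 μ (fun k x => A k x + B k x) (fun x => A₀ x + B₀ x) where
  memLp k := (hA.memLp k).add (hB.memLp k)
  memLp_lim := hA.memLp_lim.add hB.memLp_lim
  tendsto := by
    refine tendsto_of_tendsto_of_tendsto_of_le_of_le tendsto_const_nhds
      (by simpa using hA.tendsto.add hB.tendsto) (fun _ => zero_le) fun k => ?_
    have : ((fun x => A k x + B k x) - fun x => A₀ x + B₀ x) = (A k - A₀) + (B k - B₀) := by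
      ext x; simp only [Pi.sub_apply, Pi.add_apply]; ring
    rw [this]
    exact eLpNorm_add_le ((hA.memLp k).sub hA.memLp_lim).1 ((hB.memLp k).sub hB.memLp_lim).1
      (by norm_num)

lemma mul_bounded (hA : TendstoL2 μ A A₀) {a : X → ℂ} (ha : AEStronglyMeasurable a μ) {C : ℝ}
    (hC : ∀ x, ‖a x‖ ≤ C) : TendstoL2 μ (fun k x => a x * A k x) (fun x => a x * A₀ x) where
  memLp k := (hA.memLp k).of_le_mul (c := C) (ha.mul (hA.memLp k).1) (ae_of_all _ fun x => by
    rw [norm_mul]; gcongr; exact hC x)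
  memLp_lim := hA.memLp_lim.of_le_mul (c := C) (ha.mul hA.memLp_lim.1) (ae_of_all _ fun x => by
    rw [norm_mul]; gcongr; exact hC x)
  tendsto := by
    have := ENNReal.Tendsto.const_mul (a := ENNReal.ofReal C) hA.tendsto (Or.inr (by simp))
    rw [mul_zero] at this
    refine tendsto_of_tendsto_of_tendsto_of_le_of_le tendsto_const_nhds this
      (fun _ => zero_le) fun k => ?_
    refine eLpNorm_le_mul_eLpNorm_of_ae_le_mul (ae_of_all _ fun x => ?_) 2
    simp only [Pi.sub_apply, ← mul_sub, norm_mul]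
    gcongr
    exact hC x

lemma neg (hA : TendstoL2 μ A A₀) : TendstoL2 μ (fun k x => - A k x) (fun x => - A₀ x) := by
  simpa using hA.mul_bounded (a := fun _ => -1) aestronglyMeasurable_const (C := 1) (by simp)

lemma sub (hA : TendstoL2 μ A A₀) (hB : TendstoL2 μ B B₀) :
    TendstoL2 μ (fun k x => A k x - B k x) (fun x => A₀ x - B₀ x) := by
  simpa only [sub_eq_add_neg] using hA.add hB.neg

lemma zero : TendstoL2 μ (fun _ _ => 0) (fun _ => 0) where
  memLp _ := MemLp.zero'
  memLp_lim := MemLp.zero'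
  tendsto := by
    simp

lemma sum {ι : Type*} (s : Finset ι) {A : ι → ℕ → X → ℂ} {A₀ : ι → X → ℂ}
    (h : ∀ i, TendstoL2 μ (A i) (A₀ i)) :
    TendstoL2 μ (fun k x => ∑ i ∈ s, A i k x) (fun x => ∑ i ∈ s, A₀ i x) := by
  classical
  induction s using Finset.induction_on with
  | empty => simpa using zero
  | insert i s hi ih =>
    simp only [Finset.sum_insert hi]
    exact (h i).add ih

end TendstoL2

/-- Convergence of integrals along a sequence of integrable functions. -/
structure TendstoIntegral (μ : Measure X) (F : ℕ → X → ℝ) (F₀ : X → ℝ) : Prop where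
  integrable : ∀ k, Integrable (F k) μ
  integrable_lim : Integrable F₀ μ
  tendsto : Tendsto (fun k => ∫ x, F k x ∂μ) atTop (𝓝 (∫ x, F₀ x ∂μ))

namespace TendstoIntegral

variable {F G : ℕ → X → ℝ} {F₀ G₀ : X → ℝ}

lemma add (hF : TendstoIntegral μ F F₀) (hG : TendstoIntegral μ G G₀) :
    TendstoIntegral μ (fun k x => F k x + G k x) (fun x => F₀ x + G₀ x) where
  integrable k := (hF.integrable k).add (hG.integrable k)
  integrable_lim := hF.integrable_lim.add hG.integrable_lim
  tendsto := by
    simp only [integral_add (hF.integrable _) (hG.integrable _),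
      integral_add hF.integrable_lim hG.integrable_lim]
    exact hF.tendsto.add hG.tendsto

lemma sub (hF : TendstoIntegral μ F F₀) (hG : TendstoIntegral μ G G₀) :
    TendstoIntegral μ (fun k x => F k x - G k x) (fun x => F₀ x - G₀ x) where
  integrable k := (hF.integrable k).sub (hG.integrable k)
  integrable_lim := hF.integrable_lim.sub hG.integrable_lim
  tendsto := by
    simp only [integral_sub (hF.integrable _) (hG.integrable _),
      integral_sub hF.integrable_lim hG.integrable_lim]
    exact hF.tendsto.sub hG.tendsto

lemma sum {ι : Type*} (s : Finset ι) {F : ι → ℕ → X → ℝ} {F₀ : ι → X → ℝ}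
    (h : ∀ i, TendstoIntegral μ (F i) (F₀ i)) :
    TendstoIntegral μ (fun k x => ∑ i ∈ s, F i k x) (fun x => ∑ i ∈ s, F₀ i x) where
  integrable k := integrable_finsetSum _ fun i _ => (h i).integrable k
  integrable_lim := integrable_finsetSum _ fun i _ => (h i).integrable_lim
  tendsto := by
    simp only [integral_finsetSum _ fun i _ => (h i).integrable _,
      integral_finsetSum _ fun i _ => (h i).integrable_lim]
    exact tendsto_finsetSum _ fun i _ => (h i).tendsto

end TendstoIntegral

lemma TendstoL2.re_mul_conj {A B : ℕ → X → ℂ} {A₀ B₀ : X → ℂ} (hA : TendstoL2 μ A A₀)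
    (hB : TendstoL2 μ B B₀) :
    TendstoIntegral μ (fun k x => (A k x * conj (B k x)).re) (fun x => (A₀ x * conj (B₀ x)).re) := by
  have hfi : ∀ {a b : X → ℂ}, MemLp a 2 μ → MemLp b 2 μ →
      Integrable (fun x => a x * conj (b x)) μ := fun ha hb => ha.integrable_mul hb.star
  have key : ∀ {a b : X → ℂ} (ha : MemLp a 2 μ) (hb : MemLp b 2 μ),
      ∫ x, (a x * conj (b x)).re ∂μ = (inner ℂ hb.toLp ha.toLp).re := fun {a b} ha hb => by
    rw [L2.inner_def]
    have h1 := integral_re (𝕜 := ℂ) (hfi ha hb)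
    simp only [RCLike.re_eq_complex_re] at h1
    rw [h1]
    congr 1
    refine integral_congr_ae ?_
    filter_upwards [ha.coeFn_toLp, hb.coeFn_toLp] with x h2 h3
    simp [h2, h3]
  have htl : ∀ {A : ℕ → X → ℂ} {A₀ : X → ℂ} (h : TendstoL2 μ A A₀),
      Tendsto (fun k => (h.memLp k).toLp) atTop (𝓝 h.memLp_lim.toLp) := fun h =>
    (Lp.tendsto_Lp_iff_tendsto_eLpNorm'' _ h.memLp _ h.memLp_lim).2 h.tendsto
  refine ⟨fun k => (hfi (hA.memLp k) (hB.memLp k)).re, (hfi hA.memLp_lim hB.memLp_lim).re, ?_⟩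
  simp only [key (hA.memLp _) (hB.memLp _), key hA.memLp_lim hB.memLp_lim]
  exact (Complex.continuous_re.tendsto _).comp ((htl hB).inner (htl hA))

end L2Limits

section Mollify

open Filter ENNReal

lemma eLpNorm_two_sq {X : Type*} [MeasurableSpace X] {μ : Measure X} (f : X → ℂ) :
    eLpNorm f 2 μ ^ 2 = ∫⁻ x, ‖f x‖ₑ ^ 2 ∂μ := by
  have := eLpNorm_nnreal_pow_eq_lintegral (μ := μ) (f := f) (p := 2) (by norm_num)
  simpa using this

variable {n : ℕ} {f : (Fin n → ℂ) → ℂ} {ρ : (Fin n → ℂ) → ℝ}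

/-- Convolution of `f` with the real kernel `ρ`. -/
def moll (f : (Fin n → ℂ) → ℂ) (ρ : (Fin n → ℂ) → ℝ) (x : Fin n → ℂ) : ℂ :=
  ∫ s, f s * (ρ (x - s) : ℂ)

lemma moll_eq_convolution : moll f ρ = convolution f (cplx ρ) (ContinuousLinearMap.mul ℝ ℂ) volume :=
  rfl

lemma moll_congr {g : (Fin n → ℂ) → ℂ} (h : f =ᵐ[volume] g) : moll f ρ = moll g ρ := by
  funext x
  refine integral_congr_ae ?_
  filter_upwards [h] with s hs
  rw [hs]

lemma hasCompactSupport_cplx (h : HasCompactSupport ρ) : HasCompactSupport (cplx ρ) :=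
  h.comp_left (g := fun t : ℝ => (t : ℂ)) (by simp)

lemma contDiff_moll (hf : LocallyIntegrable f) {m : ℕ∞} (hρ : ContDiff ℝ m ρ)
    (hc : HasCompactSupport ρ) : ContDiff ℝ m (moll f ρ) := by
  rw [moll_eq_convolution]
  exact (hasCompactSupport_cplx hc).contDiff_convolution_right _ hf (contDiff_cplx hρ)

lemma hasCompactSupport_moll (hf : HasCompactSupport f) (hc : HasCompactSupport ρ) :
    HasCompactSupport (moll f ρ) := by
  rw [moll_eq_convolution]
  exact HasCompactSupport.convolution _ (hcf := hf) (hcg := hasCompactSupport_cplx hc)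

lemma wirt_moll (hf : LocallyIntegrable f) (hρ : ContDiff ℝ 1 ρ) (hc : HasCompactSupport ρ)
    (c : ℂ) (j : Fin n) (x : Fin n → ℂ) :
    wirt c (moll f ρ) j x = - ∫ s, f s * wirt c (cplx fun s => ρ (x - s)) j s := by
  have h := (hasCompactSupport_cplx hc).hasFDerivAt_convolution_right
    (ContinuousLinearMap.mul ℝ ℂ) hf (contDiff_cplx hρ) x
  have hconv : ConvolutionExistsAt f (fderiv ℝ (cplx ρ)) x
      ((ContinuousLinearMap.mul ℝ ℂ).precompR (Fin n → ℂ)) volume :=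
    HasCompactSupport.convolutionExists_right _ ((hasCompactSupport_cplx hc).fderiv ℝ) hf
      ((contDiff_cplx hρ).continuous_fderiv (by simp)) x
  have hv : ∀ v, fderiv ℝ (moll f ρ) x v = ∫ s, f s * fderiv ℝ (cplx ρ) (x - s) v := fun v => by
    rw [moll_eq_convolution, h.fderiv]
    exact ContinuousLinearMap.integral_apply hconv v
  have hi : ∀ v, Integrable (fun s => f s * fderiv ℝ (cplx ρ) (x - s) v) := fun v =>
    hconv.apply_continuousLinearMap v
  have hd : ∀ s v, fderiv ℝ (cplx fun s => ρ (x - s)) s v = - fderiv ℝ (cplx ρ) (x - s) v :=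
    fun s v => by
    have h1 : HasFDerivAt (fun s => x - s) (-(ContinuousLinearMap.id ℝ (Fin n → ℂ))) s :=
      (hasFDerivAt_id s).const_sub x
    have h2 : HasFDerivAt (cplx ρ) (fderiv ℝ (cplx ρ) (x - s)) (x - s) :=
      ((contDiff_cplx hρ).differentiable (by simp) (x - s)).hasFDerivAt
    have h3 := h2.comp s h1
    have h4 : (cplx fun s => ρ (x - s)) = cplx ρ ∘ fun s => x - s := rfl
    rw [h4, h3.fderiv]
    simp
  simp only [wirt, hv, hd]
  rw [← integral_const_mul, ← integral_add (hi _) ((hi _).const_mul _), ← integral_const_mul,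
    ← integral_neg]
  congr 1
  funext s
  ring

lemma eLpNorm_moll_sub_le (hf : MemLp f 2 volume) (hρ : Continuous ρ) (hc : HasCompactSupport ρ)
    (h0 : ∀ x, 0 ≤ ρ x) (h1 : ∫ x, ρ x = 1) {ε : ℝ≥0∞}
    (hε : ∀ t, ρ t ≠ 0 → eLpNorm (fun x => f (x - t) - f x) 2 volume ≤ ε) :
    eLpNorm (moll f ρ - f) 2 volume ≤ ε := by
  wlog hm : StronglyMeasurable f generalizing f
  · have he := hf.1.ae_eq_mk
    have hsub : ∀ t, (fun x => f (x - t) - f x) =ᵐ[volume] fun x => hf.1.mk f (x - t) - hf.1.mk f x :=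
      fun t => ((measurePreserving_sub_right volume t).quasiMeasurePreserving.ae_eq_comp he).sub he
    have := this (hf.ae_eq he) (fun t ht => by rw [← eLpNorm_congr_ae (hsub t)]; exact hε t ht)
      hf.1.stronglyMeasurable_mk
    rw [moll_congr he]
    rwa [eLpNorm_congr_ae (f := moll _ ρ - f) (g := moll (hf.1.mk f) ρ - hf.1.mk f)
      ((ae_eq_refl _).sub he)]
  have hfi : Integrable ρ := hρ.integrable_of_hasCompactSupport hc
  set ν : Measure (Fin n → ℂ) := volume.withDensity (fun x => ENNReal.ofReal (ρ x)) with hν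
  have hprob : IsProbabilityMeasure ν := ⟨by
    rw [hν, withDensity_apply _ MeasurableSet.univ, Measure.restrict_univ,
      ← ofReal_integral_eq_lintegral_ofReal hfi (ae_of_all _ h0), h1, ENNReal.ofReal_one]⟩
  have hρm : Measurable fun x => ENNReal.ofReal (ρ x) := hρ.measurable.ennreal_ofReal
  have hloc : LocallyIntegrable f := hf.locallyIntegrable (by norm_num)
  have hmoll : ∀ x, Integrable (fun t => f (x - t)) ν ∧ moll f ρ x = ∫ t, f (x - t) ∂ν := fun x => by
    have e1 : moll f ρ x = ∫ t, f (x - t) * (ρ t : ℂ) := by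
      rw [moll, ← integral_sub_left_eq_self _ _ x]
      simp
    have e2 : Integrable fun t => f (x - t) * (ρ t : ℂ) := by
      have := HasCompactSupport.convolutionExists_right (ContinuousLinearMap.mul ℝ ℂ)
        (hasCompactSupport_cplx hc) hloc (contDiff_cplx (contDiff_zero.2 hρ)).continuous x
      simpa [cplx] using this.integrable_swap
    constructor
    · rw [hν, integrable_withDensity_iff_integrable_smul' hρm (ae_of_all _ fun _ => by simp)]
      refine e2.congr (ae_of_all _ fun t => ?_)
      simp only [ENNReal.toReal_ofReal (h0 t), Complex.real_smul]
      ring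
    · rw [e1, hν, integral_withDensity_eq_integral_toReal_smul hρm (ae_of_all _ fun _ => by simp)]
      refine integral_congr_ae (ae_of_all _ fun t => ?_)
      simp only [ENNReal.toReal_ofReal (h0 t), Complex.real_smul]
      ring
  have hmeas : Measurable fun p : (Fin n → ℂ) × (Fin n → ℂ) => f (p.1 - p.2) - f p.1 :=
    (hm.measurable.comp (measurable_fst.sub measurable_snd)).sub (hm.measurable.comp measurable_fst)
  have hpt : ∀ x, ‖moll f ρ x - f x‖ₑ ^ 2 ≤ ∫⁻ t, ‖f (x - t) - f x‖ₑ ^ 2 ∂ν := fun x => by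
    have e1 : moll f ρ x - f x = ∫ t, (f (x - t) - f x) ∂ν := by
      rw [integral_sub (hmoll x).1 (integrable_const _), (hmoll x).2]
      simp
    have e2 : ‖∫ t, (f (x - t) - f x) ∂ν‖ₑ ≤ eLpNorm (fun t => f (x - t) - f x) 2 ν := by
      refine (enorm_integral_le_lintegral_enorm _).trans ?_
      rw [← eLpNorm_one_eq_lintegral_enorm]
      refine eLpNorm_le_eLpNorm_of_exponent_le (by norm_num) ?_
      exact (hmeas.comp measurable_prodMk_left).aestronglyMeasurable
    rw [e1, ← eLpNorm_two_sq]
    gcongr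
  have hsq : eLpNorm (moll f ρ - f) 2 volume ^ 2 ≤ ε ^ 2 := by
    rw [eLpNorm_two_sq]
    calc ∫⁻ x, ‖(moll f ρ - f) x‖ₑ ^ 2 ≤ ∫⁻ x, ∫⁻ t, ‖f (x - t) - f x‖ₑ ^ 2 ∂ν :=
          lintegral_mono hpt
      _ = ∫⁻ t, ∫⁻ x, ‖f (x - t) - f x‖ₑ ^ 2 ∂volume ∂ν :=
          lintegral_lintegral_swap (hmeas.enorm.pow_const 2).aemeasurable
      _ ≤ ∫⁻ _, ε ^ 2 ∂ν := by
          refine lintegral_mono_ae ?_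
          have : ∀ᵐ t ∂ν, ENNReal.ofReal (ρ t) ≠ 0 := by
            rw [hν, ae_withDensity_iff hρm]
            exact ae_of_all _ fun _ h => h
          filter_upwards [this] with t ht
          rw [← eLpNorm_two_sq]
          gcongr
          exact hε t fun h => ht (by simp [h])
      _ = ε ^ 2 := by simp
  exact (ENNReal.pow_le_pow_left_iff two_ne_zero).1 hsq

lemma tendsto_eLpNorm_translate (hf : MemLp f 2 volume) :
    Tendsto (fun t => eLpNorm (fun x => f (x - t) - f x) 2 volume) (𝓝 0) (𝓝 0) := by
  have hmp : ∀ t : Fin n → ℂ, MeasurePreserving (fun x => x - t) volume volume := fun t =>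
    measurePreserving_sub_right volume t
  let g : (Fin n → ℂ) → C(Fin n → ℂ, Fin n → ℂ) := fun t => ⟨fun x => x - t, by fun_prop⟩
  have hg : Continuous g :=
    ContinuousMap.continuous_of_continuous_uncurry _ (by
      show Continuous fun p : (Fin n → ℂ) × (Fin n → ℂ) => p.2 - p.1
      fun_prop)
  have := (continuous_const (y := hf.toLp)).compMeasurePreservingLp hg hmp (by norm_num)
  have h0 := this.tendsto 0
  rw [tendsto_iff_edist_tendsto_0] at h0
  refine h0.congr fun t => ?_
  rw [Lp.edist_def]
  refine eLpNorm_congr_ae ?_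
  have e1 : ∀ t, (Lp.compMeasurePreserving (g t) (hmp t) hf.toLp : (Fin n → ℂ) → ℂ)
      =ᵐ[volume] fun x => f (x - t) := fun t =>
    (Lp.coeFn_compMeasurePreserving _ _).trans
      ((hmp t).quasiMeasurePreserving.ae_eq_comp hf.coeFn_toLp)
  filter_upwards [e1 t, e1 0] with x h1 h2
  simp only [Pi.sub_apply, h1, h2, sub_zero]

/-- A sequence of smooth nonnegative kernels shrinking to the origin. -/
lemma exists_mollifier (n : ℕ) : ∃ ρ : ℕ → (Fin n → ℂ) → ℝ, (∀ k, ContDiff ℝ ∞ (ρ k)) ∧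
    (∀ k, HasCompactSupport (ρ k)) ∧
    ∀ f, MemLp f 2 volume → Tendsto (fun k => eLpNorm (moll f (ρ k) - f) 2 volume) atTop (𝓝 0) := by
  let b : ℕ → ContDiffBump (0 : Fin n → ℂ) := fun k =>
    ⟨1 / (2 * (k + 1)), 1 / (k + 1), by positivity, by
      rw [div_lt_div_iff₀ (by positivity) (by positivity)]; linarith [(k.cast_nonneg : (0:ℝ) ≤ k)]⟩
  refine ⟨fun k => (b k).normed volume, fun k => (b k).contDiff_normed,
    fun k => (b k).hasCompactSupport_normed, fun f hf => ?_⟩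
  rw [ENNReal.tendsto_atTop_zero]
  intro ε hε
  have h := (ENNReal.tendsto_nhds_zero.1 (tendsto_eLpNorm_translate hf)) ε hε
  obtain ⟨δ, hδ, hball⟩ := Metric.eventually_nhds_iff.1 h
  obtain ⟨N, hN⟩ := exists_nat_one_div_lt hδ
  refine ⟨N, fun k hk => eLpNorm_moll_sub_le hf (b k).continuous_normed
    (b k).hasCompactSupport_normed (b k).nonneg_normed ((b k).integral_normed) fun t ht => ?_⟩
  refine hball ?_
  have : t ∈ Function.support ((b k).normed volume) := ht
  rw [(b k).support_normed_eq] at this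
  refine (mem_ball.1 this).trans (lt_of_le_of_lt ?_ hN)
  show (1 : ℝ) / (k + 1) ≤ 1 / (N + 1)
  gcongr

end Mollify

section WeakKohnMorreyHormander

open Filter

variable {n : ℕ} {φ τ : (Fin n → ℂ) → ℝ}

lemma exp_mul_kmhForm_eq (hφ : ContDiff ℝ 2 φ) (hτ : ContDiff ℝ 2 τ) (z g : Fin n → ℂ) (p : ℂ)
    (q : Fin n → Fin n → ℂ) :
    Real.exp (-φ z) * kmhForm φ τ z g p q =
      (cplx (fun z => Real.exp (-φ z) * τ z) z * (p - ∑ j, wirt (-I) (cplx φ) j z * g j)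
          * conj (p - ∑ j, wirt (-I) (cplx φ) j z * g j)).re
      + ∑ j, ∑ k, (cplx (fun z => Real.exp (-φ z) * τ z / 2) z * q j k * conj (q j k)).re
      + ((∑ j, 2 * cplx (fun z => Real.exp (-φ z)) z * wirt (-I) (cplx τ) j z * g j)
          * conj (p - ∑ j, wirt (-I) (cplx φ) j z * g j)).re
      - ∑ j, ∑ k, (cplx (fun z => Real.exp (-φ z)) z * (cplx τ z * wirt I (wirt (-I) (cplx φ) j) k z
          - wirt I (wirt (-I) (cplx τ) j) k z) * g j * conj (g k)).re := by
  have hd : delPair n φ z g = ∑ j, wirt (-I) (cplx φ) j z * g j := by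
    rw [delPair_eq_sum _ (hφ.differentiable (by simp) z)]; simp only [mul_comm]
  have hd' : delPair n τ z g = ∑ j, wirt (-I) (cplx τ) j z * g j := by
    rw [delPair_eq_sum _ (hτ.differentiable (by simp) z)]; simp only [mul_comm]
  rw [kmhForm, hd, hd', hessC_eq_sum hφ, hessC_eq_sum hτ]
  set D := p - ∑ j, wirt (-I) (cplx φ) j z * g j
  have e1 : ∀ (a : ℝ) (w : ℂ), ((a : ℂ) * w * conj w).re = a * Complex.normSq w := fun a w => by
    rw [mul_assoc, Complex.mul_conj, ← Complex.ofReal_mul, Complex.ofReal_re]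
  have e2 : (∑ j, 2 * cplx (fun z => Real.exp (-φ z)) z * wirt (-I) (cplx τ) j z * g j)
      = ((2 * Real.exp (-φ z) : ℝ) : ℂ) * ∑ j, wirt (-I) (cplx τ) j z * g j := by
    rw [Finset.mul_sum]
    refine Finset.sum_congr rfl fun j _ => ?_
    simp only [cplx]; push_cast; ring
  have e3 : ∑ j, ∑ k, (cplx (fun z => Real.exp (-φ z)) z
        * (cplx τ z * wirt I (wirt (-I) (cplx φ) j) k z
          - wirt I (wirt (-I) (cplx τ) j) k z) * g j * conj (g k)).re
      = Real.exp (-φ z) * (τ z * (∑ j, ∑ k, wirt I (wirt (-I) (cplx φ) j) k z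
          * (g j * conj (g k))).re
        - (∑ j, ∑ k, wirt I (wirt (-I) (cplx τ) j) k z * (g j * conj (g k))).re) := by
    simp only [Complex.re_sum, Finset.mul_sum, ← Finset.sum_sub_distrib]
    refine Finset.sum_congr rfl fun j _ => Finset.sum_congr rfl fun k _ => ?_
    rw [← Complex.re_ofReal_mul, ← Complex.sub_re, ← Complex.re_ofReal_mul]
    congr 1
    simp only [cplx]
    ring
  rw [e2, e3]
  simp only [cplx, e1, ← Finset.mul_sum]
  rw [mul_assoc ((2 * Real.exp (-φ z) : ℝ) : ℂ), Complex.re_ofReal_mul]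
  ring

lemma exists_bound_of_hasCompactSupport {a : (Fin n → ℂ) → ℂ} (ha : Continuous a)
    (hc : HasCompactSupport a) : ∃ C : ℝ, ∀ z, ‖a z‖ ≤ C := by
  obtain ⟨C, hC⟩ := hc.exists_bound_of_continuous ha
  exact ⟨C, hC⟩

lemma TendstoL2.mul_hasCompactSupport {A : ℕ → (Fin n → ℂ) → ℂ} {A₀ a : (Fin n → ℂ) → ℂ}
    (hA : TendstoL2 volume A A₀) (ha : Continuous a) (hc : HasCompactSupport a) :
    TendstoL2 volume (fun k x => a x * A k x) (fun x => a x * A₀ x) := by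
  obtain ⟨C, hC⟩ := exists_bound_of_hasCompactSupport ha hc
  exact hA.mul_bounded ha.aestronglyMeasurable hC

/-- The twisted Kohn–Morrey–Hörmander inequality for compactly supported square-integrable forms
whose divergence and curl are square-integrable in the weak sense. -/
lemma integral_kmhForm_nonneg (hφ : ContDiff ℝ 2 φ) (hτ : ContDiff ℝ 2 τ)
    (hφc : HasCompactSupport φ) (hτc : HasCompactSupport τ) (hτ0 : ∀ z, 0 ≤ τ z)
    {G : Fin n → (Fin n → ℂ) → ℂ} {p : (Fin n → ℂ) → ℂ} {q : Fin n → Fin n → (Fin n → ℂ) → ℂ}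
    (hG : ∀ j, MemLp (G j) 2 volume) (hGc : ∀ j, HasCompactSupport (G j))
    (hp : MemLp p 2 volume) (hpc : HasCompactSupport p)
    (hq : ∀ j k, MemLp (q j k) 2 volume) (hqc : ∀ j k, HasCompactSupport (q j k))
    (hpG : ∀ θ : (Fin n → ℂ) → ℂ, ContDiff ℝ ∞ θ → HasCompactSupport θ →
      ∑ j, ∫ z, G j z * wirt (-I) θ j z = - ∫ z, p z * θ z)
    (hqG : ∀ j k, ∀ θ : (Fin n → ℂ) → ℂ, ContDiff ℝ ∞ θ → HasCompactSupport θ →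
      (∫ z, G k z * wirt I θ j z) - (∫ z, G j z * wirt I θ k z) = - ∫ z, q j k z * θ z) :
    Integrable (fun z => Real.exp (-φ z) * kmhForm φ τ z (fun j => G j z) (p z)
      (fun j k => q j k z)) ∧
    0 ≤ ∫ z, Real.exp (-φ z) * kmhForm φ τ z (fun j => G j z) (p z) (fun j k => q j k z) := by
  obtain ⟨ρ, hρ, hρc, hlim⟩ := exists_mollifier n
  have hloc : ∀ {f : (Fin n → ℂ) → ℂ}, MemLp f 2 volume → LocallyIntegrable f := fun hf =>
    hf.locallyIntegrable (by norm_num)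
  have hsm : ∀ {f : (Fin n → ℂ) → ℂ}, MemLp f 2 volume → ∀ k, ContDiff ℝ 2 (moll f (ρ k)) :=
    fun hf k => contDiff_moll (m := 2) (hloc hf) ((hρ k).of_le (by exact_mod_cast le_top)) (hρc k)
  have htl : ∀ {f : (Fin n → ℂ) → ℂ}, MemLp f 2 volume → HasCompactSupport f →
      TendstoL2 volume (fun k => moll f (ρ k)) f := fun hf hc =>
    ⟨fun k => (hsm hf k).continuous.memLp_of_hasCompactSupport (hasCompactSupport_moll hc (hρc k)),
      hf, hlim _ hf⟩
  have hρ1 : ∀ k, ContDiff ℝ 1 (ρ k) := fun k => (hρ k).of_le (by exact_mod_cast le_top)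
  have hθ : ∀ k x, ContDiff ℝ ∞ (cplx fun s => ρ k (x - s)) := fun k x =>
    contDiff_cplx ((hρ k).comp (contDiff_const.sub contDiff_id))
  have hθc : ∀ k x, HasCompactSupport (cplx fun s => ρ k (x - s)) := fun k x =>
    hasCompactSupport_cplx ((hρc k).comp_homeomorph (Homeomorph.subLeft x))
  have hw : ∀ k c j i x, wirt c (moll (G j) (ρ k)) i x
      = - ∫ s, G j s * wirt c (cplx fun s => ρ k (x - s)) i s := fun k c j i x =>
    wirt_moll (hloc (hG j)) (hρ1 k) (hρc k) c i x
  have hpk : ∀ k x, ∑ j, wirt (-I) (moll (G j) (ρ k)) j x = moll p (ρ k) x := fun k x => by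
    simp only [hw, Finset.sum_neg_distrib]
    rw [hpG _ (hθ k x) (hθc k x), neg_neg]
    rfl
  have hqk : ∀ k i j x, wirt I (moll (G j) (ρ k)) i x - wirt I (moll (G i) (ρ k)) j x
      = moll (q i j) (ρ k) x := fun k i j x => by
    have := hqG i j _ (hθ k x) (hθc k x)
    simp only [hw]
    rw [← neg_sub', this, neg_neg]
    rfl
  have hexp : Continuous fun z => Real.exp (-φ z) := Real.continuous_exp.comp hφ.continuous.neg
  have hφw : ∀ j, ContDiff ℝ 1 (wirt (-I) (cplx φ) j) := fun j =>
    contDiff_wirt (contDiff_cplx hφ) (by norm_num)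
  have hτw : ∀ j, ContDiff ℝ 1 (wirt (-I) (cplx τ) j) := fun j =>
    contDiff_wirt (contDiff_cplx hτ) (by norm_num)
  have hφwc : ∀ j, HasCompactSupport (wirt (-I) (cplx φ) j) := fun j =>
    hasCompactSupport_wirt (hasCompactSupport_cplx hφc)
  have hτwc : ∀ j, HasCompactSupport (wirt (-I) (cplx τ) j) := fun j =>
    hasCompactSupport_wirt (hasCompactSupport_cplx hτc)
  have hτcont := (contDiff_cplx hτ).continuous
  have hcc : ∀ {f : (Fin n → ℂ) → ℝ}, Continuous f → Continuous (cplx f) := fun hf =>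
    Complex.continuous_ofReal.comp hf
  have hg := fun j => htl (hG j) (hGc j)
  have hD := (htl hp hpc).sub (TendstoL2.sum Finset.univ fun j =>
    (hg j).mul_hasCompactSupport (hφw j).continuous (hφwc j))
  have t1 := (hD.mul_hasCompactSupport (hcc (hexp.mul hτ.continuous))
    (hasCompactSupport_cplx hτc.mul_left)).re_mul_conj hD
  have t2 := TendstoIntegral.sum Finset.univ fun j => TendstoIntegral.sum Finset.univ fun k =>
    ((htl (hq j k) (hqc j k)).mul_hasCompactSupport
      (a := cplx fun z => Real.exp (-φ z) * τ z / 2)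
      (hcc ((hexp.mul hτ.continuous).div_const 2))
      (hasCompactSupport_cplx (hτc.mul_left.comp_left (g := fun t : ℝ => t / 2)
        (by simp)))).re_mul_conj (htl (hq j k) (hqc j k))
  have t3 := (TendstoL2.sum Finset.univ fun j =>
    (hg j).mul_hasCompactSupport
      (a := fun z => 2 * cplx (fun z => Real.exp (-φ z)) z * wirt (-I) (cplx τ) j z)
      ((continuous_const.mul (hcc hexp)).mul (hτw j).continuous) (hτwc j).mul_left).re_mul_conj hD
  have t4 := TendstoIntegral.sum Finset.univ fun j => TendstoIntegral.sum Finset.univ fun k =>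
    ((hg j).mul_hasCompactSupport
      (a := fun z => cplx (fun z => Real.exp (-φ z)) z
        * (cplx τ z * wirt I (wirt (-I) (cplx φ) j) k z - wirt I (wirt (-I) (cplx τ) j) k z))
      ((hcc hexp).mul ((hτcont.mul (continuous_wirt (hφw j))).sub (continuous_wirt (hτw j))))
      (((hasCompactSupport_wirt (hφwc j)).mul_left).sub
        (hasCompactSupport_wirt (hτwc j))).mul_left).re_mul_conj (hg k)
  have T := ((t1.add t2).add t3).sub t4
  have e0 : ∀ z, Real.exp (-φ z) * kmhForm φ τ z (fun j => G j z) (p z) (fun j k => q j k z) = _ :=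
    fun z => exp_mul_kmhForm_eq hφ hτ z _ _ _
  simp only [e0]
  refine ⟨T.integrable_lim, ge_of_tendsto' T.tendsto fun k => ?_⟩
  have := integral_kmhForm_nonneg_of_contDiff hφ hτ hτ0 (G := fun j => moll (G j) (ρ k))
    (fun j => hsm (hG j) k) (fun j => hasCompactSupport_moll (hGc j) (hρc k))
  simp only [hpk, hqk, exp_mul_kmhForm_eq hφ hτ] at this
  exact this

end WeakKohnMorreyHormander

section Cutoff

variable {n : ℕ}

lemma memLp_mul_continuous {f a : (Fin n → ℂ) → ℂ} (hf : MemLp f 2 volume) (ha : Continuous a)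
    (hc : HasCompactSupport a) : MemLp (fun z => a z * f z) 2 volume := by
  obtain ⟨C, hC⟩ := exists_bound_of_hasCompactSupport ha hc
  refine hf.of_le_mul (c := C) (ha.aestronglyMeasurable.mul hf.1) (ae_of_all _ fun x => ?_)
  rw [norm_mul]
  gcongr
  exact hC x

lemma integrable_mul_continuous {f a : (Fin n → ℂ) → ℂ} (hf : MemLp f 2 volume)
    (ha : Continuous a) (hc : HasCompactSupport a) : Integrable (fun z => f z * a z) :=
  hf.integrable_mul (q := 2) (ha.memLp_of_hasCompactSupport hc)

lemma sum_sum_normSq_wedge_le (x y : Fin n → ℂ) :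
    ∑ j, ∑ k, Complex.normSq (x j * y k - x k * y j) ≤ 2 * (enormSq n x * enormSq n y) := by
  have h := sum_sum_normSq_sub fun j k => x k * y j
  rw [h]
  have e1 : ∑ j, ∑ k, Complex.normSq (x k * y j) = enormSq n x * enormSq n y := by
    simp only [enormSq, Finset.sum_mul_sum, Complex.normSq_mul]
    exact Finset.sum_comm
  have e2 : ∑ j, ∑ k, x k * y j * conj (x j * y k)
      = (∑ k, x k * conj (y k)) * conj (∑ k, x k * conj (y k)) := by
    rw [map_sum, Finset.sum_mul_sum, Finset.sum_comm]
    refine Finset.sum_congr rfl fun j _ => Finset.sum_congr rfl fun k _ => ?_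
    simp only [map_mul, Complex.conj_conj]
    ring
  rw [e1, e2, Complex.mul_conj, Complex.ofReal_re]
  linarith [Complex.normSq_nonneg (∑ k, x k * conj (y k))]

lemma normSq_add_le (a b : ℂ) :
    Complex.normSq (a + b) ≤ 2 * Complex.normSq a + 2 * Complex.normSq b := by
  have := Complex.normSq_nonneg (a - b)
  rw [Complex.normSq_sub] at this
  rw [Complex.normSq_add]
  linarith

lemma two_mul_re_mul_conj_le {t : ℝ} (ht : 0 < t) (a b : ℂ) :
    2 * (a * conj b).re ≤ t * Complex.normSq b + t⁻¹ * Complex.normSq a := by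
  have h := Complex.normSq_nonneg (a - t * b)
  rw [Complex.normSq_sub, Complex.normSq_mul, Complex.normSq_ofReal] at h
  have e : (a * conj ((t : ℂ) * b)).re = t * (a * conj b).re := by
    rw [map_mul, Complex.conj_ofReal, ← Complex.re_ofReal_mul]
    congr 1
    ring
  rw [e] at h
  have h2 : 0 ≤ t⁻¹ * (Complex.normSq a + t * t * Complex.normSq b
      - 2 * (t * (a * conj b).re)) := mul_nonneg (inv_nonneg.2 ht.le) h
  have h3 : t⁻¹ * (Complex.normSq a + t * t * Complex.normSq b - 2 * (t * (a * conj b).re))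
      = t⁻¹ * Complex.normSq a + t * Complex.normSq b - 2 * (a * conj b).re := by
    field_simp
  linarith

lemma normSq_sum_mul_le (x y : Fin n → ℂ) :
    Complex.normSq (∑ j, x j * y j) ≤ enormSq n x * enormSq n y := by
  have h1 : ‖∑ j, x j * y j‖ ≤ ∑ j, ‖x j‖ * ‖y j‖ :=
    (norm_sum_le _ _).trans_eq (Finset.sum_congr rfl fun j _ => norm_mul _ _)
  have h2 := Finset.sum_mul_sq_le_sq_mul_sq Finset.univ (fun j => ‖x j‖) (fun j => ‖y j‖)
  simp only [enormSq, Complex.normSq_eq_norm_sq]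
  exact (pow_le_pow_left₀ (norm_nonneg _) h1 2).trans h2

lemma enormSq_nonneg (x : Fin n → ℂ) : 0 ≤ enormSq n x :=
  Finset.sum_nonneg fun _ _ => Complex.normSq_nonneg _

lemma enormSq_const_mul (a : ℂ) (x : Fin n → ℂ) :
    enormSq n (fun j => a * x j) = Complex.normSq a * enormSq n x := by
  simp only [enormSq, Complex.normSq_mul, Finset.mul_sum]

lemma kmhForm_le {φ τ : (Fin n → ℂ) → ℝ} {z : Fin n → ℂ} (hτ : 0 < τ z) (g : Fin n → ℂ) (p : ℂ)
    (q : Fin n → Fin n → ℂ) :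
    kmhForm φ τ z g p q ≤ 2 * τ z * Complex.normSq (p - delPair n φ z g)
      + τ z / 2 * ∑ j, ∑ k, Complex.normSq (q j k) - Theta n φ τ z g := by
  have := two_mul_re_mul_conj_le hτ (delPair n τ z g) (p - delPair n φ z g)
  rw [kmhForm, Theta]
  linarith

lemma hessC_zero_right (f : (Fin n → ℂ) → ℝ) (z : Fin n → ℂ) : hessC n f z 0 = 0 := by
  have : ∀ m : Fin n → ℂ, iteratedFDeriv ℝ 2 f z ![0, m] = 0 := fun m =>
    (iteratedFDeriv ℝ 2 f z).map_coord_zero 0 rfl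
  rw [hessC, smul_zero, this]
  simp

lemma kmhForm_zero (φ τ : (Fin n → ℂ) → ℝ) (z : Fin n → ℂ) :
    kmhForm φ τ z (fun _ => 0) 0 (fun _ _ => 0) = 0 := by
  have h : (fun _ : Fin n => (0 : ℂ)) = 0 := rfl
  rw [kmhForm, h, hessC_zero_right, hessC_zero_right]
  simp [delPair]

lemma enormSq_wirt_cplx (f : (Fin n → ℂ) → ℝ) (z : Fin n → ℂ) :
    enormSq n (fun j => wirt I (cplx f) j z) = enormSq n (fun j => wirt (-I) (cplx f) j z) := by
  simp only [enormSq]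
  refine Finset.sum_congr rfl fun j _ => ?_
  rw [← Complex.normSq_conj, conj_wirt_cplx, Complex.conj_I]

end Cutoff

section CutoffEstimate

variable {n : ℕ}

/-- A cut-off form of the weighted estimate, with globally defined weights. -/
lemma exists_integrable_cutoff_bound_of_contDiff {φ τ ψ χ W : (Fin n → ℂ) → ℝ}
    {Y : Fin n → (Fin n → ℂ) → ℂ} {h : (Fin n → ℂ) → ℂ}
    (hφ : ContDiff ℝ 2 φ) (hτ : ContDiff ℝ 2 τ) (hψ : ContDiff ℝ ∞ ψ) (hχ : ContDiff ℝ ∞ χ)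
    (hφc : HasCompactSupport φ) (hτc : HasCompactSupport τ) (hχc : HasCompactSupport χ)
    (hτ0 : ∀ z, 0 ≤ τ z) (hτp : ∀ z ∈ tsupport χ, 0 < τ z) (hY : ∀ j, MemLp (Y j) 2 volume)
    (hh : Continuous h) (hhχ : ∀ z, h z ≠ 0 → χ z = 1 ∧ ∀ j, wirt (-I) (cplx χ) j z = 0)
    (hcl : ∀ j k, ∀ θ : (Fin n → ℂ) → ℂ, ContDiff ℝ ∞ θ → tsupport θ ⊆ tsupport χ →
      ∫ z, Y j z * (Real.exp ((φ z + ψ z) / 2) * wirt I θ k z)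
        = ∫ z, Y k z * (Real.exp ((φ z + ψ z) / 2) * wirt I θ j z))
    (hdiv : ∀ u : (Fin n → ℂ) → ℂ, ContDiff ℝ 2 u → tsupport u ⊆ tsupport χ →
      ∑ j, ∫ z, Y j z * (Real.exp (-(φ z + ψ z) / 2) * wirt (-I) u j z) = - ∫ z, h z * u z)
    (hΘ : ∀ z ∈ tsupport χ, ∀ ξ,
      (W z + 2 * τ z * enormSq n (fun j => wirt (-I) (cplx ψ) j z)) * enormSq n ξ
        ≤ Theta n φ τ z ξ) :
    ∃ F : (Fin n → ℂ) → ℝ, Integrable F ∧ 0 ≤ ∫ z, F z ∧ ∀ z,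
      F z + W z * χ z ^ 2 * Real.exp (-ψ z) * enormSq n (fun j => Y j z)
        ≤ 2 * τ z * Real.exp (φ z) * Complex.normSq (h z)
          + 4 * τ z * enormSq n (fun j => wirt (-I) (cplx χ) j z) * Real.exp (-ψ z)
            * enormSq n (fun j => Y j z) := by
  have two_le : (2 : ℕ∞ω) ≤ ∞ := WithTop.coe_le_coe.2 (le_top : (2 : ℕ∞) ≤ ⊤)
  have hψ2 := hψ.of_le two_le
  have hχ2 := hχ.of_le two_le
  have dd : ∀ {f : (Fin n → ℂ) → ℂ} {m : ℕ∞ω}, ContDiff ℝ m f → m ≠ 0 →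
    ∀ z, DifferentiableAt ℝ f z := fun hf hm z => hf.differentiable hm z
  have dr : ∀ {f : (Fin n → ℂ) → ℝ} {m : ℕ∞ω}, ContDiff ℝ m f → m ≠ 0 →
    ∀ z, DifferentiableAt ℝ f z := fun hf hm z => hf.differentiable hm z
  set E : (Fin n → ℂ) → ℂ := cplx fun z => Real.exp ((φ z + ψ z) / 2) with hE
  set b : (Fin n → ℂ) → ℂ := cplx fun z => Real.exp (-(φ z + ψ z) / 2) with hb
  have hEc : Continuous E := Complex.continuous_ofReal.comp
    (Real.continuous_exp.comp ((hφ.continuous.add hψ.continuous).div_const 2))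
  have hbc : Continuous b := Complex.continuous_ofReal.comp
    (Real.continuous_exp.comp ((hφ.continuous.add hψ.continuous).neg.div_const 2))
  -- the two multipliers
  set κ : (Fin n → ℂ) → ℂ := fun z => cplx χ z * cplx (fun z => Real.exp (-ψ z)) z with hκ
  set m : (Fin n → ℂ) → ℂ := fun z => cplx χ z * cplx (fun z => Real.exp (φ z)) z with hm
  have hκd : ContDiff ℝ ∞ κ :=
    (contDiff_cplx hχ).mul (contDiff_cplx (Real.contDiff_exp.comp hψ.neg))
  have hmd : ContDiff ℝ 2 m :=
    (contDiff_cplx hχ2).mul (contDiff_cplx (Real.contDiff_exp.comp hφ))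
  have hκ1 : ContDiff ℝ 1 κ := hκd.of_le (by exact_mod_cast le_top)
  have hm1 : ContDiff ℝ 1 m := hmd.of_le (by norm_num)
  have hχcc : HasCompactSupport (cplx χ) := hasCompactSupport_cplx hχc
  have hκc : HasCompactSupport κ := hχcc.mul_right
  have hmc : HasCompactSupport m := hχcc.mul_right
  have hχt : tsupport (cplx χ) ⊆ tsupport χ :=
    closure_mono fun z hz h0 => hz (by simp [cplx, h0])
  have hκt : tsupport κ ⊆ tsupport χ := (tsupport_mul_subset_left).trans hχt
  have hmt : tsupport m ⊆ tsupport χ := (tsupport_mul_subset_left).trans hχt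
  have hκw : ∀ c j z, wirt c κ j z = Real.exp (-ψ z) *
      (wirt c (cplx χ) j z - χ z * wirt c (cplx ψ) j z) := fun c j z => by
    have h1 := wirt_cplx_comp (c := c) (j := j) (dr hψ2 two_ne_zero z)
      (h := fun t => Real.exp (-t)) ((Real.hasDerivAt_exp _).comp _ (hasDerivAt_neg (ψ z)))
    have h2 : ContDiff ℝ 2 fun z => Real.exp (-ψ z) := Real.contDiff_exp.comp hψ2.neg
    rw [hκ, wirt_mul (dd (contDiff_cplx hχ2) two_ne_zero z) (dd (contDiff_cplx h2) two_ne_zero z),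
      h1]
    simp only [cplx]
    push_cast
    ring
  have hmw : ∀ c j z, wirt c m j z = Real.exp (φ z) *
      (wirt c (cplx χ) j z + χ z * wirt c (cplx φ) j z) := fun c j z => by
    have h1 := wirt_cplx_comp (c := c) (j := j) (dr hφ two_ne_zero z)
      (h := Real.exp) (Real.hasDerivAt_exp _)
    have h2 : ContDiff ℝ 2 fun z => Real.exp (φ z) := Real.contDiff_exp.comp hφ
    rw [hm, wirt_mul (dd (contDiff_cplx hχ2) two_ne_zero z) (dd (contDiff_cplx h2) two_ne_zero z),
      h1]
    simp only [cplx]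
    ring
  have hEb : ∀ z, b z * m z = E z * κ z := fun z => by
    simp only [hb, hm, hE, hκ, cplx]
    rw [mul_left_comm, mul_left_comm ((Real.exp ((φ z + ψ z) / 2) : ℝ) : ℂ)]
    congr 1
    rw [← Complex.ofReal_mul, ← Complex.ofReal_mul, ← Real.exp_add, ← Real.exp_add]
    congr 2
    ring
  let G : Fin n → (Fin n → ℂ) → ℂ := fun j z => (E z * κ z) * Y j z
  let p : (Fin n → ℂ) → ℂ := fun z => m z * h z + ∑ j, (b z * wirt (-I) m j z) * Y j z
  let q : Fin n → Fin n → (Fin n → ℂ) → ℂ := fun j k z =>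
    (E z * wirt I κ j z) * Y k z - (E z * wirt I κ k z) * Y j z
  have cκ : ∀ j, Continuous (wirt I κ j) := fun j => continuous_wirt hκ1
  have cm : ∀ j, Continuous (wirt (-I) m j) := fun j => continuous_wirt hm1
  have sκ : ∀ j, HasCompactSupport (wirt I κ j) := fun j => hasCompactSupport_wirt hκc
  have sm : ∀ j, HasCompactSupport (wirt (-I) m j) := fun j => hasCompactSupport_wirt hmc
  have main := integral_kmhForm_nonneg (G := G) (p := p) (q := q) hφ hτ hφc hτc hτ0
    (fun j => memLp_mul_continuous (hY j) (hEc.mul hκ1.continuous) hκc.mul_left)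
    (fun j => (hκc.mul_left).mul_right)
    (((hmd.continuous.mul hh).memLp_of_hasCompactSupport hmc.mul_right).add
      (memLp_finsetSum _ fun j _ => memLp_mul_continuous (hY j) (hbc.mul (cm j)) (sm j).mul_left))
    (by
      refine HasCompactSupport.intro hχc.isCompact fun z hz => ?_
      have h1 : m z = 0 := image_eq_zero_of_notMem_tsupport fun h => hz (hmt h)
      have h2 : ∀ j, wirt (-I) m j z = 0 := fun j =>
        wirt_eq_zero_of_notMem_tsupport fun h => hz (hmt h)
      simp [p, h1, h2])
    (fun j k => (memLp_mul_continuous (hY k) (hEc.mul (cκ j)) (sκ j).mul_left).sub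
      (memLp_mul_continuous (hY j) (hEc.mul (cκ k)) (sκ k).mul_left))
    (fun j k => ((sκ j).mul_left.mul_right).sub ((sκ k).mul_left.mul_right))
    (fun θ hθ hθc => by
      have hθ2 : ContDiff ℝ 2 θ := hθ.of_le two_le
      have hu := hdiv (fun z => m z * θ z) (hmd.mul hθ2) (tsupport_mul_subset_left.trans hmt)
      have hw : ∀ j z, wirt (-I) (fun z => m z * θ z) j z
          = m z * wirt (-I) θ j z + wirt (-I) m j z * θ z := fun j z =>
        wirt_mul (dd hmd two_ne_zero z) (dd hθ2 two_ne_zero z)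
      have cθ : ∀ j, Continuous (wirt (-I) θ j) := fun j =>
        continuous_wirt (hθ2.of_le (by norm_num))
      have i1 : ∀ j, Integrable fun z => Y j z * (E z * κ z * wirt (-I) θ j z) := fun j =>
        integrable_mul_continuous (hY j) ((hEc.mul hκ1.continuous).mul (cθ j))
          (hκc.mul_left.mul_right)
      have i2 : ∀ j, Integrable fun z => Y j z * (b z * wirt (-I) m j z * θ z) := fun j =>
        integrable_mul_continuous (hY j) ((hbc.mul (cm j)).mul hθ2.continuous) hθc.mul_left
      have i3 : Integrable fun z => h z * (m z * θ z) :=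
        (hh.mul (hmd.continuous.mul hθ2.continuous)).integrable_of_hasCompactSupport
          (hθc.mul_left.mul_left)
      have e1 : ∀ j, ∫ z, Y j z * (Real.exp (-(φ z + ψ z) / 2) *
            wirt (-I) (fun z => m z * θ z) j z)
          = ∫ z, G j z * wirt (-I) θ j z + Y j z * (b z * wirt (-I) m j z * θ z) := fun j => by
        congr 1
        funext z
        rw [hw]
        simp only [G]
        rw [← hEb]
        simp only [hb, cplx]
        ring
      have e2 : ∀ j, ∫ z, G j z * wirt (-I) θ j z + Y j z * (b z * wirt (-I) m j z * θ z)
          = (∫ z, G j z * wirt (-I) θ j z) + ∫ z, Y j z * (b z * wirt (-I) m j z * θ z) := fun j =>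
        integral_add ((i1 j).congr (ae_of_all _ fun z => by simp only [G]; ring)) (i2 j)
      simp only [e1, e2, Finset.sum_add_distrib] at hu
      have e3 : ∫ z, p z * θ z = (∫ z, h z * (m z * θ z))
          + ∑ j, ∫ z, Y j z * (b z * wirt (-I) m j z * θ z) := by
        rw [← integral_finsetSum _ fun j _ => i2 j,
          ← integral_add i3 (integrable_finsetSum _ fun j _ => i2 j)]
        congr 1
        funext z
        simp only [p, add_mul, Finset.sum_mul]
        congr 1
        · ring
        · exact Finset.sum_congr rfl fun j _ => by ring
      rw [e3, neg_add, ← hu]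
      ring)
    (fun j k θ hθ hθc => by
      have hu := hcl k j (fun z => κ z * θ z) (hκd.mul hθ) (tsupport_mul_subset_left.trans hκt)
      have hθ2 : ContDiff ℝ 2 θ := hθ.of_le two_le
      have hw : ∀ i z, wirt I (fun z => κ z * θ z) i z
          = κ z * wirt I θ i z + wirt I κ i z * θ z := fun i z =>
        wirt_mul (dd hκ1 one_ne_zero z) (dd hθ2 two_ne_zero z)
      have cθ : ∀ j, Continuous (wirt I θ j) := fun j =>
        continuous_wirt (hθ2.of_le (by norm_num))
      have i1 : ∀ i l, Integrable fun z => G i z * wirt I θ l z := fun i l =>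
        (integrable_mul_continuous (hY i) ((hEc.mul hκ1.continuous).mul (cθ l))
          (hκc.mul_left.mul_right)).congr (ae_of_all _ fun z => by simp only [G, Pi.mul_apply]; ring)
      have i2 : ∀ i l, Integrable fun z => Y i z * (E z * wirt I κ l z * θ z) := fun i l =>
        integrable_mul_continuous (hY i) ((hEc.mul (cκ l)).mul hθ2.continuous) hθc.mul_left
      have e1 : ∀ i l, ∫ z, Y i z * (Real.exp ((φ z + ψ z) / 2) *
            wirt I (fun z => κ z * θ z) l z)
          = (∫ z, G i z * wirt I θ l z) + ∫ z, Y i z * (E z * wirt I κ l z * θ z) := fun i l => by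
        rw [← integral_add (i1 i l) (i2 i l)]
        congr 1
        funext z
        rw [hw]
        simp only [G, hE, cplx]
        ring
      rw [e1, e1] at hu
      have e3 : ∫ z, q j k z * θ z = (∫ z, Y k z * (E z * wirt I κ j z * θ z))
          - ∫ z, Y j z * (E z * wirt I κ k z * θ z) := by
        rw [← integral_sub (i2 k j) (i2 j k)]
        congr 1
        funext z
        simp only [q]
        ring
      rw [e3]
      linear_combination hu)
  refine ⟨_, main.1, main.2, fun z => ?_⟩
  by_cases hz : z ∈ tsupport χ
  swap
  · have h0 : χ z = 0 := image_eq_zero_of_notMem_tsupport hz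
    have h1 : m z = 0 := by simp [hm, cplx, h0]
    have h2 : κ z = 0 := by simp [hκ, cplx, h0]
    have h3 : ∀ j, wirt (-I) m j z = 0 := fun j =>
      wirt_eq_zero_of_notMem_tsupport fun h => hz (hmt h)
    have h4 : ∀ j, wirt I κ j z = 0 := fun j =>
      wirt_eq_zero_of_notMem_tsupport fun h => hz (hκt h)
    have h5 : ∀ j, wirt (-I) (cplx χ) j z = 0 := fun j =>
      wirt_eq_zero_of_notMem_tsupport fun h => hz (hχt h)
    have := hτ0 z
    have := Complex.normSq_nonneg (h z)
    simp only [G, p, q, h0, h1, h2, h3, h4, h5, zero_mul, mul_zero, sub_zero, add_zero,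
      Finset.sum_const_zero, kmhForm_zero, enormSq, map_zero]
    simp only [zero_pow two_ne_zero, zero_mul, mul_zero, add_zero]
    positivity
  set y : Fin n → ℂ := fun j => Y j z with hy
  set χ' : Fin n → ℂ := fun j => wirt (-I) (cplx χ) j z with hχ'
  set ψ' : Fin n → ℂ := fun j => wirt (-I) (cplx ψ) j z with hψ'
  have hτz := hτp z hz
  have e1 : Real.exp (-ψ z) = Real.exp (-φ z) * Real.exp (φ z - ψ z) := by
    rw [← Real.exp_add]; congr 1; ring
  have hEκ : E z * κ z = ((χ z * Real.exp ((φ z - ψ z) / 2) : ℝ) : ℂ) := by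
    simp only [hE, hκ, cplx]
    rw [mul_left_comm, ← Complex.ofReal_mul, ← Real.exp_add, ← Complex.ofReal_mul]
    congr 3
    ring
  have hg : enormSq n (fun j => G j z) = χ z ^ 2 * Real.exp (φ z - ψ z) * enormSq n y := by
    simp only [G]
    rw [hEκ, enormSq_const_mul, Complex.normSq_ofReal, mul_mul_mul_comm, ← Real.exp_add, ← sq]
    congr 3
    ring
  have hbe : b z * Real.exp (φ z) = ((Real.exp ((φ z - ψ z) / 2) : ℝ) : ℂ) := by
    simp only [hb, cplx]
    rw [← Complex.ofReal_mul, ← Real.exp_add]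
    congr 2
    ring
  have hP : p z - delPair n φ z (fun j => G j z)
      = m z * h z + (Real.exp ((φ z - ψ z) / 2) : ℝ) * ∑ j, χ' j * y j := by
    rw [delPair_eq_sum _ (dr hφ two_ne_zero z), ← hbe]
    simp only [p, hmw, Finset.mul_sum, add_sub_assoc, ← Finset.sum_sub_distrib]
    congr 1
    refine Finset.sum_congr rfl fun j _ => ?_
    simp only [G, ← hEb, hm, cplx, hχ', hy]
    ring
  have hP2 : Complex.normSq (p z - delPair n φ z (fun j => G j z))
      ≤ Real.exp (φ z) * Real.exp (φ z) * Complex.normSq (h z)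
        + Real.exp (φ z - ψ z) * (enormSq n χ' * enormSq n y) := by
    rw [hP]
    have hexp : Real.exp ((φ z - ψ z) / 2) * Real.exp ((φ z - ψ z) / 2) = Real.exp (φ z - ψ z) := by
      rw [← Real.exp_add]; congr 1; ring
    by_cases h0 : h z = 0
    · rw [h0, mul_zero, zero_add, Complex.normSq_mul, Complex.normSq_ofReal, map_zero, mul_zero,
        zero_add, hexp]
      gcongr
      exact normSq_sum_mul_le _ _
    · obtain ⟨h1, h2⟩ := hhχ z h0
      have : ∑ j, χ' j * y j = 0 := Finset.sum_eq_zero fun j _ => by simp [hχ', h2]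
      rw [this, mul_zero, add_zero, Complex.normSq_mul]
      simp only [hm, cplx, h1, Complex.ofReal_one, one_mul, Complex.normSq_ofReal]
      have := mul_nonneg (enormSq_nonneg χ') (enormSq_nonneg y)
      have := mul_nonneg (Real.exp_pos (φ z - ψ z)).le this
      linarith
  set x : Fin n → ℂ := fun j => wirt I (cplx χ) j z - χ z * wirt I (cplx ψ) j z with hx
  have hx2 : enormSq n x ≤ 2 * enormSq n χ' + 2 * (χ z ^ 2 * enormSq n ψ') := by
    rw [hχ', ← enormSq_wirt_cplx, hψ', ← enormSq_wirt_cplx]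
    simp only [enormSq, Finset.mul_sum, ← Finset.sum_add_distrib]
    refine Finset.sum_le_sum fun j _ => ?_
    have := normSq_add_le (wirt I (cplx χ) j z) (-(χ z * wirt I (cplx ψ) j z))
    rw [Complex.normSq_neg, Complex.normSq_mul, Complex.normSq_ofReal, ← sub_eq_add_neg,
      ← sq] at this
    exact this
  have hq2 : ∑ j, ∑ k, Complex.normSq (q j k z)
      ≤ Real.exp (φ z - ψ z) * (2 * (enormSq n x * enormSq n y)) := by
    have h1 : ∀ j k, q j k z = (Real.exp ((φ z - ψ z) / 2) : ℝ) * (x j * y k - x k * y j) :=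
      fun j k => by
      have h2 : E z * (Real.exp (-ψ z) : ℝ) = ((Real.exp ((φ z - ψ z) / 2) : ℝ) : ℂ) := by
        simp only [hE, cplx]
        rw [← Complex.ofReal_mul, ← Real.exp_add]
        congr 2
        ring
      rw [← h2]
      simp only [q, hκw, hx, hy]
      ring
    have hexp : Real.exp ((φ z - ψ z) / 2) * Real.exp ((φ z - ψ z) / 2) = Real.exp (φ z - ψ z) := by
      rw [← Real.exp_add]; congr 1; ring
    simp only [h1, Complex.normSq_mul, Complex.normSq_ofReal, hexp, ← Finset.mul_sum]
    gcongr
    exact sum_sum_normSq_wedge_le x y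
  have hk := kmhForm_le hτz (fun j => G j z) (p z) (fun j k => q j k z) (φ := φ)
  have hT := hΘ z hz (fun j => G j z)
  rw [hg] at hT
  have hsum : kmhForm φ τ z (fun j => G j z) (p z) (fun j k => q j k z) ≤
      2 * τ z * (Real.exp (φ z) * Real.exp (φ z) * Complex.normSq (h z)
        + Real.exp (φ z - ψ z) * (enormSq n χ' * enormSq n y))
      + τ z / 2 * (Real.exp (φ z - ψ z) * (2 * ((2 * enormSq n χ'
        + 2 * (χ z ^ 2 * enormSq n ψ')) * enormSq n y)))
      - (W z + 2 * τ z * enormSq n ψ') * (χ z ^ 2 * Real.exp (φ z - ψ z) * enormSq n y) := by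
    have hy0 := enormSq_nonneg y
    refine hk.trans (sub_le_sub (add_le_add ?_ ?_) hT)
    · gcongr
    · gcongr
      exact hq2.trans (by gcongr)
  have := mul_le_mul_of_nonneg_left hsum (Real.exp_pos (-φ z)).le
  have e2 : Real.exp (-φ z) * Real.exp (φ z) = 1 := by rw [← Real.exp_add]; simp
  rw [e1]
  refine (add_le_add_left this _).trans_eq ?_
  linear_combination (2 * τ z * Real.exp (φ z) * Complex.normSq (h z)) * e2

end CutoffEstimate

section Localization

variable {n : ℕ}

lemma hessC_congr {f g : (Fin n → ℂ) → ℝ} {z : Fin n → ℂ} (h : f =ᶠ[𝓝 z] g) (ξ : Fin n → ℂ) :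
    hessC n f z ξ = hessC n g z ξ := by
  have := (h.iteratedFDeriv ℝ 2).self_of_nhds
  simp only [hessC, this]

lemma delPair_congr {f g : (Fin n → ℂ) → ℝ} {z : Fin n → ℂ} (h : f =ᶠ[𝓝 z] g) (ξ : Fin n → ℂ) :
    delPair n f z ξ = delPair n g z ξ := by
  simp only [delPair, h.fderiv_eq]

lemma Theta_congr {φ φ' τ τ' : (Fin n → ℂ) → ℝ} {z : Fin n → ℂ} (hφ : φ =ᶠ[𝓝 z] φ')
    (hτ : τ =ᶠ[𝓝 z] τ') (ξ : Fin n → ℂ) : Theta n φ τ z ξ = Theta n φ' τ' z ξ := by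
  simp only [Theta, hessC_congr hφ, hessC_congr hτ, delPair_congr hτ, hτ.eq_of_nhds]

lemma exists_contDiff_eq_one_nhds {Ω K : Set (Fin n → ℂ)} (hΩ : IsOpen Ω) (hK : IsCompact K)
    (hKΩ : K ⊆ Ω) : ∃ κ : (Fin n → ℂ) → ℝ, ContDiff ℝ ∞ κ ∧ HasCompactSupport κ ∧
      tsupport κ ⊆ Ω ∧ (∀ z, 0 ≤ κ z) ∧ ∀ z ∈ K, κ =ᶠ[𝓝 z] fun _ => 1 := by
  obtain ⟨L, hL, hKL, hLΩ⟩ := exists_compact_between hK hΩ hKΩ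
  obtain ⟨f, h1, h0, h01⟩ := exists_contMDiffMap_one_nhds_of_subset_interior
    (modelWithCornersSelf ℝ (Fin n → ℂ)) (n := ⊤) hK.isClosed hKL
  have hs : tsupport f ⊆ L := closure_minimal (fun z hz => by_contra fun h => hz (h0 z h))
    hL.isClosed
  refine ⟨f, f.contMDiff.contDiff, HasCompactSupport.intro hL h0, hs.trans hLΩ,
    fun z => (h01 z).1, fun z hz => ?_⟩
  exact Filter.Eventually.filter_mono (nhds_le_nhdsSet hz) h1

lemma contDiff_bump_mul {Ω : Set (Fin n → ℂ)} {κ f : (Fin n → ℂ) → ℝ} {m : ℕ∞}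
    (hΩ : IsOpen Ω) (hκ : ContDiff ℝ ∞ κ) (hκΩ : tsupport κ ⊆ Ω) (hf : ContDiffOn ℝ m f Ω) :
    ContDiff ℝ m fun z => κ z * f z := by
  rw [contDiff_iff_contDiffAt]
  intro z
  by_cases hz : z ∈ tsupport κ
  · exact ((hκ.of_le (WithTop.coe_le_coe.2 le_top)).contDiffAt).mul
      (hf.contDiffAt (hΩ.mem_nhds (hκΩ hz)))
  · refine (contDiffAt_const (c := (0 : ℝ))).congr_of_eventuallyEq ?_
    filter_upwards [notMem_tsupport_iff_eventuallyEq.1 hz] with w hw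
    rw [hw, Pi.zero_apply, zero_mul]

/-- A cut-off form of the weighted estimate. -/
lemma exists_integrable_cutoff_bound {Ω : Set (Fin n → ℂ)} {φ τ ψ χ W : (Fin n → ℂ) → ℝ}
    {Y : Fin n → (Fin n → ℂ) → ℂ} {h : (Fin n → ℂ) → ℂ} (hΩ : IsOpen Ω)
    (hφ : ContDiffOn ℝ 2 φ Ω) (hτ : ContDiffOn ℝ 2 τ Ω) (hψ : ContDiffOn ℝ ∞ ψ Ω)
    (hχ : ContDiff ℝ ∞ χ) (hχc : HasCompactSupport χ) (hχΩ : tsupport χ ⊆ Ω)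
    (hτp : ∀ z ∈ Ω, 0 < τ z) (hY : ∀ j, MemLp (Y j) 2 volume)
    (hh : Continuous h) (hhχ : ∀ z, h z ≠ 0 → χ z = 1 ∧ ∀ j, wirt (-I) (cplx χ) j z = 0)
    (hcl : ∀ j k, ∀ θ : (Fin n → ℂ) → ℂ, ContDiff ℝ ∞ θ → HasCompactSupport θ → tsupport θ ⊆ Ω →
      ∫ z, Y j z * (Real.exp ((φ z + ψ z) / 2) * wirt I θ k z)
        = ∫ z, Y k z * (Real.exp ((φ z + ψ z) / 2) * wirt I θ j z))
    (hdiv : ∀ u : (Fin n → ℂ) → ℂ, ContDiff ℝ 2 u → HasCompactSupport u → tsupport u ⊆ Ω →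
      ∑ j, ∫ z, Y j z * (Real.exp (-(φ z + ψ z) / 2) * wirt (-I) u j z) = - ∫ z, h z * u z)
    (hΘ : ∀ z ∈ Ω, ∀ ξ,
      (W z + 2 * τ z * enormSq n (fun j => wirt (-I) (cplx ψ) j z)) * enormSq n ξ
        ≤ Theta n φ τ z ξ) :
    ∃ F : (Fin n → ℂ) → ℝ, Integrable F ∧ 0 ≤ ∫ z, F z ∧ (∀ z, z ∉ tsupport χ → F z ≤ 0) ∧
      ∀ z ∈ Ω,
      F z + W z * χ z ^ 2 * Real.exp (-ψ z) * enormSq n (fun j => Y j z)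
        ≤ 2 * τ z * Real.exp (φ z) * Complex.normSq (h z)
          + 4 * τ z * enormSq n (fun j => wirt (-I) (cplx χ) j z) * Real.exp (-ψ z)
            * enormSq n (fun j => Y j z) := by
  obtain ⟨κ, hκ, hκc, hκΩ, hκ0, hκ1⟩ := exists_contDiff_eq_one_nhds hΩ hχc.isCompact hχΩ
  have key : ∀ f : (Fin n → ℂ) → ℝ, ∀ z ∈ tsupport χ, (fun z => κ z * f z) =ᶠ[𝓝 z] f :=
    fun f z hz => (hκ1 z hz).mono fun w hw => by simp only [hw, one_mul]
  have keyv : ∀ f : (Fin n → ℂ) → ℝ, ∀ z ∈ tsupport χ, κ z * f z = f z := fun f z hz =>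
    (key f z hz).eq_of_nhds
  have hcs : ∀ {f : (Fin n → ℂ) → ℂ}, tsupport f ⊆ tsupport χ → HasCompactSupport f :=
    fun hf => hχc.isCompact.of_isClosed_subset (isClosed_tsupport _) hf
  have hχt : tsupport (cplx χ) ⊆ tsupport χ :=
    closure_mono fun z hz h0 => hz (by simp [cplx, h0])
  obtain ⟨F, hF, hF0, hFle⟩ := exists_integrable_cutoff_bound_of_contDiff (W := W)
    (contDiff_bump_mul (m := 2) hΩ hκ hκΩ hφ) (contDiff_bump_mul (m := 2) hΩ hκ hκΩ hτ)
    (contDiff_bump_mul (m := ⊤) hΩ hκ hκΩ hψ) hχ hκc.mul_right hκc.mul_right hχc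
    (fun z => by
      by_cases hz : z ∈ Ω
      · exact mul_nonneg (hκ0 z) (hτp z hz).le
      · rw [image_eq_zero_of_notMem_tsupport fun h => hz (hκΩ h), zero_mul])
    (fun z hz => by rw [keyv τ z hz]; exact hτp z (hχΩ hz)) hY hh hhχ
    (fun j k θ hθ hθχ => by
      have e : ∀ i l, ∫ z, Y i z * (Real.exp ((κ z * φ z + κ z * ψ z) / 2) * wirt I θ l z)
          = ∫ z, Y i z * (Real.exp ((φ z + ψ z) / 2) * wirt I θ l z) := fun i l => by
        congr 1
        funext z
        by_cases hz : z ∈ tsupport χ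
        · rw [keyv φ z hz, keyv ψ z hz]
        · rw [wirt_eq_zero_of_notMem_tsupport fun h => hz (hθχ h), mul_zero, mul_zero, mul_zero,
            mul_zero]
      rw [e, e]
      exact hcl j k θ hθ (hcs hθχ) (hθχ.trans hχΩ))
    (fun u hu huχ => by
      rw [← hdiv u hu (hcs huχ) (huχ.trans hχΩ)]
      refine Finset.sum_congr rfl fun j _ => ?_
      congr 1
      funext z
      by_cases hz : z ∈ tsupport χ
      · rw [keyv φ z hz, keyv ψ z hz]
      · rw [wirt_eq_zero_of_notMem_tsupport fun h => hz (huχ h), mul_zero, mul_zero, mul_zero,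
          mul_zero])
    (fun z hz ξ => by
      rw [Theta_congr (key φ z hz) (key τ z hz), keyv τ z hz]
      have e : ∀ j, wirt (-I) (cplx fun z => κ z * ψ z) j z = wirt (-I) (cplx ψ) j z := fun j =>
        wirt_congr ((key ψ z hz).mono fun w hw => by simp only [cplx, hw])
      simp only [e]
      exact hΘ z (hχΩ hz) ξ)
  have off : ∀ z, z ∉ tsupport χ → χ z = 0 ∧ h z = 0 ∧ ∀ j, wirt (-I) (cplx χ) j z = 0 := by
    intro z hz
    have h0 : χ z = 0 := image_eq_zero_of_notMem_tsupport hz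
    refine ⟨h0, ?_, fun j => wirt_eq_zero_of_notMem_tsupport fun h => hz (hχt h)⟩
    by_contra hne
    have := (hhχ z hne).1
    rw [h0] at this
    exact zero_ne_one this
  have hoff : ∀ z, z ∉ tsupport χ → F z ≤ 0 := by
    intro z hz
    have := hFle z
    obtain ⟨h0, h1, h2⟩ := off z hz
    simpa [h0, h1, h2, enormSq] using this
  refine ⟨F, hF, hF0, hoff, fun z hzΩ => ?_⟩
  by_cases hz : z ∈ tsupport χ
  · have := hFle z
    rwa [keyv φ z hz, keyv τ z hz, keyv ψ z hz] at this
  · obtain ⟨h0, h1, h2⟩ := off z hz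
    simpa [h0, h1, h2, enormSq] using hoff z hz

end Localization

section WeightedEstimate

variable {n : ℕ}

lemma integrable_enormSq {Y : Fin n → (Fin n → ℂ) → ℂ} {μ : Measure (Fin n → ℂ)}
    (hY : ∀ j, MemLp (Y j) 2 μ) : Integrable (fun z => enormSq n fun j => Y j z) μ := by
  refine integrable_finsetSum _ fun j _ => ?_
  have := (hY j).integrable_norm_pow two_ne_zero
  simpa only [ENNReal.toReal_ofNat, Complex.normSq_eq_norm_sq] using this

/-- The weighted estimate for `∂̄`-closed fields with divergence `h`. -/
lemma setIntegral_enormSq_le {Ω : Set (Fin n → ℂ)} {φ τ ψ W : (Fin n → ℂ) → ℝ}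
    {χ : ℕ → (Fin n → ℂ) → ℝ} {B : ℝ}
    {Y : Fin n → (Fin n → ℂ) → ℂ} {h : (Fin n → ℂ) → ℂ} (hΩ : IsOpen Ω)
    (hφ : ContDiffOn ℝ 2 φ Ω) (hτ : ContDiffOn ℝ 2 τ Ω) (hψ : ContDiffOn ℝ ∞ ψ Ω)
    (hW : ContinuousOn W Ω) (hW0 : ∀ z ∈ Ω, 0 ≤ W z)
    (hχ : ∀ ν, ContDiff ℝ ∞ (χ ν)) (hχc : ∀ ν, HasCompactSupport (χ ν))
    (hχΩ : ∀ ν, tsupport (χ ν) ⊆ Ω) (hχ01 : ∀ ν z, χ ν z ∈ Icc (0 : ℝ) 1)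
    (hχK : ∀ K ⊆ Ω, IsCompact K → ∀ᶠ ν in Filter.atTop, ∀ z ∈ K,
      χ ν z = 1 ∧ ∀ j, wirt (-I) (cplx (χ ν)) j z = 0)
    (hB : ∀ ν, ∀ z ∈ Ω,
      4 * τ z * enormSq n (fun j => wirt (-I) (cplx (χ ν)) j z) * Real.exp (-ψ z) ≤ B)
    (hWB : ∀ z ∈ Ω, W z * Real.exp (-ψ z) ≤ B)
    (hτp : ∀ z ∈ Ω, 0 < τ z) (hY : ∀ j, MemLp (Y j) 2 volume)
    (hh : Continuous h) (hhc : HasCompactSupport h) (hhΩ : tsupport h ⊆ Ω)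
    (hcl : ∀ j k, ∀ θ : (Fin n → ℂ) → ℂ, ContDiff ℝ ∞ θ → HasCompactSupport θ → tsupport θ ⊆ Ω →
      ∫ z, Y j z * (Real.exp ((φ z + ψ z) / 2) * wirt I θ k z)
        = ∫ z, Y k z * (Real.exp ((φ z + ψ z) / 2) * wirt I θ j z))
    (hdiv : ∀ u : (Fin n → ℂ) → ℂ, ContDiff ℝ 2 u → HasCompactSupport u → tsupport u ⊆ Ω →
      ∑ j, ∫ z, Y j z * (Real.exp (-(φ z + ψ z) / 2) * wirt (-I) u j z) = - ∫ z, h z * u z)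
    (hΘ : ∀ z ∈ Ω, ∀ ξ,
      (W z + 2 * τ z * enormSq n (fun j => wirt (-I) (cplx ψ) j z)) * enormSq n ξ
        ≤ Theta n φ τ z ξ) :
    Integrable (fun z => W z * Real.exp (-ψ z) * enormSq n (fun j => Y j z))
        (volume.restrict Ω) ∧
    ∫ z in Ω, W z * Real.exp (-ψ z) * enormSq n (fun j => Y j z)
      ≤ ∫ z in Ω, 2 * τ z * Real.exp (φ z) * Complex.normSq (h z) := by
  have hYi : Integrable (fun z => enormSq n fun j => Y j z) (volume.restrict Ω) :=
    (integrable_enormSq hY).integrableOn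
  have hYB : Integrable (fun z => B * enormSq n fun j => Y j z) (volume.restrict Ω) :=
    hYi.const_mul B
  have meas : ∀ {f : (Fin n → ℂ) → ℝ}, ContinuousOn f Ω →
      AEStronglyMeasurable (fun z => f z * enormSq n fun j => Y j z) (volume.restrict Ω) :=
    fun hf => (hf.aestronglyMeasurable hΩ.measurableSet).mul hYi.aestronglyMeasurable
  have hexp : ContinuousOn (fun z => Real.exp (-ψ z)) Ω :=
    Real.continuous_exp.comp_continuousOn hψ.continuousOn.neg
  have cχ : ∀ ν j, Continuous (wirt (-I) (cplx (χ ν)) j) := fun ν j =>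
    continuous_wirt (contDiff_cplx ((hχ ν).of_le (by exact_mod_cast le_top)))
  have cE : ∀ ν, ContinuousOn (fun z => 4 * τ z * enormSq n (fun j => wirt (-I) (cplx (χ ν)) j z)
      * Real.exp (-ψ z)) Ω := fun ν =>
    ((continuousOn_const.mul hτ.continuousOn).mul (continuous_finsetSum _ fun j _ =>
      Complex.continuous_normSq.comp (cχ ν j)).continuousOn).mul hexp
  have cA : ∀ ν, ContinuousOn (fun z => W z * χ ν z ^ 2 * Real.exp (-ψ z)) Ω := fun ν =>
    (hW.mul ((hχ ν).continuous.pow 2).continuousOn).mul hexp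
  have bE : ∀ ν, ∀ᵐ z ∂volume.restrict Ω, ‖4 * τ z *
      enormSq n (fun j => wirt (-I) (cplx (χ ν)) j z) * Real.exp (-ψ z)
        * enormSq n (fun j => Y j z)‖ ≤ B * enormSq n fun j => Y j z := fun ν => by
    refine (ae_restrict_mem hΩ.measurableSet).mono fun z hz => ?_
    have h1 := (hτp z hz).le
    have h2 := enormSq_nonneg (fun j => wirt (-I) (cplx (χ ν)) j z)
    have h3 := enormSq_nonneg (fun j => Y j z)
    rw [Real.norm_of_nonneg (by positivity)]
    exact mul_le_mul_of_nonneg_right (hB ν z hz) h3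
  have bW : ∀ᵐ z ∂volume.restrict Ω, ‖W z * Real.exp (-ψ z) * enormSq n (fun j => Y j z)‖
      ≤ B * enormSq n fun j => Y j z := by
    refine (ae_restrict_mem hΩ.measurableSet).mono fun z hz => ?_
    have h1 := hW0 z hz
    have h3 := enormSq_nonneg (fun j => Y j z)
    rw [Real.norm_of_nonneg (by positivity)]
    exact mul_le_mul_of_nonneg_right (hWB z hz) h3
  have bA : ∀ ν, ∀ᵐ z ∂volume.restrict Ω, ‖W z * χ ν z ^ 2 * Real.exp (-ψ z)
        * enormSq n (fun j => Y j z)‖ ≤ B * enormSq n fun j => Y j z := fun ν => by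
    refine (ae_restrict_mem hΩ.measurableSet).mono fun z hz => ?_
    have h1 := hW0 z hz
    have h3 := enormSq_nonneg (fun j => Y j z)
    have h4 : χ ν z ^ 2 ≤ 1 := pow_le_one₀ (hχ01 ν z).1 (hχ01 ν z).2
    rw [Real.norm_of_nonneg (by positivity)]
    refine mul_le_mul_of_nonneg_right (le_trans ?_ (hWB z hz)) h3
    exact mul_le_mul_of_nonneg_right (mul_le_of_le_one_right h1 h4) (Real.exp_pos _).le
  have iW : Integrable (fun z => W z * Real.exp (-ψ z) * enormSq n (fun j => Y j z))
      (volume.restrict Ω) := hYB.mono' (meas (hW.mul hexp)) bW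
  have iA := fun ν => hYB.mono' (meas (cA ν)) (bA ν)
  have iE := fun ν => hYB.mono' (meas (cE ν)) (bE ν)
  refine ⟨iW, ?_⟩
  have iR : Integrable (fun z => 2 * τ z * Real.exp (φ z) * Complex.normSq (h z))
      (volume.restrict Ω) := by
    have hc : ContinuousOn (fun z => 2 * τ z * Real.exp (φ z) * Complex.normSq (h z)) Ω :=
      ((continuousOn_const.mul hτ.continuousOn).mul
        (Real.continuous_exp.comp_continuousOn hφ.continuousOn)).mul
        (Complex.continuous_normSq.comp hh).continuousOn
    have h1 := (hc.mono hhΩ).integrableOn_compact hhc.isCompact (μ := volume)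
    refine IntegrableOn.of_forall_sdiff_eq_zero h1 hΩ.measurableSet fun z hz => ?_
    rw [image_eq_zero_of_notMem_tsupport hz.2, map_zero, mul_zero]
  have lim : ∀ {z}, z ∈ Ω → ∀ᶠ ν in Filter.atTop, χ ν z = 1 ∧
      ∀ j, wirt (-I) (cplx (χ ν)) j z = 0 := fun {z} hz =>
    (hχK {z} (singleton_subset_iff.2 hz) isCompact_singleton).mono fun ν hν => hν z rfl
  have tA := tendsto_integral_of_dominated_convergence
    (F := fun ν z => W z * χ ν z ^ 2 * Real.exp (-ψ z) * enormSq n (fun j => Y j z))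
    (f := fun z => W z * Real.exp (-ψ z) * enormSq n (fun j => Y j z)) _
    (fun ν => meas (cA ν)) hYB bA
    ((ae_restrict_mem hΩ.measurableSet).mono fun z hz =>
      tendsto_const_nhds.congr' ((lim hz).mono fun ν hν => by simp only [hν.1]; ring))
  have tE := tendsto_integral_of_dominated_convergence
    (F := fun ν z => 4 * τ z * enormSq n (fun j => wirt (-I) (cplx (χ ν)) j z) * Real.exp (-ψ z)
      * enormSq n (fun j => Y j z)) (f := fun _ => 0) _
    (fun ν => meas (cE ν)) hYB bE
    ((ae_restrict_mem hΩ.measurableSet).mono fun z hz =>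
      tendsto_const_nhds.congr' ((lim hz).mono fun ν hν => by simp [hν.2, enormSq]))
  rw [integral_zero] at tE
  refine le_of_tendsto_of_tendsto tA (by simpa using tE.const_add _) ?_
  filter_upwards [hχK _ hhΩ hhc.isCompact] with ν hν
  obtain ⟨F, hF, hF0, hFoff, hFle⟩ := exists_integrable_cutoff_bound (W := W) hΩ hφ hτ hψ (hχ ν)
    (hχc ν) (hχΩ ν) hτp hY hh (fun z hz => hν z (subset_tsupport _ hz)) hcl hdiv hΘ
  have hFΩ : 0 ≤ ∫ z in Ω, F z := by
    have h1 := integral_add_compl hΩ.measurableSet hF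
    have h2 : ∫ z in Ωᶜ, F z ≤ 0 := setIntegral_nonpos hΩ.measurableSet.compl fun z hz =>
      hFoff z fun h => hz (hχΩ ν h)
    linarith
  have := integral_mono_ae (hF.integrableOn.add (iA ν)) (iR.add (iE ν))
    ((ae_restrict_mem hΩ.measurableSet).mono fun z hz => hFle z hz)
  rw [integral_add' hF.integrableOn (iA ν), integral_add' iR (iE ν)] at this
  linarith

end WeightedEstimate

section LeviGeometry

variable {n : ℕ}

lemma exists_bound_lipschitz_closedBall {G : Type*} [NormedAddCommGroup G] [NormedSpace ℝ G]
    {F : (Fin n → ℂ) → G} (hF : ContDiff ℝ 1 F) (R : ℝ) :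
    ∃ A > 0, ∀ z ∈ closedBall (0 : Fin n → ℂ) R, ‖F z‖ ≤ A ∧
      ∀ p ∈ closedBall (0 : Fin n → ℂ) R, ‖F z - F p‖ ≤ A * ‖z - p‖ := by
  have hK := isCompact_closedBall (0 : Fin n → ℂ) R
  obtain ⟨A₁, h₁⟩ := hK.exists_bound_of_continuousOn hF.continuous.continuousOn
  obtain ⟨A₂, h₂⟩ := hK.exists_bound_of_continuousOn
    (hF.continuous_fderiv one_ne_zero).continuousOn
  refine ⟨max (max A₁ A₂) 1, by positivity, fun z hz => ⟨(h₁ z hz).trans (by simp), fun p hp => ?_⟩⟩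
  refine ((convex_closedBall (0 : Fin n → ℂ) R).norm_image_sub_le_of_norm_fderiv_le
    (fun x _ => hF.differentiable one_ne_zero x) h₂ hp hz).trans ?_
  gcongr
  simp

lemma norm_sq_le_enormSq (ξ : Fin n → ℂ) : ‖ξ‖ ^ 2 ≤ enormSq n ξ := by
  have h0 := enormSq_nonneg ξ
  rw [← Real.le_sqrt (norm_nonneg _) h0]
  refine (pi_norm_le_iff_of_nonneg (Real.sqrt_nonneg _)).2 fun j => ?_
  refine Real.le_sqrt_of_sq_le ?_
  rw [← Complex.normSq_eq_norm_sq]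
  exact Finset.single_le_sum (f := fun j => Complex.normSq (ξ j))
    (fun i _ => Complex.normSq_nonneg _) (Finset.mem_univ j)

lemma norm_I_smul (ξ : Fin n → ℂ) : ‖Complex.I • ξ‖ = ‖ξ‖ := by simp [norm_smul]

lemma norm_delPair_sub_le (f : (Fin n → ℂ) → ℝ) (z p ξ : Fin n → ℂ) :
    ‖delPair n f z ξ - delPair n f p ξ‖ ≤ ‖fderiv ℝ f z - fderiv ℝ f p‖ * ‖ξ‖ := by
  have h1 := (fderiv ℝ f z - fderiv ℝ f p).le_opNorm ξ
  have h2 := (fderiv ℝ f z - fderiv ℝ f p).le_opNorm (Complex.I • ξ)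
  rw [norm_I_smul] at h2
  have e : delPair n f z ξ - delPair n f p ξ
      = (1 / 2) * (((fderiv ℝ f z - fderiv ℝ f p) ξ : ℝ) -
        Complex.I * ((fderiv ℝ f z - fderiv ℝ f p) (Complex.I • ξ) : ℝ)) := by
    simp only [delPair, sub_apply]
    push_cast
    ring
  rw [e, norm_mul]
  have := norm_sub_le (((fderiv ℝ f z - fderiv ℝ f p) ξ : ℝ) : ℂ)
    (Complex.I * ((fderiv ℝ f z - fderiv ℝ f p) (Complex.I • ξ) : ℝ))
  rw [norm_mul, Complex.norm_I, one_mul, Complex.norm_real, Complex.norm_real] at this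
  rw [show ‖(1 / 2 : ℂ)‖ = 1 / 2 by norm_num]
  linarith

lemma norm_delPair_le (f : (Fin n → ℂ) → ℝ) (z ξ : Fin n → ℂ) :
    ‖delPair n f z ξ‖ ≤ ‖fderiv ℝ f z‖ * ‖ξ‖ := by
  have h1 := (fderiv ℝ f z).le_opNorm ξ
  have h2 := (fderiv ℝ f z).le_opNorm (Complex.I • ξ)
  rw [norm_I_smul] at h2
  rw [delPair, norm_mul]
  have := norm_sub_le ((fderiv ℝ f z ξ : ℝ) : ℂ)
    (Complex.I * (fderiv ℝ f z (Complex.I • ξ) : ℝ))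
  rw [norm_mul, Complex.norm_I, one_mul, Complex.norm_real, Complex.norm_real] at this
  rw [show ‖(1 / 2 : ℂ)‖ = 1 / 2 by norm_num]
  linarith

lemma delPair_re (f : (Fin n → ℂ) → ℝ) (z ξ : Fin n → ℂ) :
    (delPair n f z ξ).re = fderiv ℝ f z ξ / 2 := by
  simp [delPair]
  ring

lemma delPair_sub (f : (Fin n → ℂ) → ℝ) (z ξ η : Fin n → ℂ) :
    delPair n f z (ξ - η) = delPair n f z ξ - delPair n f z η := by
  simp only [delPair, smul_sub, map_sub]
  push_cast
  ring

lemma delPair_smul {f : (Fin n → ℂ) → ℝ} {z : Fin n → ℂ} (hf : DifferentiableAt ℝ f z) (a : ℂ)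
    (ξ : Fin n → ℂ) : delPair n f z (a • ξ) = a * delPair n f z ξ := by
  rw [delPair_eq_sum f hf, delPair_eq_sum f hf, Finset.mul_sum]
  exact Finset.sum_congr rfl fun j _ => by simp [mul_assoc]

lemma abs_hessC_sub_le (f : (Fin n → ℂ) → ℝ) (z p ξ : Fin n → ℂ) :
    |hessC n f z ξ - hessC n f p ξ|
      ≤ ‖fderiv ℝ (fderiv ℝ f) z - fderiv ℝ (fderiv ℝ f) p‖ * ‖ξ‖ ^ 2 / 2 := by
  set D := fderiv ℝ (fderiv ℝ f) z - fderiv ℝ (fderiv ℝ f) p with hD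
  have h1 := D.le_opNorm₂ ξ ξ
  have h2 := D.le_opNorm₂ (Complex.I • ξ) (Complex.I • ξ)
  rw [norm_I_smul] at h2
  rw [Real.norm_eq_abs, abs_le] at h1 h2
  simp only [hD, sub_apply] at h1 h2
  rw [hessC_eq_fderiv, hessC_eq_fderiv, abs_le]
  constructor <;> nlinarith [h1.1, h1.2, h2.1, h2.2]

lemma abs_hessC_le (f : (Fin n → ℂ) → ℝ) (z ξ : Fin n → ℂ) :
    |hessC n f z ξ| ≤ ‖fderiv ℝ (fderiv ℝ f) z‖ * ‖ξ‖ ^ 2 / 2 := by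
  set D := fderiv ℝ (fderiv ℝ f) z with hD
  have h1 := D.le_opNorm₂ ξ ξ
  have h2 := D.le_opNorm₂ (Complex.I • ξ) (Complex.I • ξ)
  rw [norm_I_smul] at h2
  rw [Real.norm_eq_abs, abs_le] at h1 h2
  rw [hessC_eq_fderiv, abs_le]
  constructor <;> nlinarith [h1.1, h1.2, h2.1, h2.2]

lemma abs_hessC_sub_sub_le (f : (Fin n → ℂ) → ℝ) (z ξ v : Fin n → ℂ) :
    |hessC n f z (ξ - v) - hessC n f z ξ|
      ≤ ‖fderiv ℝ (fderiv ℝ f) z‖ * (‖v‖ * (‖ξ‖ + ‖ξ - v‖)) / 2 := by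
  set D := fderiv ℝ (fderiv ℝ f) z with hD
  have b : ∀ x y : Fin n → ℂ, |D (x - y) (x - y) - D x x| ≤ ‖D‖ * (‖y‖ * (‖x‖ + ‖x - y‖)) := by
    intro x y
    have e : D (x - y) (x - y) - D x x = -(D y x) - D (x - y) y := by
      simp only [map_sub, sub_apply]
      ring
    have h1 := D.le_opNorm₂ y x
    have h2 := D.le_opNorm₂ (x - y) y
    rw [Real.norm_eq_abs, abs_le] at h1 h2
    rw [e, abs_le]
    constructor <;> nlinarith [h1.1, h1.2, h2.1, h2.2]
  have h1 := b ξ v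
  have h2 := b (Complex.I • ξ) (Complex.I • v)
  rw [← smul_sub, norm_I_smul, norm_I_smul, norm_I_smul] at h2
  rw [abs_le] at h1 h2
  rw [hessC_eq_fderiv, hessC_eq_fderiv, smul_sub, abs_le]
  rw [smul_sub] at h2
  constructor <;> linarith [h1.1, h1.2, h2.1, h2.2]

end LeviGeometry

section LeviGeometry

variable {n : ℕ}

/-- Near a nondegenerate boundary point one reaches the zero set in a transversal direction. -/
lemma exists_zero_near {r : (Fin n → ℂ) → ℝ} (hr : ContDiff ℝ 2 r) {z w : Fin n → ℂ} {A c : ℝ}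
    (hA : 0 < A) (hc : 0 < c) (hw : ‖w‖ ≤ 1) (hzw : c ≤ fderiv ℝ r z w)
    (hL : ∀ p ∈ closedBall z 1, ‖fderiv ℝ r z - fderiv ℝ r p‖ ≤ A * ‖z - p‖)
    (h0 : r z ≤ 0) (h1 : 2 * (-r z) ≤ c) (h2 : 4 * A * (-r z) ≤ c ^ 2) :
    ∃ p ∈ closedBall z 1, r p = 0 ∧ ‖z - p‖ ≤ 2 * (-r z) / c ∧ c / 2 ≤ fderiv ℝ r p w := by
  set T := 2 * (-r z) / c with hT
  have hT0 : 0 ≤ T := div_nonneg (by linarith) hc.le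
  have hT1 : T ≤ 1 := (div_le_one hc).2 h1
  have hAT : A * T ≤ c / 2 := by
    rw [hT, ← mul_div_assoc, div_le_iff₀ hc]
    nlinarith
  have hdist : ∀ t ∈ Icc 0 T, ‖z - (z + t • w)‖ ≤ t := fun t ht => by
    rw [sub_add_cancel_left, norm_neg, norm_smul, Real.norm_of_nonneg ht.1]
    exact mul_le_of_le_one_right ht.1 hw
  have hmem : ∀ t ∈ Icc 0 T, z + t • w ∈ closedBall z 1 := fun t ht => by
    rw [mem_closedBall, dist_comm, dist_eq_norm]
    exact (hdist t ht).trans (ht.2.trans hT1)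
  have hd : ∀ t ∈ Icc 0 T, c / 2 ≤ fderiv ℝ r (z + t • w) w := fun t ht => by
    have e1 := (fderiv ℝ r z - fderiv ℝ r (z + t • w)).le_opNorm w
    have e2 := hL _ (hmem t ht)
    have e3 : A * ‖z - (z + t • w)‖ ≤ c / 2 := le_trans (by
      gcongr
      exact (hdist t ht).trans ht.2) hAT
    have e4 : ‖fderiv ℝ r z - fderiv ℝ r (z + t • w)‖ * ‖w‖ ≤ c / 2 :=
      (mul_le_of_le_one_right (norm_nonneg _) hw).trans (e2.trans e3)
    have e5 := (Real.le_norm_self _).trans (e1.trans e4)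
    rw [sub_apply] at e5
    linarith
  have hder : ∀ t : ℝ, HasDerivAt (fun t : ℝ => r (z + t • w)) (fderiv ℝ r (z + t • w) w) t := by
    intro t
    have h := ((hasDerivAt_id t).smul_const w).const_add z
    rw [one_smul] at h
    exact (hr.differentiable two_ne_zero (z + t • w)).hasFDerivAt.comp_hasDerivAt t h
  have hcont : ContinuousOn (fun t : ℝ => r (z + t • w)) (Icc 0 T) :=
    fun t _ => (hder t).continuousAt.continuousWithinAt
  have hend : 0 ≤ r (z + T • w) := by
    have := Convex.mul_sub_le_image_sub_of_le_deriv (convex_Icc 0 T) hcont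
      (fun t _ => (hder t).differentiableAt.differentiableWithinAt) (C := c / 2)
      (fun t ht => by
        rw [(hder t).deriv]
        exact hd t (interior_subset ht)) 0 (left_mem_Icc.2 hT0) T (right_mem_Icc.2 hT0) hT0
    have e : c / 2 * (T - 0) = - r z := by
      rw [hT]
      field_simp
      ring
    rw [e] at this
    simp only [zero_smul, add_zero] at this
    linarith
  obtain ⟨t, ht, h⟩ := intermediate_value_Icc hT0 hcont
    (show (0 : ℝ) ∈ Icc _ _ from ⟨by simpa using h0, hend⟩)
  exact ⟨z + t • w, hmem t ht, h, (hdist t ht).trans ht.2, hd t ht⟩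

set_option maxHeartbeats 400000 in
/-- On a bounded Levi pseudoconvex domain, the complex Hessian of `-log (-r)` is bounded below. -/
lemma IsLeviDefiningFn.exists_hessC_lower_bound {Ω : Set (Fin n → ℂ)} {r : (Fin n → ℂ) → ℝ}
    (hr : IsLeviDefiningFn n Ω r) (hbd : Bornology.IsBounded Ω) :
    ∃ C ≥ 0, ∀ z ∈ Ω, ∀ ξ : Fin n → ℂ, -(C * enormSq n ξ)
      ≤ hessC n r z ξ / (-r z) + Complex.normSq (delPair n r z ξ) / r z ^ 2 := by
  obtain ⟨hrs, hΩ, hnd, hlevi⟩ := hr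
  have hr2 : ContDiff ℝ 2 r := hrs.of_le (WithTop.coe_le_coe.2 le_top)
  have hr3 : ContDiff ℝ 3 r := hrs.of_le (WithTop.coe_le_coe.2 le_top)
  have hD1 : ContDiff ℝ 2 (fderiv ℝ r) := hr3.fderiv_right (by norm_num)
  have hD2 : ContDiff ℝ 1 (fderiv ℝ (fderiv ℝ r)) := hD1.fderiv_right (by norm_num)
  obtain ⟨R, hR⟩ := hbd.subset_closedBall (0 : Fin n → ℂ)
  obtain ⟨A₁, hA₁, h₁⟩ := exists_bound_lipschitz_closedBall (hD1.of_le (by norm_num)) (R + 1)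
  obtain ⟨A₂, hA₂, h₂⟩ := exists_bound_lipschitz_closedBall hD2 (R + 1)
  have hball : ∀ z ∈ Ω, closedBall z 1 ⊆ closedBall (0 : Fin n → ℂ) (R + 1) := fun z hz =>
    closedBall_subset_closedBall' (by have := hR hz; rw [mem_closedBall] at this; linarith)
  have hself : ∀ z : Fin n → ℂ, z ∈ closedBall z 1 := fun z => mem_closedBall_self zero_le_one
  -- the gradient is bounded below near the boundary
  have hcomp : IsCompact (closure Ω) := hbd.isCompact_closure
  obtain ⟨c₀, hc₀, hc⟩ : ∃ c₀ > 0, ∀ z ∈ closure Ω, c₀ ≤ ‖fderiv ℝ r z‖ + |r z| := by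
    refine hcomp.exists_forall_le' (f := fun z => ‖fderiv ℝ r z‖ + |r z|)
      ((hD1.continuous.norm.add hrs.continuous.abs).continuousOn) fun z _ => ?_
    by_cases hz : r z = 0
    · have := norm_pos_iff.2 (hnd z hz)
      positivity
    · have := abs_pos.2 hz
      positivity
  set c := c₀ / 4 with hcdef
  have hcpos : 0 < c := by positivity
  set q₁ := min (c₀ / 2) (min (c / 2) (c ^ 2 / (4 * A₁))) with hq₁
  have hq₁pos : 0 < q₁ := by positivity
  set D := max (A₂ / (2 * q₁)) (max (A₂ / c + A₂ * (8 * A₁ / c ^ 2) * (1 + 2 * A₁ / c))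
    (A₂ * (4 / c) * (1 + 2 * A₁ / c))) with hDdef
  have hD0 : 0 ≤ D := le_trans (by positivity) (le_max_left _ _)
  refine ⟨D + D ^ 2 / 4, by positivity, fun z hz ξ => ?_⟩
  have hrz : r z < 0 := by rwa [hΩ] at hz
  set q := -r z with hq
  have hqpos : 0 < q := by linarith
  have hξ := norm_sq_le_enormSq ξ
  have hzb := hball z hz (hself z)
  have hN : r z ^ 2 = q ^ 2 := by rw [hq]; ring
  rw [hN]
  refine le_trans (neg_le_neg (mul_le_mul_of_nonneg_left hξ (by positivity))) ?_
  by_cases hlarge : q₁ ≤ q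
  · have e1 := (abs_le.1 (abs_hessC_le r z ξ)).1
    have e2 : ‖fderiv ℝ (fderiv ℝ r) z‖ * ‖ξ‖ ^ 2 / 2 ≤ D * ‖ξ‖ ^ 2 * q := by
      have : A₂ / 2 ≤ D * q := by
        calc A₂ / 2 = A₂ / (2 * q₁) * q₁ := by field_simp
          _ ≤ D * q := mul_le_mul (le_max_left _ _) hlarge hq₁pos.le hD0
      have h3 := (h₂ z hzb).1
      nlinarith [sq_nonneg ‖ξ‖]
    have e3 : -(D * ‖ξ‖ ^ 2) ≤ hessC n r z ξ / q := by
      rw [le_div_iff₀ hqpos]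
      linarith
    have e4 : 0 ≤ Complex.normSq (delPair n r z ξ) / q ^ 2 :=
      div_nonneg (Complex.normSq_nonneg _) (sq_nonneg _)
    nlinarith [mul_nonneg (sq_nonneg D) (sq_nonneg ‖ξ‖)]
  push Not at hlarge
  have hq2 : q < c₀ / 2 := hlarge.trans_le (min_le_left _ _)
  have hq3 : q ≤ c / 2 := hlarge.le.trans ((min_le_right _ _).trans (min_le_left _ _))
  have hq4 : q ≤ c ^ 2 / (4 * A₁) := hlarge.le.trans ((min_le_right _ _).trans (min_le_right _ _))
  obtain ⟨w, hw, hzw⟩ : ∃ w : Fin n → ℂ, ‖w‖ ≤ 1 ∧ c ≤ fderiv ℝ r z w := by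
    have h := hc z (subset_closure hz)
    rw [abs_of_neg hrz] at h
    obtain ⟨x, hx, hx'⟩ := (fderiv ℝ r z).exists_lt_apply_of_lt_opNorm
      (show c < ‖fderiv ℝ r z‖ by rw [hcdef]; linarith)
    rw [Real.norm_eq_abs] at hx'
    rcases lt_abs.1 hx' with h | h
    · exact ⟨x, hx.le, h.le⟩
    · exact ⟨-x, by rw [norm_neg]; exact hx.le, by rw [map_neg]; exact h.le⟩
  obtain ⟨p, hp, hp0, hzp, hpw⟩ := exists_zero_near hr2 hA₁ hcpos hw hzw
    (fun p hp => (h₁ z hzb).2 p (hball z hz hp)) hrz.le (by linarith)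
    (by rw [le_div_iff₀ (by positivity)] at hq4; linarith)
  have hpb := hball z hz hp
  -- the tangential part of `ξ` at `p`
  set lp := delPair n r p ξ with hlp
  set lw := delPair n r p w with hlw
  have hlw0 : c / 4 ≤ ‖lw‖ := by
    refine le_trans ?_ (Complex.re_le_norm lw)
    rw [hlw, delPair_re]
    linarith
  have hlwpos : 0 < ‖lw‖ := lt_of_lt_of_le (by positivity) hlw0
  set v := (lp / lw) • w with hv
  have hrd : DifferentiableAt ℝ r p := hr2.differentiable two_ne_zero p
  have htan : delPair n r p (ξ - v) = 0 := by
    rw [delPair_sub, hv, delPair_smul hrd, div_mul_cancel₀ _ (norm_pos_iff.1 hlwpos), sub_self]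
  have hH := hlevi p hp0 _ htan
  have hvn : ‖v‖ ≤ 4 / c * ‖lp‖ := by
    rw [hv, norm_smul, norm_div]
    refine (mul_le_of_le_one_right (by positivity) hw).trans ?_
    rw [div_mul_eq_mul_div, div_le_div_iff₀ hlwpos hcpos]
    nlinarith [norm_nonneg lp]
  set L := ‖delPair n r z ξ‖ with hL
  set x := ‖ξ‖ with hx
  have hx0 : 0 ≤ x := norm_nonneg ξ
  have hL0 : 0 ≤ L := norm_nonneg _
  have hlp1 : ‖lp‖ ≤ A₁ * x := (norm_delPair_le r p ξ).trans (by
    gcongr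
    exact (h₁ p hpb).1)
  have hlp2 : ‖lp‖ ≤ L + A₁ * (2 * q / c) * x := by
    have e1 := norm_delPair_sub_le r z p ξ
    have e2 : ‖fderiv ℝ r z - fderiv ℝ r p‖ ≤ A₁ * (2 * q / c) :=
      ((h₁ z hzb).2 p hpb).trans (by gcongr)
    have e3 := norm_sub_norm_le lp (delPair n r z ξ)
    rw [norm_sub_rev] at e3
    have e4 : ‖fderiv ℝ r z - fderiv ℝ r p‖ * x ≤ A₁ * (2 * q / c) * x := by gcongr
    linarith
  have hv1 : ‖v‖ ≤ 4 * A₁ / c * x := hvn.trans ((mul_le_mul_of_nonneg_left hlp1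
    (by positivity)).trans_eq (by ring))
  have hv2 : ‖v‖ ≤ 4 / c * L + 8 * A₁ / c ^ 2 * q * x :=
    hvn.trans ((mul_le_mul_of_nonneg_left hlp2 (by positivity)).trans_eq (by field_simp; ring))
  have hS : ‖ξ‖ + ‖ξ - v‖ ≤ 2 * (1 + 2 * A₁ / c) * x := by
    have := norm_sub_le ξ v
    calc ‖ξ‖ + ‖ξ - v‖ ≤ x + (x + 4 * A₁ / c * x) := by linarith
      _ = 2 * (1 + 2 * A₁ / c) * x := by ring
  have b1 : hessC n r p ξ - A₂ / c * q * x ^ 2 ≤ hessC n r z ξ := by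
    have e1 := (abs_le.1 (abs_hessC_sub_le r z p ξ)).1
    have e2 : ‖fderiv ℝ (fderiv ℝ r) z - fderiv ℝ (fderiv ℝ r) p‖ * ‖ξ‖ ^ 2 / 2
        ≤ A₂ * (2 * q / c) * x ^ 2 / 2 := by
      gcongr
      exact ((h₂ z hzb).2 p hpb).trans (by gcongr)
    have e3 : A₂ * (2 * q / c) * x ^ 2 / 2 = A₂ / c * q * x ^ 2 := by ring
    linarith
  have b2 : -(A₂ * (4 / c * L + 8 * A₁ / c ^ 2 * q * x) * (1 + 2 * A₁ / c) * x)
      ≤ hessC n r p ξ := by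
    have e1 := (abs_le.1 (abs_hessC_sub_sub_le r p ξ v)).2
    have e2 : ‖fderiv ℝ (fderiv ℝ r) p‖ * (‖v‖ * (‖ξ‖ + ‖ξ - v‖)) / 2
        ≤ A₂ * ((4 / c * L + 8 * A₁ / c ^ 2 * q * x) * (2 * (1 + 2 * A₁ / c) * x)) / 2 := by
      gcongr
      exact (h₂ p hpb).1
    linarith
  have b3 : -(D * q * x ^ 2) - D * L * x ≤ hessC n r z ξ := by
    have d1 : A₂ / c + A₂ * (8 * A₁ / c ^ 2) * (1 + 2 * A₁ / c) ≤ D :=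
      (le_max_left _ _).trans (le_max_right _ _)
    have d2 : A₂ * (4 / c) * (1 + 2 * A₁ / c) ≤ D := (le_max_right _ _).trans (le_max_right _ _)
    have e1 := mul_le_mul_of_nonneg_right d1 (show 0 ≤ q * x ^ 2 by positivity)
    have e2 := mul_le_mul_of_nonneg_right d2 (show 0 ≤ L * x by positivity)
    linear_combination e1 + e2 + b1 + b2
  have e : Complex.normSq (delPair n r z ξ) = L ^ 2 := Complex.normSq_eq_norm_sq _
  have e' : hessC n r z ξ / q + L ^ 2 / q ^ 2 = (hessC n r z ξ * q + L ^ 2) / q ^ 2 := by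
    field_simp
  rw [e, e', le_div_iff₀ (by positivity)]
  linear_combination sq_nonneg (L - D * q * x / 2) + mul_le_mul_of_nonneg_right b3 hqpos.le

end LeviGeometry

section HessianCalculus

variable {n : ℕ}

lemma normSq_delPair (f : (Fin n → ℂ) → ℝ) (z ξ : Fin n → ℂ) :
    Complex.normSq (delPair n f z ξ)
      = (1 / 4) * (fderiv ℝ f z ξ ^ 2 + fderiv ℝ f z (Complex.I • ξ) ^ 2) := by
  simp [delPair, Complex.normSq_apply]
  ring

lemma differentiableAt_fderiv {f : (Fin n → ℂ) → ℝ} {z : Fin n → ℂ} (hf : ContDiffAt ℝ 2 f z) :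
    DifferentiableAt ℝ (fderiv ℝ f) z :=
  (hf.fderiv_right (m := 1) (by norm_num)).differentiableAt one_ne_zero

lemma hessC_comp {f : (Fin n → ℂ) → ℝ} {z : Fin n → ℂ} {h h' : ℝ → ℝ} {h'' : ℝ}
    (hf : ContDiffAt ℝ 2 f z) (hh : ∀ᶠ t in 𝓝 (f z), HasDerivAt h (h' t) t)
    (hh' : HasDerivAt h' h'' (f z)) (ξ : Fin n → ℂ) :
    hessC n (fun x => h (f x)) z ξ
      = h' (f z) * hessC n f z ξ + h'' * Complex.normSq (delPair n f z ξ) := by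
  have hfd : DifferentiableAt ℝ f z := hf.differentiableAt two_ne_zero
  have ev : fderiv ℝ (fun x => h (f x)) =ᶠ[𝓝 z] fun x => h' (f x) • fderiv ℝ f x := by
    filter_upwards [hfd.continuousAt.eventually hh,
      hf.eventually (by simp)] with x hx hfx
    exact (hx.comp_hasFDerivAt x (hfx.differentiableAt two_ne_zero).hasFDerivAt).fderiv
  have h2 : HasFDerivAt (fun x => h' (f x)) (h'' • fderiv ℝ f z) z :=
    hh'.comp_hasFDerivAt z hfd.hasFDerivAt
  have h3 := h2.fun_smul (differentiableAt_fderiv hf).hasFDerivAt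
  rw [hessC_eq_fderiv, hessC_eq_fderiv, normSq_delPair, ev.fderiv_eq, h3.fderiv]
  simp only [add_apply, smul_apply, ContinuousLinearMap.smulRight_apply, smul_eq_mul]
  ring

lemma hessC_add {f g : (Fin n → ℂ) → ℝ} {z : Fin n → ℂ} (hf : ContDiffAt ℝ 2 f z)
    (hg : ContDiffAt ℝ 2 g z) (ξ : Fin n → ℂ) :
    hessC n (fun x => f x + g x) z ξ = hessC n f z ξ + hessC n g z ξ := by
  have ev : fderiv ℝ (fun x => f x + g x) =ᶠ[𝓝 z] fun x => fderiv ℝ f x + fderiv ℝ g x := by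
    filter_upwards [hf.eventually (by simp), hg.eventually (by simp)] with x hfx hgx
    exact fderiv_fun_add (hfx.differentiableAt two_ne_zero) (hgx.differentiableAt two_ne_zero)
  rw [hessC_eq_fderiv, hessC_eq_fderiv, hessC_eq_fderiv, ev.fderiv_eq,
    fderiv_fun_add (differentiableAt_fderiv hf) (differentiableAt_fderiv hg)]
  simp only [add_apply]
  ring

lemma hessC_const_mul {f : (Fin n → ℂ) → ℝ} {z : Fin n → ℂ} (hf : ContDiffAt ℝ 2 f z) (a : ℝ)
    (ξ : Fin n → ℂ) : hessC n (fun x => a * f x) z ξ = a * hessC n f z ξ := by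
  have := hessC_comp (h := fun t => a * t) (h' := fun _ => a) hf
    (Filter.Eventually.of_forall fun t => by simpa using (hasDerivAt_id t).const_mul a)
    (hasDerivAt_const _ _) ξ
  simpa using this

lemma Theta_add {φ η τ : (Fin n → ℂ) → ℝ} {z : Fin n → ℂ} (hφ : ContDiffAt ℝ 2 φ z)
    (hη : ContDiffAt ℝ 2 η z) (ξ : Fin n → ℂ) :
    Theta n (fun x => φ x + η x) τ z ξ = Theta n φ τ z ξ + τ z * hessC n η z ξ := by
  simp only [Theta, hessC_add hφ hη]
  ring

lemma contDiff_enormSq {m : ℕ∞ω} : ContDiff ℝ m (enormSq n) := by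
  have : enormSq n = fun z : Fin n → ℂ => ∑ j, ‖z j‖ ^ 2 := by
    funext z
    simp only [enormSq, Complex.normSq_eq_norm_sq]
  rw [this]
  exact ContDiff.sum fun j _ => (contDiff_apply ℝ ℂ j).norm_sq ℝ

lemma hessC_enormSq (z ξ : Fin n → ℂ) : hessC n (enormSq n) z ξ = enormSq n ξ := by
  have h1 : ∀ x w : Fin n → ℂ, fderiv ℝ (enormSq n) x w
      = ∑ j, 2 * ((x j).re * (w j).re + (x j).im * (w j).im) := by
    intro x w
    have hre : ∀ j, HasFDerivAt (fun z : Fin n → ℂ => (z j).re)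
        (Complex.reCLM.comp (ContinuousLinearMap.proj j : (Fin n → ℂ) →L[ℝ] ℂ)) x := fun j =>
      (Complex.reCLM.comp (ContinuousLinearMap.proj j : (Fin n → ℂ) →L[ℝ] ℂ)).hasFDerivAt
    have him : ∀ j, HasFDerivAt (fun z : Fin n → ℂ => (z j).im)
        (Complex.imCLM.comp (ContinuousLinearMap.proj j : (Fin n → ℂ) →L[ℝ] ℂ)) x := fun j =>
      (Complex.imCLM.comp (ContinuousLinearMap.proj j : (Fin n → ℂ) →L[ℝ] ℂ)).hasFDerivAt
    have h := HasFDerivAt.fun_sum (u := Finset.univ) fun j _ =>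
      ((hre j).fun_mul (hre j)).fun_add ((him j).fun_mul (him j))
    have e : enormSq n = fun z : Fin n → ℂ => ∑ j, ((z j).re * (z j).re + (z j).im * (z j).im) := by
      funext z
      simp only [enormSq, Complex.normSq_apply]
    rw [e]
    rw [HasFDerivAt.fderiv h, sum_apply]
    refine Finset.sum_congr rfl fun j _ => ?_
    simp
    ring
  have hd : DifferentiableAt ℝ (fderiv ℝ (enormSq n)) z :=
    differentiableAt_fderiv contDiff_enormSq.contDiffAt
  have h2 : ∀ w : Fin n → ℂ, fderiv ℝ (fderiv ℝ (enormSq n)) z w w = 2 * enormSq n w := by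
    intro w
    rw [← fderiv_fderiv_apply hd]
    have h3 : (fun x => fderiv ℝ (enormSq n) x w) = fun x => fderiv ℝ (enormSq n) w x := by
      funext x
      rw [h1, h1]
      exact Finset.sum_congr rfl fun j _ => by ring
    rw [h3, ContinuousLinearMap.fderiv, h1, enormSq, Finset.mul_sum]
    exact Finset.sum_congr rfl fun j _ => by rw [Complex.normSq_apply]
  rw [hessC_eq_fderiv, h2, h2]
  have : enormSq n (Complex.I • ξ) = enormSq n ξ := by simp [enormSq]
  rw [this]
  ring

end HessianCalculus

section Weights

variable {n : ℕ}

lemma exists_bound_deriv_smoothTransition :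
    ∃ C > 0, ∀ t, |deriv Real.smoothTransition t| ≤ C ∧
      (deriv Real.smoothTransition t ≠ 0 → t ∈ Icc (0 : ℝ) 1) := by
  have hc : Continuous (deriv Real.smoothTransition) :=
    (Real.smoothTransition.contDiff (n := 1)).continuous_deriv le_rfl
  have h0 : ∀ t, deriv Real.smoothTransition t ≠ 0 → t ∈ Icc (0 : ℝ) 1 := fun t ht => by
    by_contra h
    apply ht
    rw [mem_Icc, not_and_or, not_le, not_le] at h
    rcases h with h | h
    · have e : Real.smoothTransition =ᶠ[𝓝 t] fun _ => 0 := by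
        filter_upwards [Iio_mem_nhds h] with s hs
        exact Real.smoothTransition.zero_of_nonpos (le_of_lt hs)
      rw [e.deriv_eq, deriv_const]
    · have e : Real.smoothTransition =ᶠ[𝓝 t] fun _ => 1 := by
        filter_upwards [Ioi_mem_nhds h] with s hs
        exact Real.smoothTransition.one_of_one_le (le_of_lt hs)
      rw [e.deriv_eq, deriv_const]
  obtain ⟨C, hC⟩ := (isCompact_Icc (a := (0 : ℝ)) (b := 1)).exists_bound_of_continuousOn
    hc.continuousOn
  refine ⟨max C 1, by positivity, fun t => ⟨?_, h0 t⟩⟩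
  by_cases h : deriv Real.smoothTransition t = 0
  · rw [h, abs_zero]
    positivity
  · exact (hC t (h0 t h)).trans (le_max_left _ _)

/-- Plurisubharmonic weights and cut-off functions adapted to a bounded Levi pseudoconvex domain. -/
lemma IsLeviDefiningFn.exists_weights {Ω : Set (Fin n → ℂ)} {r : (Fin n → ℂ) → ℝ}
    (hr : IsLeviDefiningFn n Ω r) (hbd : Bornology.IsBounded Ω) :
    ∃ (η : (Fin n → ℂ) → ℝ) (χ : ℕ → (Fin n → ℂ) → ℝ),
      ContDiffOn ℝ ∞ η Ω ∧ (∀ z ∈ Ω, 0 ≤ η z) ∧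
      (∀ ν, ContDiff ℝ ∞ (χ ν)) ∧ (∀ ν, HasCompactSupport (χ ν)) ∧ (∀ ν, tsupport (χ ν) ⊆ Ω) ∧
      (∀ ν z, χ ν z ∈ Icc (0 : ℝ) 1) ∧
      (∀ K ⊆ Ω, IsCompact K → ∀ᶠ ν in Filter.atTop, ∀ z ∈ K,
        χ ν z = 1 ∧ ∀ j, wirt (-I) (cplx (χ ν)) j z = 0) ∧
      ∀ ε > 0, ∃ (ψ : (Fin n → ℂ) → ℝ) (B : ℝ), ContDiffOn ℝ ∞ ψ Ω ∧ (∀ z ∈ Ω, 0 ≤ ψ z) ∧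
        (∀ z ∈ Ω, ∀ ξ, 2 * enormSq n (fun j => wirt (-I) (cplx ψ) j z) * enormSq n ξ
          ≤ ε * hessC n η z ξ) ∧
        ∀ ν, ∀ z ∈ Ω,
          enormSq n (fun j => wirt (-I) (cplx (χ ν)) j z) * Real.exp (-ψ z) ≤ B := by
  obtain ⟨C, hC0, hC⟩ := hr.exists_hessC_lower_bound hbd
  obtain ⟨S, hS0, hS⟩ := exists_bound_deriv_smoothTransition
  obtain ⟨hrs, hΩ, -, -⟩ := hr
  have hneg : ∀ z ∈ Ω, r z < 0 := fun z hz => by rwa [hΩ] at hz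
  have hr2 : ContDiff ℝ 2 r := hrs.of_le (WithTop.coe_le_coe.2 le_top)
  have hrd : ∀ z, DifferentiableAt ℝ r z := hr2.differentiable two_ne_zero
  have cr : ∀ j, Continuous (wirt (-I) (cplx r) j) := fun j =>
    continuous_wirt (contDiff_cplx (hr2.of_le (by norm_num)))
  obtain ⟨Q, hQ⟩ := hbd.isCompact_closure.exists_bound_of_continuousOn
    (f := fun z => enormSq n fun j => wirt (-I) (cplx r) j z)
    (continuous_finsetSum _ fun j _ => Complex.continuous_normSq.comp (cr j)).continuousOn
  have hQ' : ∀ z ∈ Ω, enormSq n (fun j => wirt (-I) (cplx r) j z) ≤ |Q| := fun z hz =>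
    (Real.le_norm_self _).trans ((hQ z (subset_closure hz)).trans (le_abs_self Q))
  have hQ0 : 0 ≤ |Q| := abs_nonneg Q
  set M := 4 * C + 1 with hM
  let ℓ : (Fin n → ℂ) → ℝ := fun z => M * enormSq n z + -4 * Real.log (-r z)
  have hlog : ContDiffOn ℝ ∞ (fun z => -4 * Real.log (-r z)) Ω :=
    contDiffOn_const.mul (hrs.neg.contDiffOn.log fun z hz => by
      have := hneg z hz
      linarith)
  have hlog2 : ∀ z ∈ Ω, ContDiffAt ℝ 2 (fun z => -4 * Real.log (-r z)) z := fun z hz =>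
    contDiffAt_const.mul (hr2.neg.contDiffAt.log (by
      have := hneg z hz
      linarith))
  have hsq : ContDiff ℝ ∞ fun z : Fin n → ℂ => M * enormSq n z :=
    contDiff_const.mul contDiff_enormSq
  have hℓ : ContDiffOn ℝ ∞ ℓ Ω := hsq.contDiffOn.add hlog
  have hsq2 : ContDiff ℝ 2 fun z : Fin n → ℂ => M * enormSq n z :=
    contDiff_const.mul contDiff_enormSq
  have hℓ2 : ∀ z ∈ Ω, ContDiffAt ℝ 2 ℓ z := fun z hz => hsq2.contDiffAt.add (hlog2 z hz)
  have hHℓ : ∀ z ∈ Ω, ∀ ξ, enormSq n ξ ≤ hessC n ℓ z ξ := fun z hz ξ => by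
    have hz' := hneg z hz
    have e1 : hessC n (fun z => -4 * Real.log (-r z)) z ξ
        = 4 * (hessC n r z ξ / (-r z) + Complex.normSq (delPair n r z ξ) / r z ^ 2) := by
      rw [hessC_comp (h := fun t => -4 * Real.log (-t)) (h' := fun t => -4 / t)
        (h'' := 4 / r z ^ 2) hr2.contDiffAt]
      · ring
      · filter_upwards [Iio_mem_nhds hz'] with t ht
        have := ((hasDerivAt_neg t).log (by linarith [show t < 0 from ht])).const_mul (-4)
        exact this.congr_deriv (by field_simp)
      · have := (hasDerivAt_inv hz'.ne).const_mul (-4)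
        exact this.congr_deriv (by ring)
    rw [show ℓ = fun z => M * enormSq n z + -4 * Real.log (-r z) from rfl,
      hessC_add hsq2.contDiffAt (hlog2 z hz), e1, hessC_const_mul contDiff_enormSq.contDiffAt,
      hessC_enormSq]
    have := hC z hz ξ
    rw [hM]
    linarith
  have hHη : ∀ z ∈ Ω, ∀ ξ, enormSq n ξ / r z ^ 4 ≤ hessC n (fun z => Real.exp (ℓ z)) z ξ := by
    intro z hz ξ
    rw [hessC_comp (hℓ2 z hz) (Filter.Eventually.of_forall Real.hasDerivAt_exp)
      (Real.hasDerivAt_exp _)]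
    have h1 : 1 / r z ^ 4 ≤ Real.exp (ℓ z) := by
      have h4 : Real.exp (-4 * Real.log (-r z)) = 1 / r z ^ 4 := by
        have hz' := hneg z hz
        rw [show -4 * Real.log (-r z) = -(((4 : ℕ) : ℝ) * Real.log (-r z)) by push_cast; ring,
          ← Real.log_pow, Real.exp_neg, Real.exp_log (by positivity [neg_pos.2 hz'])]
        rw [one_div, Even.neg_pow (by decide)]
      rw [← h4]
      refine Real.exp_le_exp.2 (le_add_of_nonneg_left (mul_nonneg ?_ (enormSq_nonneg z)))
      positivity
    have h2 := enormSq_nonneg ξ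
    have h3 := mul_le_mul h1 (hHℓ z hz ξ) h2 (Real.exp_pos _).le
    have h5 := mul_nonneg (Real.exp_pos (ℓ z)).le (Complex.normSq_nonneg (delPair n ℓ z ξ))
    rw [one_div, inv_mul_eq_div] at h3
    linarith
  have hst : ∀ t, HasDerivAt Real.smoothTransition (deriv Real.smoothTransition t) t := fun t =>
    ((Real.smoothTransition.contDiff (n := 1)).differentiable one_ne_zero t).hasDerivAt
  have hsupp : ∀ ν : ℕ, tsupport (fun z => Real.smoothTransition (ν * (-r z) - 1))
      ⊆ {z | 1 ≤ ν * (-r z)} := fun ν => by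
    refine closure_minimal (fun z hz => ?_)
      (isClosed_le continuous_const (continuous_const.mul hrs.continuous.neg))
    by_contra h
    rw [mem_ofPred_eq, not_le] at h
    exact hz (Real.smoothTransition.zero_of_nonpos (by linarith))
  have hsub : ∀ ν : ℕ, {z | 1 ≤ ν * (-r z)} ⊆ Ω := fun ν z hz => by
    rw [hΩ]
    by_contra h
    have h1 : 0 ≤ r z := not_lt.1 h
    have h2 : (1 : ℝ) ≤ ν * (-r z) := hz
    nlinarith [Nat.cast_nonneg (α := ℝ) ν]
  have hwχ : ∀ (ν : ℕ) j z,
      wirt (-I) (cplx fun z => Real.smoothTransition (ν * (-r z) - 1)) j z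
        = ((deriv Real.smoothTransition (ν * (-r z) - 1) * (-ν) : ℝ) : ℂ)
          * wirt (-I) (cplx r) j z := fun ν j z =>
    wirt_cplx_comp (h := fun t => Real.smoothTransition (ν * (-t) - 1)) (hrd z) (by
      have h1 : HasDerivAt (fun t : ℝ => (ν : ℝ) * (-t) - 1) (-ν) (r z) := by
        simpa using ((hasDerivAt_neg (r z)).const_mul (ν : ℝ)).sub_const 1
      exact (hst _).comp (r z) h1)
  refine ⟨fun z => Real.exp (ℓ z), fun ν z => Real.smoothTransition (ν * (-r z) - 1),
    Real.contDiff_exp.comp_contDiffOn hℓ, fun z _ => (Real.exp_pos _).le, fun ν =>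
    Real.smoothTransition.contDiff.comp ((contDiff_const.mul hrs.neg).sub contDiff_const),
    fun ν => ?_, fun ν => (hsupp ν).trans (hsub ν), fun ν z =>
    ⟨Real.smoothTransition.nonneg _, Real.smoothTransition.le_one _⟩, fun K hKΩ hK => ?_,
    fun ε hε => ?_⟩
  · exact hbd.isCompact_closure.of_isClosed_subset (isClosed_tsupport _)
      (((hsupp ν).trans (hsub ν)).trans subset_closure)
  · obtain ⟨m, hm0, hm⟩ := hK.exists_forall_le' (f := fun z => -r z)
      hrs.continuous.neg.continuousOn (a := 0) (fun z hz => by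
        have := hneg z (hKΩ hz)
        linarith)
    filter_upwards [Filter.eventually_ge_atTop ⌈3 / m⌉₊] with ν hν z hz
    have h1 : 3 / m ≤ ν := Nat.ceil_le.1 hν
    have h2 : 3 ≤ ν * (-r z) := by
      rw [div_le_iff₀ hm0] at h1
      exact h1.trans (by gcongr; exact hm z hz)
    refine ⟨Real.smoothTransition.one_of_one_le (by linarith), fun j => ?_⟩
    have h3 : deriv Real.smoothTransition (ν * (-r z) - 1) = 0 := by
      by_contra h
      have := ((hS _).2 h).2
      linarith
    rw [hwχ, h3]
    simp
  · set δ := Real.sqrt (ε / (2 * (|Q| + 1))) with hδ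
    have hδ0 : 0 < δ := Real.sqrt_pos.2 (by positivity)
    have hδ2 : 2 * δ ^ 2 * |Q| ≤ ε := by
      rw [hδ, Real.sq_sqrt (by positivity)]
      rw [show 2 * (ε / (2 * (|Q| + 1))) * |Q| = ε * (|Q| / (|Q| + 1)) by field_simp]
      refine mul_le_of_le_one_right hε.le ?_
      rw [div_le_one (by positivity)]
      linarith
    refine ⟨fun z => δ / (-r z), 8 * S ^ 2 * |Q| / δ ^ 2,
      contDiffOn_const.div hrs.neg.contDiffOn fun z hz => by
        have := hneg z hz
        linarith, fun z hz => div_nonneg hδ0.le (by linarith [hneg z hz]), fun z hz ξ => ?_,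
      fun ν z hz => ?_⟩
    · have hz' := hneg z hz
      have hw : ∀ j, wirt (-I) (cplx fun z => δ / (-r z)) j z
          = ((δ / r z ^ 2 : ℝ) : ℂ) * wirt (-I) (cplx r) j z := fun j =>
        wirt_cplx_comp (h := fun t => δ / (-t)) (hrd z) (by
          have h1 := ((hasDerivAt_neg (r z)).inv (by linarith)).const_mul δ
          exact h1.congr_deriv (by ring))
      simp only [hw, enormSq_const_mul, Complex.normSq_ofReal]
      have h1 := hHη z hz ξ
      have h2 := enormSq_nonneg ξ
      have h3 := hQ' z hz
      calc 2 * (δ / r z ^ 2 * (δ / r z ^ 2) * enormSq n fun j => wirt (-I) (cplx r) j z)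
            * enormSq n ξ
          = 2 * δ ^ 2 * (enormSq n fun j => wirt (-I) (cplx r) j z) * (enormSq n ξ / r z ^ 4) := by
            field_simp
        _ ≤ 2 * δ ^ 2 * |Q| * (enormSq n ξ / r z ^ 4) := by gcongr
        _ ≤ ε * (enormSq n ξ / r z ^ 4) := by gcongr
        _ ≤ _ := by gcongr
    · have hz' := hneg z hz
      simp only [hwχ, enormSq_const_mul, Complex.normSq_ofReal]
      set D := deriv Real.smoothTransition (ν * (-r z) - 1) with hD
      by_cases h0 : D = 0
      · rw [h0]
        simp only [zero_mul]
        positivity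
      have h1 : ν * (-r z) ≤ 2 := by
        have := ((hS _).2 h0).2
        linarith
      have hq : 0 < -r z := by linarith
      have h2 : D ^ 2 ≤ S ^ 2 := sq_le_sq' (by linarith [(abs_le.1 (hS (ν * (-r z) - 1)).1).1])
        (abs_le.1 (hS (ν * (-r z) - 1)).1).2
      have h3 : Real.exp (-(δ / (-r z))) ≤ 2 * (-r z) ^ 2 / δ ^ 2 := by
        have hx : 0 < δ / (-r z) := div_pos hδ0 hq
        have h5 := Real.quadratic_le_exp_of_nonneg hx.le
        rw [Real.exp_neg]
        refine (inv_anti₀ (by positivity) (show (δ / (-r z)) ^ 2 / 2 ≤ _ by linarith)).trans_eq ?_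
        field_simp
      have h4 : (ν * (-r z)) ^ 2 ≤ 4 := by
        have := pow_le_pow_left₀ (mul_nonneg (Nat.cast_nonneg ν) hq.le) h1 2
        linarith
      calc D * -(ν : ℝ) * (D * -(ν : ℝ)) * (enormSq n fun j => wirt (-I) (cplx r) j z)
            * Real.exp (-(δ / (-r z)))
          = D ^ 2 * (ν : ℝ) ^ 2 * (enormSq n fun j => wirt (-I) (cplx r) j z)
            * Real.exp (-(δ / (-r z))) := by ring
        _ ≤ S ^ 2 * (ν : ℝ) ^ 2 * |Q| * (2 * (-r z) ^ 2 / δ ^ 2) := by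
            have := hQ' z hz
            have := enormSq_nonneg fun j => wirt (-I) (cplx r) j z
            gcongr
        _ = 2 * S ^ 2 * |Q| / δ ^ 2 * (ν * (-r z)) ^ 2 := by ring
        _ ≤ 2 * S ^ 2 * |Q| / δ ^ 2 * 4 := by gcongr
        _ = _ := by ring

end Weights

section Projection

variable {ι α : Type*} [Fintype ι] [MeasurableSpace α] {μ : Measure α}

lemma exists_mem_orthogonal_inner_sub_eq_zero {E : Type*} [NormedAddCommGroup E]
    [InnerProductSpace ℂ E] [CompleteSpace E] (K : Submodule ℂ E) (x : E) :
    ∃ y ∈ K.orthogonal, ∀ v ∈ K.orthogonal, inner ℂ (x - y) v = 0 :=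
  have : CompleteSpace K.orthogonal := K.isClosed_orthogonal.completeSpace_coe
  ⟨K.orthogonal.starProjection x, Submodule.starProjection_apply_mem _ _, fun _ hv =>
    Submodule.inner_left_of_mem_orthogonal hv (Submodule.sub_starProjection_mem_orthogonal x)⟩

lemma inner_toLp_pi (F : ι → Lp ℂ 2 μ) (G : ι → Lp ℂ 2 μ) :
    inner ℂ (WithLp.toLp 2 F : PiLp 2 fun _ : ι => Lp ℂ 2 μ) (WithLp.toLp 2 G)
      = ∑ j, ∫ z, G j z * conj (F j z) ∂μ := by
  rw [PiLp.inner_apply]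
  simp only [L2.inner_def, RCLike.inner_apply]

lemma inner_toLp_single [DecidableEq ι] (j : ι) (f : Lp ℂ 2 μ)
    (G : PiLp 2 fun _ : ι => Lp ℂ 2 μ) :
    inner ℂ (WithLp.toLp 2 (Pi.single j f) : PiLp 2 fun _ : ι => Lp ℂ 2 μ) G
      = inner ℂ f (G j) := by
  rw [PiLp.inner_apply, Finset.sum_eq_single j]
  · simp
  · intro i _ hij
    simp [Pi.single_eq_of_ne hij]
  · simp

/-- Orthogonal projection of a square integrable field onto the fields that are closed with respect
to a family of test fields. -/
lemma exists_closed_projection (𝒢 : Set (ι → α → ℂ)) (h𝒢 : ∀ g ∈ 𝒢, ∀ j, MemLp (g j) 2 μ)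
    {X : ι → α → ℂ} (hX : ∀ j, MemLp (X j) 2 μ) :
    ∃ Y : ι → α → ℂ, (∀ j, MemLp (Y j) 2 μ) ∧
      (∀ g ∈ 𝒢, ∀ j k, ∫ z, Y j z * g k z ∂μ = ∫ z, Y k z * g j z ∂μ) ∧
      ∀ V : ι → α → ℂ, (∀ j, MemLp (V j) 2 μ) →
        (∀ g ∈ 𝒢, ∀ j k, ∫ z, V j z * g k z ∂μ = ∫ z, V k z * g j z ∂μ) →
        ∑ j, ∫ z, V j z * conj (Y j z) ∂μ = ∑ j, ∫ z, V j z * conj (X j z) ∂μ := by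
  classical
  let c : ∀ g : α → ℂ, MemLp g 2 μ → Lp ℂ 2 μ := fun g hg => hg.star.toLp _
  have hc : ∀ (g : α → ℂ) (hg : MemLp g 2 μ) (f : Lp ℂ 2 μ),
      inner ℂ (c g hg) f = ∫ z, f z * g z ∂μ := by
    intro g hg f
    rw [L2.inner_def]
    refine integral_congr_ae ?_
    filter_upwards [hg.star.coeFn_toLp] with z hz
    rw [RCLike.inner_apply]
    simp only [c]
    rw [hz]
    simp
  let T : Set (PiLp 2 fun _ : ι => Lp ℂ 2 μ) := {t | ∃ g, ∃ hg : g ∈ 𝒢, ∃ j k,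
    t = WithLp.toLp 2 (Pi.single j (c (g k) (h𝒢 g hg k)))
      - WithLp.toLp 2 (Pi.single k (c (g j) (h𝒢 g hg j)))}
  let K : Submodule ℂ (PiLp 2 fun _ : ι => Lp ℂ 2 μ) := Submodule.span ℂ T
  have hK : ∀ x : PiLp 2 fun _ : ι => Lp ℂ 2 μ, x ∈ K.orthogonal ↔
      ∀ g ∈ 𝒢, ∀ j k, ∫ z, x j z * g k z ∂μ = ∫ z, x k z * g j z ∂μ := by
    intro x
    have h1 : x ∈ K.orthogonal ↔ ∀ t ∈ T, inner ℂ t x = 0 := by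
      rw [Submodule.mem_orthogonal]
      refine ⟨fun h t ht => h t (Submodule.subset_span ht), fun h u hu => ?_⟩
      induction hu using Submodule.span_induction with
      | mem t ht => exact h t ht
      | zero => exact inner_zero_left _
      | add a b _ _ ha hb => rw [inner_add_left, ha, hb, add_zero]
      | smul a b _ hb => rw [inner_smul_left, hb, mul_zero]
    rw [h1]
    constructor
    · intro h g hg j k
      have := h _ ⟨g, hg, j, k, rfl⟩
      rwa [inner_sub_left, inner_toLp_single, inner_toLp_single, hc _ (h𝒢 g hg k), hc _ (h𝒢 g hg j),
        sub_eq_zero] at this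
    · rintro h t ⟨g, hg, j, k, rfl⟩
      rw [inner_sub_left, inner_toLp_single, inner_toLp_single, hc _ (h𝒢 g hg k), hc _ (h𝒢 g hg j),
        sub_eq_zero]
      exact h g hg j k
  set x : PiLp 2 fun _ : ι => Lp ℂ 2 μ := WithLp.toLp 2 fun j => (hX j).toLp _ with hx
  obtain ⟨y, hyK, hy⟩ := exists_mem_orthogonal_inner_sub_eq_zero K x
  refine ⟨fun j => y j, fun j => Lp.memLp _, fun g hg => (hK y).1 hyK g hg, fun V hV hVg => ?_⟩
  set v : PiLp 2 fun _ : ι => Lp ℂ 2 μ := WithLp.toLp 2 fun j => (hV j).toLp _ with hv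
  have hvK : v ∈ K.orthogonal := by
    rw [hK]
    intro g hg j k
    have e : ∀ i l, ∫ z, v i z * g l z ∂μ = ∫ z, V i z * g l z ∂μ := fun i l => by
      refine integral_congr_ae ?_
      filter_upwards [(hV i).coeFn_toLp] with z hz
      rw [hv]
      simp only
      rw [hz]
    rw [e, e]
    exact hVg g hg j k
  have h0 := hy v hvK
  rw [inner_sub_left, sub_eq_zero] at h0
  have e1 : inner ℂ x v = ∑ j, ∫ z, V j z * conj (X j z) ∂μ := by
    rw [hx, hv, inner_toLp_pi]
    refine Finset.sum_congr rfl fun j _ => integral_congr_ae ?_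
    filter_upwards [(hV j).coeFn_toLp, (hX j).coeFn_toLp] with z h1 h2
    rw [h1, h2]
  have e2 : inner ℂ y v = ∑ j, ∫ z, V j z * conj (y j z) ∂μ := by
    rw [hv, show y = WithLp.toLp 2 (fun j => y j) from rfl, inner_toLp_pi]
    refine Finset.sum_congr rfl fun j _ => integral_congr_ae ?_
    filter_upwards [(hV j).coeFn_toLp] with z h1
    rw [h1]
  rw [← e1, ← e2, h0]

end Projection

section ClosedField

variable {n : ℕ} {Ω : Set (Fin n → ℂ)}

lemma continuous_mul_of_tsupport_subset {a g : (Fin n → ℂ) → ℂ} (hΩ : IsOpen Ω)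
    (ha : ContinuousOn a Ω) (hg : Continuous g) (hgΩ : tsupport g ⊆ Ω) :
    Continuous fun z => a z * g z :=
  (ha.mul hg.continuousOn).continuous_of_tsupport_subset hΩ
    ((tsupport_mul_subset_right (f := a) (g := g)).trans hgΩ)

lemma memLp_mul_of_tsupport_subset {a g : (Fin n → ℂ) → ℂ} (hΩ : IsOpen Ω)
    (ha : ContinuousOn a Ω) (hg : Continuous g) (hgc : HasCompactSupport g)
    (hgΩ : tsupport g ⊆ Ω) : MemLp (fun z => a z * g z) 2 volume :=
  (continuous_mul_of_tsupport_subset hΩ ha hg hgΩ).memLp_of_hasCompactSupport hgc.mul_left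

lemma setIntegral_eq_integral_of_tsupport_subset {f g : (Fin n → ℂ) → ℂ}
    (hg : tsupport g ⊆ Ω) (hfg : ∀ z, g z = 0 → f z = 0) : ∫ z in Ω, f z = ∫ z, f z :=
  setIntegral_eq_integral_of_forall_compl_eq_zero fun z hz =>
    hfg z (image_eq_zero_of_notMem_tsupport fun h => hz (hg h))

lemma continuousOn_ofReal_exp {t : (Fin n → ℂ) → ℝ} (ht : ContinuousOn t Ω) :
    ContinuousOn (fun z => (Real.exp (t z) : ℂ)) Ω :=
  Complex.continuous_ofReal.comp_continuousOn (Real.continuous_exp.comp_continuousOn ht)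

/-- The weighted gradient of a `C²` function is closed with respect to the weighted test fields. -/
lemma integral_weighted_wirt_symm {s : (Fin n → ℂ) → ℝ} {w θ : (Fin n → ℂ) → ℂ}
    (hw : ContDiff ℝ 2 w) (hθ : ContDiff ℝ ∞ θ) (hθc : HasCompactSupport θ)
    (hθΩ : tsupport θ ⊆ Ω) (j k : Fin n) :
    ∫ z in Ω, (Real.exp (-s z / 2) * wirt I w j z) * (Real.exp (s z / 2) * wirt I θ k z)
      = ∫ z in Ω, (Real.exp (-s z / 2) * wirt I w k z) * (Real.exp (s z / 2) * wirt I θ j z) := by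
  have hθ1 : ContDiff ℝ 1 θ := hθ.of_le (by exact_mod_cast le_top)
  have e : ∀ j k, ∫ z in Ω, (Real.exp (-s z / 2) * wirt I w j z)
      * (Real.exp (s z / 2) * wirt I θ k z) = - ∫ z, wirt I (wirt I w j) k z * θ z := by
    intro j k
    rw [← integral_mul_wirt (contDiff_wirt hw (by norm_num)) hθ1 hθc,
      setIntegral_eq_integral_of_tsupport_subset (g := wirt I θ k)
        (tsupport_wirt_subset.trans hθΩ) (fun z hz => by simp [hz])]
    refine integral_congr_ae (.of_forall fun z => ?_)
    have h1 : (Real.exp (-s z / 2) : ℂ) * Real.exp (s z / 2) = 1 := by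
      rw [← Complex.ofReal_mul, ← Real.exp_add]
      simp [neg_div]
    linear_combination (wirt I w j z * wirt I θ k z) * h1
  rw [e, e]
  simp only [wirt_comm hw (j := k) (k := j)]

/-- Decomposition of a weighted compactly supported field: its closed part `Y`. -/
lemma exists_closed_field (hΩ : IsOpen Ω) {s : (Fin n → ℂ) → ℝ} (hs : ContinuousOn s Ω)
    {Φ : Fin n → (Fin n → ℂ) → ℂ} (hΦ : ∀ j, ContDiff ℝ ∞ (Φ j))
    (hΦc : ∀ j, HasCompactSupport (Φ j)) (hΦΩ : ∀ j, tsupport (Φ j) ⊆ Ω) :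
    ∃ Y : Fin n → (Fin n → ℂ) → ℂ, (∀ j, MemLp (Y j) 2 volume) ∧
      (∀ j k, ∀ θ : (Fin n → ℂ) → ℂ, ContDiff ℝ ∞ θ → HasCompactSupport θ → tsupport θ ⊆ Ω →
        ∫ z, Y j z * (Real.exp (s z / 2) * wirt I θ k z)
          = ∫ z, Y k z * (Real.exp (s z / 2) * wirt I θ j z)) ∧
      (∀ u : (Fin n → ℂ) → ℂ, ContDiff ℝ 2 u → HasCompactSupport u → tsupport u ⊆ Ω →
        ∑ j, ∫ z, Y j z * (Real.exp (-s z / 2) * wirt (-I) u j z)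
          = - ∫ z, conj (∑ j, wirt I (Φ j) j z) * u z) ∧
      ∀ V : Fin n → (Fin n → ℂ) → ℂ, (∀ j, MemLp (V j) 2 (volume.restrict Ω)) →
        (∀ j k, ∀ θ : (Fin n → ℂ) → ℂ, ContDiff ℝ ∞ θ → HasCompactSupport θ → tsupport θ ⊆ Ω →
          ∫ z in Ω, V j z * (Real.exp (s z / 2) * wirt I θ k z)
            = ∫ z in Ω, V k z * (Real.exp (s z / 2) * wirt I θ j z)) →
        ∑ j, ∫ z in Ω, V j z * conj (Y j z)
          = ∑ j, ∫ z in Ω, V j z * (Real.exp (s z / 2) * Φ j z) := by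
  have hsp : ContinuousOn (fun z => (Real.exp (s z / 2) : ℂ)) Ω :=
    continuousOn_ofReal_exp (hs.div_const 2)
  have hsm : ContinuousOn (fun z => (Real.exp (-s z / 2) : ℂ)) Ω :=
    continuousOn_ofReal_exp (hs.neg.div_const 2)
  let 𝒢 : Set (Fin n → (Fin n → ℂ) → ℂ) := {g | ∃ θ : (Fin n → ℂ) → ℂ, ContDiff ℝ ∞ θ ∧
    HasCompactSupport θ ∧ tsupport θ ⊆ Ω ∧ g = fun k z => Real.exp (s z / 2) * wirt I θ k z}
  have h𝒢 : ∀ g ∈ 𝒢, ∀ j, MemLp (g j) 2 (volume.restrict Ω) := by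
    rintro g ⟨θ, hθ, hθc, hθΩ, rfl⟩ j
    exact (memLp_mul_of_tsupport_subset hΩ hsp
      (continuous_wirt (hθ.of_le (by exact_mod_cast le_top))) (hasCompactSupport_wirt hθc)
      (tsupport_wirt_subset.trans hθΩ)).restrict Ω
  have hX : ∀ j, MemLp (fun z => (Real.exp (s z / 2) : ℂ) * conj (Φ j z)) 2
      (volume.restrict Ω) := by
    intro j
    have hsupp : tsupport (fun z => conj (Φ j z)) ⊆ tsupport (Φ j) :=
      closure_mono fun z hz h => hz (by simp only [h, map_zero])
    exact (memLp_mul_of_tsupport_subset hΩ hsp (continuous_conj.comp (hΦ j).continuous)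
      ((hΦc j).mono' ((subset_tsupport _).trans hsupp)) (hsupp.trans (hΦΩ j))).restrict Ω
  obtain ⟨Y, hY, hcl, hV⟩ := exists_closed_projection 𝒢 h𝒢 hX
  have key : ∀ V : Fin n → (Fin n → ℂ) → ℂ, (∀ j, MemLp (V j) 2 (volume.restrict Ω)) →
        (∀ j k, ∀ θ : (Fin n → ℂ) → ℂ, ContDiff ℝ ∞ θ → HasCompactSupport θ → tsupport θ ⊆ Ω →
          ∫ z in Ω, V j z * (Real.exp (s z / 2) * wirt I θ k z)
            = ∫ z in Ω, V k z * (Real.exp (s z / 2) * wirt I θ j z)) →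
        ∑ j, ∫ z in Ω, V j z * conj (Y j z)
          = ∑ j, ∫ z in Ω, V j z * (Real.exp (s z / 2) * Φ j z) := by
    intro V hVm hVs
    rw [hV V hVm]
    · simp only [map_mul, Complex.conj_ofReal, Complex.conj_conj]
    · rintro g ⟨θ, hθ, hθc, hθΩ, rfl⟩ j k
      exact hVs j k θ hθ hθc hθΩ
  have hind : ∀ j (f : (Fin n → ℂ) → ℂ), ∫ z, Ω.indicator (Y j) z * f z
      = ∫ z in Ω, Y j z * f z := by
    intro j f
    rw [← integral_indicator hΩ.measurableSet]
    refine integral_congr_ae (.of_forall fun z => ?_)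
    by_cases hz : z ∈ Ω <;> simp [hz]
  refine ⟨fun j => Ω.indicator (Y j), fun j =>
    (memLp_indicator_iff_restrict hΩ.measurableSet).2 (hY j), ?_, ?_, ?_⟩
  · intro j k θ hθ hθc hθΩ
    rw [hind, hind]
    exact hcl _ ⟨θ, hθ, hθc, hθΩ, rfl⟩ j k
  · intro u hu huc huΩ
    have hu' : ContDiff ℝ 2 (fun z => conj (u z)) := Complex.conjCLE.contDiff.comp hu
    have hw : ∀ j z, wirt I (fun z => conj (u z)) j z = conj (wirt (-I) u j z) := fun j z => by
      rw [wirt_conj, Complex.conj_I]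
    have h1 := key (fun j z => Real.exp (-s z / 2) * wirt I (fun z => conj (u z)) j z) ?_ ?_
    · have h2 : ∀ j, ∫ z, Ω.indicator (Y j) z * (Real.exp (-s z / 2) * wirt (-I) u j z)
          = conj (∫ z in Ω, (Real.exp (-s z / 2) * wirt I (fun z => conj (u z)) j z)
            * conj (Y j z)) := by
        intro j
        rw [hind, ← integral_conj]
        refine integral_congr_ae (.of_forall fun z => ?_)
        simp only [hw, map_mul, Complex.conj_ofReal, Complex.conj_conj]
        ring
      rw [Finset.sum_congr rfl fun j _ => h2 j, ← map_sum, h1, map_sum]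
      have h3 : ∀ j, ∫ z in Ω, (Real.exp (-s z / 2) * wirt I (fun z => conj (u z)) j z)
          * (Real.exp (s z / 2) * Φ j z) = - ∫ z, wirt I (Φ j) j z * conj (u z) := by
        intro j
        have h4 := integral_mul_wirt (c := I) (j := j) (hu'.of_le (by norm_num))
          ((hΦ j).of_le (by exact_mod_cast le_top)) (hΦc j)
        rw [setIntegral_eq_integral_of_tsupport_subset (hΦΩ j) fun z hz => by simp [hz]]
        have h5 : ∫ z, wirt I (Φ j) j z * conj (u z)
            = ∫ z, conj (u z) * wirt I (Φ j) j z := by simp only [mul_comm]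
        rw [h5, h4, neg_neg]
        refine integral_congr_ae (.of_forall fun z => ?_)
        have h1 : (Real.exp (-s z / 2) : ℂ) * Real.exp (s z / 2) = 1 := by
          rw [← Complex.ofReal_mul, ← Real.exp_add]
          simp [neg_div]
        linear_combination (wirt I (fun z => conj (u z)) j z * Φ j z) * h1
      rw [Finset.sum_congr rfl fun j _ => by rw [h3 j, map_neg, ← integral_conj],
        Finset.sum_neg_distrib, ← integral_finsetSum]
      · congr 1
        refine integral_congr_ae (.of_forall fun z => ?_)
        simp only [map_mul, Complex.conj_conj, map_sum, Finset.sum_mul]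
      · intro j _
        have c1 : Continuous fun z => conj (wirt I (Φ j) j z * conj (u z)) :=
          continuous_conj.comp ((continuous_wirt ((hΦ j).of_le (by exact_mod_cast le_top))).mul
            (continuous_conj.comp hu.continuous))
        refine c1.integrable_of_hasCompactSupport (huc.mono' fun z hz => subset_tsupport _ ?_)
        intro h
        exact hz (by simp [h])
    · intro j
      refine (memLp_mul_of_tsupport_subset hΩ hsm (continuous_wirt (hu'.of_le (by norm_num)))
        (hasCompactSupport_wirt ?_) (tsupport_wirt_subset.trans (subset_trans ?_ huΩ))).restrict Ω
      · exact huc.mono' fun z hz => subset_tsupport _ fun h => hz (by simp [h])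
      · exact closure_mono fun z hz h => hz (by simp only [h, map_zero])
    · intro j k θ hθ hθc hθΩ
      exact integral_weighted_wirt_symm hu' hθ hθc hθΩ j k
  · intro V hVm hVs
    rw [← key V hVm hVs]
    refine Finset.sum_congr rfl fun j _ => setIntegral_congr_fun hΩ.measurableSet fun z hz => ?_
    simp only [indicator_of_mem hz]

end ClosedField

section DualEstimate

variable {n : ℕ} {Ω : Set (Fin n → ℂ)}

lemma norm_toLp_eq_sqrt {X : Type*} [MeasurableSpace X] {μ : Measure X} {g : X → ℂ}
    (hg : MemLp g 2 μ) : ‖hg.toLp g‖ = Real.sqrt (∫ z, Complex.normSq (g z) ∂μ) := by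
  rw [@norm_eq_sqrt_re_inner ℂ, L2.inner_def]
  congr 1
  have h : ∫ z, inner ℂ (hg.toLp g z) (hg.toLp g z) ∂μ
      = ∫ z, (Complex.normSq (g z) : ℂ) ∂μ := by
    refine integral_congr_ae ?_
    filter_upwards [hg.coeFn_toLp] with z hz
    rw [RCLike.inner_apply, hz, Complex.mul_conj]
  rw [h, integral_complex_ofReal]
  exact Complex.ofReal_re _

lemma norm_integral_mul_conj_le {X : Type*} [MeasurableSpace X] {μ : Measure X} (f : Lp ℂ 2 μ)
    {g : X → ℂ} (hg : MemLp g 2 μ) :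
    ‖∫ z, f z * conj (g z) ∂μ‖ ≤ ‖f‖ * Real.sqrt (∫ z, Complex.normSq (g z) ∂μ) := by
  have h1 : inner ℂ (hg.toLp g) f = ∫ z, f z * conj (g z) ∂μ := by
    rw [L2.inner_def]
    refine integral_congr_ae ?_
    filter_upwards [hg.coeFn_toLp] with z hz
    rw [RCLike.inner_apply, hz]
  rw [← h1, ← norm_toLp_eq_sqrt hg, mul_comm]
  exact norm_inner_le_norm _ _

/-- Cauchy–Schwarz for the pairing of a `∂̄`-closed form with a test field. -/
lemma norm_sq_sum_setIntegral_le (hΩ : IsOpen Ω) {s : (Fin n → ℂ) → ℝ} (hs : ContinuousOn s Ω)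
    {m : ℝ} (hm : ∀ z ∈ Ω, m ≤ s z) {Φ Y : Fin n → (Fin n → ℂ) → ℂ}
    (hY : ∀ j, MemLp (Y j) 2 volume)
    (hV : ∀ V : Fin n → (Fin n → ℂ) → ℂ, (∀ j, MemLp (V j) 2 (volume.restrict Ω)) →
        (∀ j k, ∀ θ : (Fin n → ℂ) → ℂ, ContDiff ℝ ∞ θ → HasCompactSupport θ → tsupport θ ⊆ Ω →
          ∫ z in Ω, V j z * (Real.exp (s z / 2) * wirt I θ k z)
            = ∫ z in Ω, V k z * (Real.exp (s z / 2) * wirt I θ j z)) →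
        ∑ j, ∫ z in Ω, V j z * conj (Y j z)
          = ∑ j, ∫ z in Ω, V j z * (Real.exp (s z / 2) * Φ j z))
    (α : Fin n → Lp ℂ 2 ((volume : Measure (Fin n → ℂ)).restrict Ω))
    (hα : DbarClosed n Ω (fun j => ⇑(α j))) :
    ‖∑ j, ∫ z in Ω, α j z * Φ j z‖ ^ 2
      ≤ (∑ j, ‖α j‖ ^ 2) * ∫ z in Ω, Real.exp (-s z) * enormSq n fun j => Y j z := by
  have hb : ContinuousOn (fun z => (Real.exp (-s z / 2) : ℂ)) Ω :=
    continuousOn_ofReal_exp (hs.neg.div_const 2)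
  have hbm : AEStronglyMeasurable (fun z => (Real.exp (-s z / 2) : ℂ)) (volume.restrict Ω) :=
    hb.aestronglyMeasurable hΩ.measurableSet
  have hbb : ∀ᵐ z ∂volume.restrict Ω, ‖(Real.exp (-s z / 2) : ℂ)‖ ≤ Real.exp (-m / 2) := by
    filter_upwards [ae_restrict_mem hΩ.measurableSet] with z hz
    rw [Complex.norm_real, Real.norm_eq_abs, abs_of_pos (Real.exp_pos _)]
    exact Real.exp_le_exp.2 (by linarith [hm z hz])
  have hmul : ∀ f : (Fin n → ℂ) → ℂ, MemLp f 2 (volume.restrict Ω) →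
      MemLp (fun z => (Real.exp (-s z / 2) : ℂ) * f z) 2 (volume.restrict Ω) := by
    intro f hf
    refine hf.of_le_mul (c := Real.exp (-m / 2)) (hbm.mul hf.1) ?_
    filter_upwards [hbb] with z hz
    rw [norm_mul]
    exact mul_le_mul_of_nonneg_right hz (norm_nonneg _)
  have hinv : ∀ z, (Real.exp (-s z / 2) : ℂ) * Real.exp (s z / 2) = 1 := fun z => by
    rw [← Complex.ofReal_mul, ← Real.exp_add]
    simp [neg_div]
  have hbY : ∀ j, MemLp (fun z => (Real.exp (-s z / 2) : ℂ) * Y j z) 2 (volume.restrict Ω) :=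
    fun j => hmul _ ((hY j).restrict Ω)
  have h1 := hV (fun j z => Real.exp (-s z / 2) * α j z) (fun j => hmul _ (Lp.memLp _)) ?_
  · have h2 : ∑ j, ∫ z in Ω, α j z * Φ j z
        = ∑ j, ∫ z in Ω, α j z * conj ((Real.exp (-s z / 2) : ℂ) * Y j z) := by
      rw [show ∑ j, ∫ z in Ω, α j z * Φ j z = ∑ j, ∫ z in Ω, (Real.exp (-s z / 2) * α j z)
          * (Real.exp (s z / 2) * Φ j z) from Finset.sum_congr rfl fun j _ => by
            refine integral_congr_ae (.of_forall fun z => ?_)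
            linear_combination (-(α j z * Φ j z)) * hinv z, ← h1]
      refine Finset.sum_congr rfl fun j _ => integral_congr_ae (.of_forall fun z => ?_)
      simp only [map_mul, Complex.conj_ofReal]
      ring
    have h3 : ‖∑ j, ∫ z in Ω, α j z * Φ j z‖ ≤ ∑ j, ‖α j‖ *
        Real.sqrt (∫ z in Ω, Complex.normSq ((Real.exp (-s z / 2) : ℂ) * Y j z)) := by
      rw [h2]
      exact (norm_sum_le _ _).trans
        (Finset.sum_le_sum fun j _ => norm_integral_mul_conj_le (α j) (hbY j))
    refine (pow_le_pow_left₀ (norm_nonneg _) h3 2).trans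
      ((Finset.sum_mul_sq_le_sq_mul_sq _ _ _).trans_eq ?_)
    congr 1
    have hfi : ∀ j, Integrable (fun z => Complex.normSq ((Real.exp (-s z / 2) : ℂ) * Y j z))
        (volume.restrict Ω) := fun j => by
      simpa only [Complex.normSq_eq_norm_sq] using (hbY j).integrable_norm_pow (by norm_num)
    rw [Finset.sum_congr rfl fun j _ => Real.sq_sqrt
      (integral_nonneg fun z => Complex.normSq_nonneg _),
      ← integral_finsetSum _ fun j _ => hfi j]
    refine integral_congr_ae (.of_forall fun z => ?_)
    simp only [enormSq, Finset.mul_sum, map_mul, Complex.normSq_ofReal, ← Real.exp_add]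
    ring_nf
  · intro j k θ hθ hθc hθΩ
    have e : ∀ j k, ∫ z in Ω, (Real.exp (-s z / 2) * α j z) * (Real.exp (s z / 2) * wirt I θ k z)
        = ∫ z in Ω, α j z * dbarCoord n θ k z := fun j k => by
      refine integral_congr_ae (.of_forall fun z => ?_)
      simp only [dbarCoord_eq_wirt]
      linear_combination (α j z * wirt I θ k z) * hinv z
    rw [e, e]
    exact hα j k θ ⟨hθ, hθc, hθΩ⟩

/-- The dual a priori estimate, with the loss `exp (ε η)` coming from the auxiliary weight. -/
lemma norm_sq_sum_setIntegral_le_of_weights {φ lam τ ψ η : (Fin n → ℂ) → ℝ}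
    {χ : ℕ → (Fin n → ℂ) → ℝ} {c B Λ ε : ℝ} (hΩ : IsOpen Ω)
    (hlam : ContDiffOn ℝ 2 lam Ω) (hτ : ContDiffOn ℝ 2 τ Ω) (hη : ContDiffOn ℝ ∞ η Ω)
    (hψ : ContDiffOn ℝ ∞ ψ Ω) (hφ : φ = fun z => lam z + ε * η z)
    (hη0 : ∀ z ∈ Ω, 0 ≤ η z) (hψ0 : ∀ z ∈ Ω, 0 ≤ ψ z) (hε : 0 < ε) (hc : 0 < c)
    (hτp : ∀ z ∈ Ω, 0 < τ z) (hτΛ : ∀ z ∈ Ω, τ z ≤ Λ) (hlamΛ : ∀ z ∈ Ω, -Λ ≤ lam z)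
    (hχ : ∀ ν, ContDiff ℝ ∞ (χ ν)) (hχc : ∀ ν, HasCompactSupport (χ ν))
    (hχΩ : ∀ ν, tsupport (χ ν) ⊆ Ω) (hχ01 : ∀ ν z, χ ν z ∈ Icc (0 : ℝ) 1)
    (hχK : ∀ K ⊆ Ω, IsCompact K → ∀ᶠ ν in Filter.atTop, ∀ z ∈ K,
      χ ν z = 1 ∧ ∀ j, wirt (-I) (cplx (χ ν)) j z = 0)
    (hB : ∀ ν, ∀ z ∈ Ω,
      enormSq n (fun j => wirt (-I) (cplx (χ ν)) j z) * Real.exp (-ψ z) ≤ B)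
    (hψη : ∀ z ∈ Ω, ∀ ξ, 2 * enormSq n (fun j => wirt (-I) (cplx ψ) j z) * enormSq n ξ
      ≤ ε * hessC n η z ξ)
    (hΘ : ∀ z ∈ Ω, ∀ ξ, c * enormSq n ξ * Real.exp (-lam z) ≤ Theta n lam τ z ξ)
    {Φ : Fin n → (Fin n → ℂ) → ℂ} (hΦ : ∀ j, ContDiff ℝ ∞ (Φ j))
    (hΦc : ∀ j, HasCompactSupport (Φ j)) (hΦΩ : ∀ j, tsupport (Φ j) ⊆ Ω)
    (α : Fin n → Lp ℂ 2 ((volume : Measure (Fin n → ℂ)).restrict Ω))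
    (hα : DbarClosed n Ω (fun j => ⇑(α j))) :
    c * ‖∑ j, ∫ z in Ω, α j z * Φ j z‖ ^ 2 ≤ (∑ j, ‖α j‖ ^ 2) *
      ∫ z in Ω, 2 * τ z * Real.exp (φ z) * Complex.normSq (∑ j, dbarCoord n (Φ j) j z) := by
  have hφc : ContDiffOn ℝ 2 φ Ω := by
    rw [hφ]
    exact hlam.add (contDiffOn_const.mul (hη.of_le (WithTop.coe_le_coe.2 le_top)))
  have hsc : ContinuousOn (fun z => φ z + ψ z) Ω := hφc.continuousOn.add hψ.continuousOn
  obtain ⟨Y, hY, hcl, hdiv, hV⟩ := exists_closed_field hΩ hsc hΦ hΦc hΦΩ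
  have hφ0 : ∀ z ∈ Ω, lam z ≤ φ z := fun z hz => by
    rw [hφ]
    exact le_add_of_nonneg_right (mul_nonneg hε.le (hη0 z hz))
  have h1 := norm_sq_sum_setIntegral_le hΩ hsc (m := -Λ)
    (fun z hz => by linarith [hφ0 z hz, hψ0 z hz, hlamΛ z hz]) hY hV α hα
  have hdbar : ∀ j, Continuous (wirt I (Φ j) j) := fun j =>
    continuous_wirt ((hΦ j).of_le (by exact_mod_cast le_top))
  set h : (Fin n → ℂ) → ℂ := fun z => conj (∑ j, wirt I (Φ j) j z) with hh
  have hhK : ∀ z, h z ≠ 0 → z ∈ ⋃ j, tsupport (Φ j) := by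
    intro z hz
    by_contra hn
    rw [mem_iUnion, not_exists] at hn
    exact hz (by simp [hh, fun j => wirt_eq_zero_of_notMem_tsupport (c := I) (j := j) (hn j)])
  have hKc : IsCompact (⋃ j, tsupport (Φ j)) := isCompact_iUnion fun j => hΦc j
  have hhs : tsupport h ⊆ ⋃ j, tsupport (Φ j) := closure_minimal hhK hKc.isClosed
  have hBχ : ∀ ν, ∀ z ∈ Ω, 4 * τ z * enormSq n (fun j => wirt (-I) (cplx (χ ν)) j z)
      * Real.exp (-ψ z) ≤ max (4 * Λ * B) (c * Real.exp Λ) := by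
    intro ν z hz
    refine le_trans ?_ (le_max_left _ _)
    have hX : 0 ≤ enormSq n (fun j => wirt (-I) (cplx (χ ν)) j z) * Real.exp (-ψ z) :=
      mul_nonneg (enormSq_nonneg _) (Real.exp_pos _).le
    have hp := hτp z hz
    have hq := hτΛ z hz
    nlinarith [mul_le_mul hq (hB ν z hz) hX (hp.le.trans hq)]
  have hWB : ∀ z ∈ Ω, c * Real.exp (-lam z) * Real.exp (-ψ z)
      ≤ max (4 * Λ * B) (c * Real.exp Λ) := by
    intro z hz
    refine le_trans ?_ (le_max_right _ _)
    rw [mul_assoc, ← Real.exp_add]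
    exact mul_le_mul_of_nonneg_left
      (Real.exp_le_exp.2 (by linarith [hψ0 z hz, hlamΛ z hz])) hc.le
  have hΘφ : ∀ z ∈ Ω, ∀ ξ, (c * Real.exp (-lam z)
      + 2 * τ z * enormSq n (fun j => wirt (-I) (cplx ψ) j z)) * enormSq n ξ
        ≤ Theta n φ τ z ξ := by
    intro z hz ξ
    have hηz : ContDiffAt ℝ 2 η z :=
      (hη.of_le (WithTop.coe_le_coe.2 le_top)).contDiffAt (hΩ.mem_nhds hz)
    rw [hφ, Theta_add (hlam.contDiffAt (hΩ.mem_nhds hz)) (contDiffAt_const.mul hηz),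
      hessC_const_mul hηz]
    have e1 := hΘ z hz ξ
    have e2 := mul_le_mul_of_nonneg_left (hψη z hz ξ) (hτp z hz).le
    linarith
  obtain ⟨hi, h2⟩ := setIntegral_enormSq_le (W := fun z => c * Real.exp (-lam z))
    (B := max (4 * Λ * B) (c * Real.exp Λ)) (h := h) hΩ hφc hτ hψ
    (continuousOn_const.mul (Real.continuous_exp.comp_continuousOn hlam.continuousOn.neg))
    (fun z _ => by positivity) hχ hχc hχΩ hχ01 hχK hBχ hWB hτp hY
    (continuous_conj.comp (continuous_finsetSum _ fun j _ => hdbar j))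
    (hKc.of_isClosed_subset (isClosed_tsupport h) hhs) (hhs.trans (iUnion_subset hΦΩ))
    hcl hdiv hΘφ
  have h3 : c * ∫ z in Ω, Real.exp (-(φ z + ψ z)) * enormSq n (fun j => Y j z)
      ≤ ∫ z in Ω, c * Real.exp (-lam z) * Real.exp (-ψ z) * enormSq n (fun j => Y j z) := by
    rw [← integral_const_mul]
    refine integral_mono_of_nonneg (.of_forall fun z => ?_) hi ?_
    · exact mul_nonneg hc.le (mul_nonneg (Real.exp_pos _).le (enormSq_nonneg _))
    · filter_upwards [ae_restrict_mem hΩ.measurableSet] with z hz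
      rw [mul_assoc c, ← Real.exp_add, mul_assoc c]
      refine mul_le_mul_of_nonneg_left (mul_le_mul_of_nonneg_right
        (Real.exp_le_exp.2 ?_) (enormSq_nonneg _)) hc.le
      linarith [hφ0 z hz]
  have h4 : ∀ z, Complex.normSq (h z) = Complex.normSq (∑ j, dbarCoord n (Φ j) j z) := fun z =>
    Complex.normSq_conj _
  simp only [h4] at h2
  calc c * ‖∑ j, ∫ z in Ω, α j z * Φ j z‖ ^ 2
      ≤ c * ((∑ j, ‖α j‖ ^ 2)
        * ∫ z in Ω, Real.exp (-(φ z + ψ z)) * enormSq n fun j => Y j z) :=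
        mul_le_mul_of_nonneg_left h1 hc.le
    _ = (∑ j, ‖α j‖ ^ 2)
        * (c * ∫ z in Ω, Real.exp (-(φ z + ψ z)) * enormSq n fun j => Y j z) := by ring
    _ ≤ _ := mul_le_mul_of_nonneg_left (h3.trans h2)
        (Finset.sum_nonneg fun j _ => sq_nonneg _)

/-- The dual a priori estimate on a smoothly bounded Levi pseudoconvex domain. -/
lemma norm_sum_setIntegral_le (hbd : Bornology.IsBounded Ω) {r : (Fin n → ℂ) → ℝ}
    (hr : IsLeviDefiningFn n Ω r) {lam τ : (Fin n → ℂ) → ℝ} {U : Set (Fin n → ℂ)}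
    (hclU : closure Ω ⊆ U) (hlam : ContDiffOn ℝ 2 lam U) (hτ : ContDiffOn ℝ 2 τ U)
    (hτp : ∀ z ∈ closure Ω, 0 < τ z) {c₁ c₂ : ℝ} (hc₁ : 0 < c₁) (hc₂ : 0 < c₂)
    (hΘ : ∀ z ∈ Ω, ∀ ξ, c₁ * enormSq n ξ * Real.exp (-lam z) ≤ Theta n lam τ z ξ)
    (hratio : ∀ z ∈ closure Ω, c₂ ≤ Real.exp (-lam z) / τ z)
    {Φ : Fin n → (Fin n → ℂ) → ℂ} (hΦ : ∀ j, IsTest n Ω (Φ j))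
    (α : Fin n → Lp ℂ 2 ((volume : Measure (Fin n → ℂ)).restrict Ω))
    (hα : DbarClosed n Ω (fun j => ⇑(α j))) :
    ‖∑ j, ∫ z in Ω, α j z * Φ j z‖ ≤ Real.sqrt (2 / (c₁ * c₂)) * Real.sqrt (∑ j, ‖α j‖ ^ 2) *
      Real.sqrt (∫ z in Ω, Complex.normSq (∑ j, dbarCoord n (Φ j) j z)) := by
  have hΩ : IsOpen Ω := by
    rw [hr.2.1]
    exact isOpen_lt hr.1.continuous continuous_const
  have hsub : Ω ⊆ U := subset_closure.trans hclU
  have hK : IsCompact (closure Ω) := hbd.isCompact_closure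
  obtain ⟨Λ₁, hΛ₁⟩ := hK.exists_bound_of_continuousOn (hlam.continuousOn.mono hclU)
  obtain ⟨Λ₂, hΛ₂⟩ := hK.exists_bound_of_continuousOn (hτ.continuousOn.mono hclU)
  obtain ⟨η, χ, hη, hη0, hχ, hχc, hχΩ, hχ01, hχK, hweights⟩ := hr.exists_weights hbd
  have hKc : IsCompact (⋃ j, tsupport (Φ j)) := isCompact_iUnion fun j => (hΦ j).2.1
  obtain ⟨m, hm⟩ := hKc.exists_bound_of_continuousOn
    (hη.continuousOn.mono (iUnion_subset fun j => (hΦ j).2.2))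
  set H := ∫ z in Ω, Complex.normSq (∑ j, dbarCoord n (Φ j) j z) with hH
  have hH0 : 0 ≤ H := integral_nonneg fun z => Complex.normSq_nonneg _
  have hzero : ∀ z, z ∉ ⋃ j, tsupport (Φ j) → ∑ j, dbarCoord n (Φ j) j z = 0 := by
    intro z hn
    rw [mem_iUnion, not_exists] at hn
    exact Finset.sum_eq_zero fun j _ => wirt_eq_zero_of_notMem_tsupport (hn j)
  have hHi : Integrable (fun z => Complex.normSq (∑ j, dbarCoord n (Φ j) j z))
      (volume.restrict Ω) := by
    have hcont : Continuous fun z => Complex.normSq (∑ j, dbarCoord n (Φ j) j z) :=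
      Complex.continuous_normSq.comp (continuous_finsetSum _ fun j _ =>
        continuous_wirt ((hΦ j).1.of_le (by exact_mod_cast le_top)))
    refine (hcont.integrable_of_hasCompactSupport (HasCompactSupport.intro hKc fun z hz => ?_)
      ).integrableOn
    rw [hzero z hz, map_zero]
  have main : ∀ ε > 0, ‖∑ j, ∫ z in Ω, α j z * Φ j z‖ ^ 2
      ≤ 2 / (c₁ * c₂) * Real.exp (ε * m) * ((∑ j, ‖α j‖ ^ 2) * H) := by
    intro ε hε
    obtain ⟨ψ, B, hψ, hψ0, hψη, hB⟩ := hweights ε hε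
    have h1 := norm_sq_sum_setIntegral_le_of_weights (Λ := max Λ₁ Λ₂) hΩ (hlam.mono hsub)
      (hτ.mono hsub) hη hψ rfl hη0 hψ0 hε hc₁ (fun z hz => hτp z (subset_closure hz))
      (fun z hz => (le_abs_self _).trans ((hΛ₂ z (subset_closure hz)).trans (le_max_right _ _)))
      (fun z hz => (neg_le_neg (le_max_left _ _)).trans
        (abs_le.1 (hΛ₁ z (subset_closure hz))).1) hχ hχc hχΩ hχ01 hχK hB hψη hΘ
      (fun j => (hΦ j).1) (fun j => (hΦ j).2.1) (fun j => (hΦ j).2.2) α hα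
    have h2 : ∫ z in Ω, 2 * τ z * Real.exp (lam z + ε * η z)
          * Complex.normSq (∑ j, dbarCoord n (Φ j) j z)
        ≤ 2 / c₂ * Real.exp (ε * m) * H := by
      rw [hH, ← integral_const_mul]
      refine integral_mono_of_nonneg ?_ (hHi.const_mul _) ?_
      · filter_upwards [ae_restrict_mem hΩ.measurableSet] with z hz
        have := hτp z (subset_closure hz)
        exact mul_nonneg (by positivity) (Complex.normSq_nonneg _)
      · filter_upwards [ae_restrict_mem hΩ.measurableSet] with z hz
        have hp := hτp z (subset_closure hz)
        by_cases hzK : z ∈ ⋃ j, tsupport (Φ j)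
        · refine mul_le_mul_of_nonneg_right ?_ (Complex.normSq_nonneg _)
          have e1 : τ z * Real.exp (lam z) ≤ 1 / c₂ := by
            rw [le_div_iff₀ hc₂]
            have := (le_div_iff₀ hp).1 (hratio z (subset_closure hz))
            calc τ z * Real.exp (lam z) * c₂ = Real.exp (lam z) * (c₂ * τ z) := by ring
              _ ≤ Real.exp (lam z) * Real.exp (-lam z) :=
                mul_le_mul_of_nonneg_left this (Real.exp_pos _).le
              _ = 1 := by rw [← Real.exp_add]; simp
          have e2 : Real.exp (ε * η z) ≤ Real.exp (ε * m) :=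
            Real.exp_le_exp.2 (mul_le_mul_of_nonneg_left
              ((le_abs_self _).trans (hm z hzK)) hε.le)
          have e3 := mul_le_mul e1 e2 (Real.exp_pos _).le (by positivity)
          rw [Real.exp_add]
          calc 2 * τ z * (Real.exp (lam z) * Real.exp (ε * η z))
              = 2 * (τ z * Real.exp (lam z) * Real.exp (ε * η z)) := by ring
            _ ≤ 2 * (1 / c₂ * Real.exp (ε * m)) := by linarith
            _ = _ := by ring
        · simp only [hzero z hzK, map_zero, mul_zero, le_refl]
    have h3 := h1.trans (mul_le_mul_of_nonneg_left h2 (Finset.sum_nonneg fun j _ => sq_nonneg _))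
    rw [mul_comm, ← le_div_iff₀ hc₁] at h3
    refine h3.trans_eq ?_
    field_simp
  have hlim : ‖∑ j, ∫ z in Ω, α j z * Φ j z‖ ^ 2
      ≤ 2 / (c₁ * c₂) * ((∑ j, ‖α j‖ ^ 2) * H) := by
    have ht : Filter.Tendsto
        (fun ε : ℝ => 2 / (c₁ * c₂) * Real.exp (ε * m) * ((∑ j, ‖α j‖ ^ 2) * H)) (𝓝[>] 0)
        (𝓝 (2 / (c₁ * c₂) * Real.exp (0 * m) * ((∑ j, ‖α j‖ ^ 2) * H))) :=
      (Continuous.tendsto (by fun_prop) 0).mono_left nhdsWithin_le_nhds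
    rw [zero_mul, Real.exp_zero, mul_one] at ht
    exact ge_of_tendsto ht (by filter_upwards [self_mem_nhdsWithin] with ε hε using main ε hε)
  rw [← Real.sqrt_mul (by positivity), ← Real.sqrt_mul (by positivity), mul_assoc]
  exact Real.le_sqrt_of_sq_le hlim

end DualEstimate

section Duality

/-- A functional dominated by `‖A ·‖` is represented by a vector tested against `A ·`. -/
lemma exists_inner_eq_of_norm_le {M H : Type*} [AddCommGroup M] [Module ℂ M]
    [NormedAddCommGroup H] [InnerProductSpace ℂ H] [CompleteSpace H] (A : M →ₗ[ℂ] H)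
    (ℓ : M →ₗ[ℂ] ℂ) {C : ℝ} (hC : 0 ≤ C) (h : ∀ m, ‖ℓ m‖ ≤ C * ‖A m‖) :
    ∃ v : H, ‖v‖ ≤ C ∧ ∀ m, ℓ m = inner ℂ v (A m) := by
  obtain ⟨s, hs⟩ := A.rangeRestrict.exists_rightInverse_of_surjective A.range_rangeRestrict
  have hs' : ∀ y, A (s y) = y := fun y => congrArg Subtype.val (LinearMap.congr_fun hs y)
  have hg : ∀ y, ‖(ℓ ∘ₗ s) y‖ ≤ C * ‖y‖ := fun y => by
    have := h (s y)
    rwa [hs' y] at this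
  obtain ⟨F, hF, hFn⟩ := exists_extension_norm_eq A.range ((ℓ ∘ₗ s).mkContinuous C hg)
  refine ⟨(InnerProductSpace.toDual ℂ H).symm F, ?_, fun m => ?_⟩
  · rw [LinearIsometryEquiv.norm_map, hFn]
    exact LinearMap.mkContinuous_norm_le _ hC _
  · rw [InnerProductSpace.toDual_symm_apply]
    have h1 := hF (A.rangeRestrict m)
    change F (A m) = ℓ (s (A.rangeRestrict m)) at h1
    rw [h1]
    have h2 := h (m - s (A.rangeRestrict m))
    have h3 : A (s (A.rangeRestrict m)) = A m := hs' _
    rw [map_sub A, h3, sub_self, norm_zero, mul_zero, map_sub] at h2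
    exact sub_eq_zero.1 (norm_le_zero_iff.1 h2)

variable {n : ℕ} {Ω : Set (Fin n → ℂ)}

lemma IsTest.add {φ ψ : (Fin n → ℂ) → ℂ} (hφ : IsTest n Ω φ) (hψ : IsTest n Ω ψ) :
    IsTest n Ω (φ + ψ) :=
  ⟨hφ.1.add hψ.1, hφ.2.1.add hψ.2.1,
    (tsupport_add φ ψ).trans (union_subset hφ.2.2 hψ.2.2)⟩

lemma IsTest.const_smul {φ : (Fin n → ℂ) → ℂ} (hφ : IsTest n Ω φ) (a : ℂ) :
    IsTest n Ω (a • φ) :=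
  ⟨contDiff_const.mul hφ.1, hφ.2.1.mul_left,
    (tsupport_mul_subset_right (f := fun _ => a) (g := φ)).trans hφ.2.2⟩

lemma isTest_zero : IsTest n Ω 0 :=
  ⟨contDiff_const, HasCompactSupport.zero, by simp [tsupport]⟩

lemma IsTest.dbarCoord {φ : (Fin n → ℂ) → ℂ} (hφ : IsTest n Ω φ) (j : Fin n) :
    IsTest n Ω (dbarCoord n φ j) :=
  ⟨contDiff_wirt hφ.1 (by norm_num), hasCompactSupport_wirt hφ.2.1,
    tsupport_wirt_subset.trans hφ.2.2⟩

lemma IsTest.memLp {φ : (Fin n → ℂ) → ℂ} (hφ : IsTest n Ω φ) :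
    MemLp φ 2 (volume.restrict Ω) :=
  (hφ.1.continuous.memLp_of_hasCompactSupport hφ.2.1).restrict Ω

lemma IsTest.integrable_mul {φ : (Fin n → ℂ) → ℂ} (hφ : IsTest n Ω φ)
    (f : Lp ℂ 2 ((volume : Measure (Fin n → ℂ)).restrict Ω)) :
    Integrable (fun z => f z * φ z) (volume.restrict Ω) :=
  (Lp.memLp f).integrable_mul hφ.memLp

variable (n Ω) in
/-- The tuples of test functions. -/
def testFields : Submodule ℂ (Fin n → (Fin n → ℂ) → ℂ) where
  carrier := {Φ | ∀ j, IsTest n Ω (Φ j)}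
  add_mem' hΦ hΨ j := (hΦ j).add (hΨ j)
  zero_mem' _ := isTest_zero
  smul_mem' a _ hΦ j := (hΦ j).const_smul a

lemma memLp_sum_dbarCoord {Φ : Fin n → (Fin n → ℂ) → ℂ} (hΦ : ∀ j, IsTest n Ω (Φ j)) :
    MemLp (fun z => ∑ j, dbarCoord n (Φ j) j z) 2 (volume.restrict Ω) :=
  memLp_finsetSum _ fun j _ => ((hΦ j).dbarCoord j).memLp

lemma IsTest.differentiable {φ : (Fin n → ℂ) → ℂ} (hφ : IsTest n Ω φ) : Differentiable ℝ φ :=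
  hφ.1.differentiable (by simp)

variable (n Ω) in
/-- The divergence `Φ ↦ ∑ ∂Φ_j/∂z̄_j` on test fields. -/
def testDiv : testFields n Ω →ₗ[ℂ] Lp ℂ 2 ((volume : Measure (Fin n → ℂ)).restrict Ω) where
  toFun Φ := (memLp_sum_dbarCoord Φ.2).toLp _
  map_add' Φ Ψ := by
    rw [← MemLp.toLp_add]
    refine MemLp.toLp_congr _ _ (.of_forall fun z => ?_)
    simp only [Pi.add_apply, ← Finset.sum_add_distrib]
    exact Finset.sum_congr rfl fun j _ =>
      wirt_add ((Φ.2 j).differentiable z) ((Ψ.2 j).differentiable z)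
  map_smul' a Φ := by
    rw [RingHom.id_apply, ← MemLp.toLp_const_smul]
    refine MemLp.toLp_congr _ _ (.of_forall fun z => ?_)
    simp only [Pi.smul_apply, smul_eq_mul, Finset.mul_sum]
    exact Finset.sum_congr rfl fun j _ => wirt_const_mul a ((Φ.2 j).differentiable z)

/-- The pairing of a form with test fields. -/
def testPairing (α : Fin n → Lp ℂ 2 ((volume : Measure (Fin n → ℂ)).restrict Ω)) :
    testFields n Ω →ₗ[ℂ] ℂ where
  toFun Φ := ∑ j, ∫ z in Ω, α j z * Φ.1 j z
  map_add' Φ Ψ := by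
    rw [← Finset.sum_add_distrib]
    refine Finset.sum_congr rfl fun j _ => ?_
    rw [← integral_add ((Φ.2 j).integrable_mul _) ((Ψ.2 j).integrable_mul _)]
    exact integral_congr_ae (.of_forall fun z => mul_add _ _ _)
  map_smul' a Φ := by
    rw [RingHom.id_apply, smul_eq_mul, Finset.mul_sum]
    refine Finset.sum_congr rfl fun j _ => ?_
    rw [← integral_const_mul]
    exact integral_congr_ae (.of_forall fun z => mul_left_comm _ _ _)

/-- A dual estimate yields a solution of `∂̄v = α` with the same bound. -/
lemma exists_dbarEq_of_dual_estimate
    (α : Fin n → Lp ℂ 2 ((volume : Measure (Fin n → ℂ)).restrict Ω)) {C : ℝ} (hC : 0 ≤ C)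
    (h : ∀ Φ : Fin n → (Fin n → ℂ) → ℂ, (∀ j, IsTest n Ω (Φ j)) →
      ‖∑ j, ∫ z in Ω, α j z * Φ j z‖
        ≤ C * Real.sqrt (∫ z in Ω, Complex.normSq (∑ j, dbarCoord n (Φ j) j z))) :
    ∃ v : Lp ℂ 2 ((volume : Measure (Fin n → ℂ)).restrict Ω),
      DbarEq n Ω (⇑v) (fun j => ⇑(α j)) ∧ ‖v‖ ≤ C := by
  obtain ⟨w, hwC, hw⟩ := exists_inner_eq_of_norm_le (testDiv n Ω) (testPairing α) hC fun Φ => by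
    refine (h Φ.1 Φ.2).trans_eq ?_
    rw [testDiv, LinearMap.coe_mk, AddHom.coe_mk, norm_toLp_eq_sqrt]
  refine ⟨-star w, fun j φ hφ => ?_, ?_⟩
  swap
  · rw [norm_neg]
    refine (Lp.norm_le_norm_of_ae_le ?_).trans hwC
    filter_upwards [Lp.coeFn_star w] with z hz
    rw [hz, Pi.star_apply, norm_star]
  have hΦ : ∀ i, IsTest n Ω (Pi.single (M := fun _ => (Fin n → ℂ) → ℂ) j φ i) := by
    intro i
    rcases eq_or_ne i j with rfl | hij
    · simpa using hφ
    · simpa [Pi.single_eq_of_ne hij] using isTest_zero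
  have h1 := hw ⟨Pi.single j φ, hΦ⟩
  have h2 : testPairing α ⟨Pi.single j φ, hΦ⟩ = ∫ z in Ω, α j z * φ z := by
    refine (Finset.sum_eq_single j (fun i _ hij => ?_) fun hn => absurd (Finset.mem_univ _) hn).trans (by simp)
    simp [Pi.single_eq_of_ne hij]
  have h3 : ∀ z, ∑ i, dbarCoord n (Pi.single (M := fun _ => (Fin n → ℂ) → ℂ) j φ i) i z
      = dbarCoord n φ j z := by
    intro z
    refine (Finset.sum_eq_single j (fun i _ hij => ?_) fun hn => absurd (Finset.mem_univ _) hn).trans (by simp)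
    simp [Pi.single_eq_of_ne hij, dbarCoord]
  rw [← h2, h1, L2.inner_def, ← integral_neg]
  refine integral_congr_ae ?_
  filter_upwards [(memLp_sum_dbarCoord hΦ).coeFn_toLp, Lp.coeFn_neg (star w), Lp.coeFn_star w]
    with z e1 e2 e3
  rw [RCLike.inner_apply, e2, Pi.neg_apply, e3]
  simp only [testDiv, LinearMap.coe_mk, AddHom.coe_mk]
  rw [e1, h3]
  simp [mul_comm]

/-- A distributional `∂̄u` is `∂̄`-closed. -/
lemma DbarEq.dbarClosed {u : (Fin n → ℂ) → ℂ} {α : Fin n → (Fin n → ℂ) → ℂ}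
    (h : DbarEq n Ω u α) : DbarClosed n Ω α := by
  intro j k φ hφ
  rw [h j _ (hφ.dbarCoord k), h k _ (hφ.dbarCoord j)]
  have : ∀ z, dbarCoord n (dbarCoord n φ k) j z = dbarCoord n (dbarCoord n φ j) k z := fun z =>
    wirt_comm (hφ.1.of_le (WithTop.coe_le_coe.2 le_top))
  simp only [this]

/-- Solvability with a bound implies the estimate on the orthogonal complement of the kernel. -/
lemma norm_le_of_orthogonal
    {f : Lp ℂ 2 ((volume : Measure (Fin n → ℂ)).restrict Ω)}
    {v : Lp ℂ 2 ((volume : Measure (Fin n → ℂ)).restrict Ω)}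
    {β : Fin n → (Fin n → ℂ) → ℂ} (hf : DbarEq n Ω (⇑f) β) (hv : DbarEq n Ω (⇑v) β)
    (horth : ∀ h : Lp ℂ 2 ((volume : Measure (Fin n → ℂ)).restrict Ω),
      DbarEq n Ω (⇑h) (fun _ _ => 0) → @inner ℂ _ _ f h = 0) : ‖f‖ ≤ ‖v‖ := by
  have h0 : inner ℂ f (f - v) = 0 := by
    refine horth _ fun j φ hφ => ?_
    have h1 := hf j φ hφ
    rw [hv j φ hφ] at h1
    have h2 : ∫ z in Ω, (f - v) z * dbarCoord n φ j z = ∫ z in Ω, (f z * dbarCoord n φ j z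
        - v z * dbarCoord n φ j z) := by
      refine integral_congr_ae ?_
      filter_upwards [Lp.coeFn_sub f v] with z hz
      rw [hz, Pi.sub_apply, sub_mul]
    rw [h2, integral_sub ((hφ.dbarCoord j).integrable_mul f) ((hφ.dbarCoord j).integrable_mul v),
      ← neg_inj.1 h1, sub_self]
    simp
  rw [inner_sub_right, sub_eq_zero] at h0
  have h1 : ‖f‖ * ‖f‖ ≤ ‖f‖ * ‖v‖ := by
    have := norm_inner_le_norm (𝕜 := ℂ) f v
    rwa [← h0, inner_self_eq_norm_sq_to_K, norm_pow, RCLike.norm_ofReal, abs_norm, sq] at this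
  rcases (norm_nonneg f).eq_or_lt with h2 | h2
  · rw [← h2]
    exact norm_nonneg v
  · exact le_of_mul_le_mul_left h1 h2

end Duality

/-- **Uniform twisted estimates on smoothly bounded domains (q = 0).**
Let `Ω ⊆ ℂⁿ` be a bounded Levi-pseudoconvex open set with smooth boundary and let
`λ, τ` be `C²` on a neighborhood of `closure Ω` with `τ > 0` there. If
`Θ_{λ,τ}(z;ξ) ≥ c₁|ξ|²e^{−λ(z)}` on `Ω` and `e^{−λ}/τ ≥ c₂ > 0` on `closure Ω`, then
(1) every `∂̄`-closed `α ∈ (L²(Ω))ⁿ` has a solution `v ∈ L²(Ω)` of `∂̄v = α` with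
`‖v‖ ≤ √(2/(c₁c₂))·‖α‖`, and (2) `‖f‖ ≤ √(2/(c₁c₂))·‖∂̄f‖` for every `f ∈ D(∂̄)`
orthogonal to `N(∂̄)`. -/
theorem bounded_uniform_estimate
    {n : ℕ} (Ω : Set (Fin n → ℂ)) (hbd : Bornology.IsBounded Ω)
    (r : (Fin n → ℂ) → ℝ) (hr : IsLeviDefiningFn n Ω r)
    (lam tau : (Fin n → ℂ) → ℝ) (U : Set (Fin n → ℂ))
    (hU : IsOpen U) (hclU : closure Ω ⊆ U)
    (hlam : ContDiffOn ℝ 2 lam U) (htau : ContDiffOn ℝ 2 tau U)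
    (htaupos : ∀ z ∈ closure Ω, 0 < tau z)
    (c₁ c₂ : ℝ) (hc₁ : 0 < c₁) (hc₂ : 0 < c₂)
    (hTheta : ∀ z ∈ Ω, ∀ ξ : Fin n → ℂ,
      c₁ * enormSq n ξ * Real.exp (-lam z) ≤ Theta n lam tau z ξ)
    (hratio : ∀ z ∈ closure Ω, c₂ ≤ Real.exp (-lam z) / tau z) :
    (∀ α : Fin n → Lp ℂ 2 ((volume : Measure (Fin n → ℂ)).restrict Ω),
      DbarClosed n Ω (fun j => ⇑(α j)) →
      ∃ v : Lp ℂ 2 ((volume : Measure (Fin n → ℂ)).restrict Ω),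
        DbarEq n Ω (⇑v) (fun j => ⇑(α j)) ∧
        ‖v‖ ≤ Real.sqrt (2 / (c₁ * c₂)) * Real.sqrt (∑ j, ‖α j‖ ^ 2)) ∧
    (∀ f : Lp ℂ 2 ((volume : Measure (Fin n → ℂ)).restrict Ω),
      ∀ β : Fin n → Lp ℂ 2 ((volume : Measure (Fin n → ℂ)).restrict Ω),
      DbarEq n Ω (⇑f) (fun j => ⇑(β j)) →
      (∀ h : Lp ℂ 2 ((volume : Measure (Fin n → ℂ)).restrict Ω),
        DbarEq n Ω (⇑h) (fun _ _ => 0) → @inner ℂ _ _ f h = 0) →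
      ‖f‖ ≤ Real.sqrt (2 / (c₁ * c₂)) * Real.sqrt (∑ j, ‖β j‖ ^ 2)) := by
  have key : ∀ α : Fin n → Lp ℂ 2 ((volume : Measure (Fin n → ℂ)).restrict Ω),
      DbarClosed n Ω (fun j => ⇑(α j)) →
      ∃ v : Lp ℂ 2 ((volume : Measure (Fin n → ℂ)).restrict Ω),
        DbarEq n Ω (⇑v) (fun j => ⇑(α j)) ∧
        ‖v‖ ≤ Real.sqrt (2 / (c₁ * c₂)) * Real.sqrt (∑ j, ‖α j‖ ^ 2) := fun α hα =>
    exists_dbarEq_of_dual_estimate α (by positivity) fun Φ hΦ =>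
      norm_sum_setIntegral_le hbd hr hclU hlam htau htaupos hc₁ hc₂ hTheta hratio hΦ α hα
  refine ⟨key, fun f β hf horth => ?_⟩
  obtain ⟨v, hv, hvC⟩ := key β hf.dbarClosed
  exact (norm_le_of_orthogonal hf hv horth).trans hvC
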